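/- Let r := √2 − 1, L := r·√(2√6 + 6) and ε := 1/173. Every FM-tetrahedron T with all four radii equal to r, with edge lengths dist(A,D), dist(B,C), dist(B,D), dist(C,D) ∈ [2r, 2r + ε] and dist(A,B), dist(A,C) ∈ [L − ε, L + ε], satisfies δ(T) ≤ δ(T₀), where T₀ is any weighted tetrahedron with all radii r and edge lengths dist(A,B) = dist(A,C) = L, dist(A,D) = dist(B,C) = dist(B,D) = dist(C,D) = 2r (the densest tetrahedron of type rrrr). -/

import Mathlib

open MeasureTheory Metric

noncomputable def tetra (A B C D : EuclideanSpace ℝ (Fin 3)) :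
    Set (EuclideanSpace ℝ (Fin 3)) :=
  convexHull ℝ {A, B, C, D}

noncomputable def density (A B C D : EuclideanSpace ℝ (Fin 3)) (rA rB rC rD : ℝ) : ℝ :=
  (volume (tetra A B C D ∩
    (closedBall A rA ∪ closedBall B rB ∪ closedBall C rC ∪ closedBall D rD))).toReal /
  (volume (tetra A B C D)).toReal


open MeasureTheory Metric

namespace RR
open Real Set
open scoped ENNReal

abbrev E3 := EuclideanSpace ℝ (Fin 3)

/-- The coordinate map `x ↦ (x₂, (x₀, x₁))`. -/
def Phi (x : E3) : ℝ × (ℝ × ℝ) := (x 2, (x 0, x 1))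

lemma Phi_mp : MeasurePreserving Phi (volume : Measure E3) volume := by
  have h1 := PiLp.volume_preserving_ofLp (Fin 3)
  have h2 := volume_preserving_piFinSuccAbove (fun _ : Fin 3 => ℝ) 2
  have h3 := (MeasurePreserving.id (volume : Measure ℝ)).prod (volume_preserving_finTwoArrow ℝ)
  have h := (h3.comp h2).comp h1
  have e : Phi = (Prod.map id (MeasurableEquiv.finTwoArrow (α := ℝ))) ∘
      (MeasurableEquiv.piFinSuccAbove (fun _ : Fin 3 => ℝ) 2) ∘ (@WithLp.ofLp 2 (Fin 3 → ℝ)) := by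
    funext x
    simp only [Phi, Function.comp, Prod.map, MeasurableEquiv.piFinSuccAbove_apply]
    rfl
  rw [e]
  exact h

/-- Mass per unit of angle of the ball of radius `ρ`. -/
noncomputable def kap (ρ : ℝ) : ℝ≥0∞ :=
  ∫⁻ z : ℝ, ∫⁻ r in Ioi (0:ℝ), ENNReal.ofReal r *
    (if r ^ 2 + z ^ 2 ≤ ρ ^ 2 then 1 else 0)

lemma hm_aux (ρ : ℝ) (A : Set (ℝ × ℝ)) (hA : MeasurableSet A) :
    MeasurableSet {p : ℝ × (ℝ × ℝ) | p.1 ^ 2 + p.2.1 ^ 2 + p.2.2 ^ 2 ≤ ρ ^ 2 ∧ p.2 ∈ A} := by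
  have e : {p : ℝ × (ℝ × ℝ) | p.1 ^ 2 + p.2.1 ^ 2 + p.2.2 ^ 2 ≤ ρ ^ 2 ∧ p.2 ∈ A} =
    {p : ℝ × (ℝ × ℝ) | p.1 ^ 2 + p.2.1 ^ 2 + p.2.2 ^ 2 ≤ ρ ^ 2} ∩ Prod.snd ⁻¹' A := by
    ext p; simp
  rw [e]
  exact (measurableSet_le (by fun_prop) (by fun_prop)).inter (measurable_snd hA)

lemma meas_prod (ρ : ℝ) (A : Set (ℝ × ℝ)) (hA : MeasurableSet A) (Θ : Set ℝ)
    (hΘ : MeasurableSet Θ)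
    (h : ∀ r t : ℝ, 0 < r → t ∈ Ioo (-π) π → ((r * cos t, r * sin t) ∈ A ↔ t ∈ Θ)) :
    volume {p : ℝ × (ℝ × ℝ) | p.1 ^ 2 + p.2.1 ^ 2 + p.2.2 ^ 2 ≤ ρ ^ 2 ∧ p.2 ∈ A} =
      kap ρ * volume (Θ ∩ Ioo (-π) π) := by
  have hm : MeasurableSet {p : ℝ × (ℝ × ℝ) | p.1 ^ 2 + p.2.1 ^ 2 + p.2.2 ^ 2 ≤ ρ ^ 2 ∧ p.2 ∈ A} :=
    hm_aux ρ A hA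
  rw [Measure.volume_eq_prod, Measure.prod_apply hm, kap, ← lintegral_mul_const]
  swap
  · refine Measurable.lintegral_prod_right' (ν := volume.restrict (Ioi (0:ℝ))) (f := fun p : ℝ × ℝ => ENNReal.ofReal p.2 *
      (if p.2 ^ 2 + p.1 ^ 2 ≤ ρ ^ 2 then 1 else 0)) ?_
    apply Measurable.mul
    · fun_prop
    · exact Measurable.ite (measurableSet_le (by fun_prop) (by fun_prop)) measurable_const measurable_const
  congr 1
  funext z
  set B : Set (ℝ × ℝ) := (Prod.mk z ⁻¹' {p : ℝ × (ℝ × ℝ) | p.1 ^ 2 + p.2.1 ^ 2 + p.2.2 ^ 2 ≤ ρ ^ 2 ∧ p.2 ∈ A}) with hB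
  have hBm : MeasurableSet B := measurable_prodMk_left hm
  rw [← lintegral_indicator_one hBm, ← lintegral_comp_polarCoord_symm]
  have e1 : ∫⁻ p in polarCoord.target, ENNReal.ofReal p.1 • B.indicator 1 (polarCoord.symm p)
      = ∫⁻ p in (Ioi (0:ℝ) ×ˢ Ioo (-π) π),
        (ENNReal.ofReal p.1 * (if p.1 ^ 2 + z ^ 2 ≤ ρ ^ 2 then 1 else 0)) * (Θ.indicator 1 p.2) := by
    rw [polarCoord_target]
    apply setLIntegral_congr_fun (measurableSet_Ioi.prod measurableSet_Ioo)
    rintro ⟨r, t⟩ ⟨hr, ht⟩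
    simp only [smul_eq_mul, mul_assoc, polarCoord_symm_apply]
    congr 1
    have hBmem : (r * cos t, r * sin t) ∈ B ↔ (r ^ 2 + z ^ 2 ≤ ρ ^ 2 ∧ t ∈ Θ) := by
      simp only [hB, mem_preimage, mem_ofPred_eq]
      rw [h r t hr ht]
      have : z ^ 2 + (r * cos t) ^ 2 + (r * sin t) ^ 2 = r ^ 2 + z ^ 2 := by
        have := sin_sq_add_cos_sq t
        linear_combination r ^ 2 * this
      rw [this]
    by_cases h1 : r ^ 2 + z ^ 2 ≤ ρ ^ 2 <;> by_cases h2 : t ∈ Θ <;>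
      simp [indicator, hBmem, h1, h2]
  rw [e1, Measure.volume_eq_prod, ← Measure.prod_restrict,
    lintegral_prod_mul (f := fun r : ℝ => ENNReal.ofReal r * (if r ^ 2 + z ^ 2 ≤ ρ ^ 2 then 1 else 0))
      (g := Θ.indicator 1)]
  · rw [lintegral_indicator_one hΘ, Measure.restrict_apply hΘ]
  · apply Measurable.aemeasurable
    apply Measurable.mul
    · fun_prop
    · exact Measurable.ite (measurableSet_le (by fun_prop) (by fun_prop)) measurable_const measurable_const
  · exact (measurable_one.indicator hΘ).aemeasurable

lemma normsq3 (x : E3) : ‖x‖ ^ 2 = x 0 ^ 2 + x 1 ^ 2 + x 2 ^ 2 := by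
  rw [EuclideanSpace.norm_sq_eq, Fin.sum_univ_three]
  simp

lemma meas_E3 (ρ : ℝ) (hρ : 0 ≤ ρ) (A : Set (ℝ × ℝ)) (hA : MeasurableSet A) (Θ : Set ℝ)
    (hΘ : MeasurableSet Θ)
    (h : ∀ r t : ℝ, 0 < r → t ∈ Ioo (-π) π → ((r * cos t, r * sin t) ∈ A ↔ t ∈ Θ)) :
    volume (closedBall (0 : E3) ρ ∩ {x | (x 0, x 1) ∈ A}) =
      kap ρ * volume (Θ ∩ Ioo (-π) π) := by
  rw [← meas_prod ρ A hA Θ hΘ h, ← Phi_mp.measure_preimage]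
  · congr 1
    ext x
    simp only [mem_inter_iff, mem_closedBall_zero_iff, mem_ofPred_eq, mem_preimage, Phi]
    rw [← abs_of_nonneg hρ, ← abs_of_nonneg (norm_nonneg x), ← sq_le_sq, normsq3]
    simp only [abs_of_nonneg hρ]
    constructor <;> rintro ⟨h1, h2⟩ <;> exact ⟨by linarith, h2⟩
  · exact (hm_aux ρ A hA).nullMeasurableSet

lemma kap_ball (ρ : ℝ) (hρ : 0 ≤ ρ) :
    volume (closedBall (0 : E3) ρ) = kap ρ * ENNReal.ofReal (2 * π) := by
  have := meas_E3 ρ hρ univ MeasurableSet.univ univ MeasurableSet.univ (by simp)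
  simp only [mem_univ, ofPred_true, inter_univ, univ_inter, Real.volume_Ioo] at this
  rw [this]
  congr 2
  ring

lemma kap_ne_top (ρ : ℝ) (hρ : 0 ≤ ρ) : kap ρ ≠ ⊤ := by
  intro h
  have h1 := kap_ball ρ hρ
  rw [h, ENNReal.top_mul (by simp [pi_pos])] at h1
  exact measure_closedBall_lt_top.ne h1

/-- Volume of the standard wedge. -/
lemma wedge_std (ρ : ℝ) (hρ : 0 ≤ ρ) (φ : ℝ) (h0 : 0 ≤ φ) (h1 : φ < π) :
    volume (closedBall (0 : E3) ρ ∩ {x | 0 ≤ x 0 ∧ 0 ≤ cos φ * x 0 + sin φ * x 1}) =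
      kap ρ * ENNReal.ofReal (π - φ) := by
  have := meas_E3 ρ hρ {p : ℝ × ℝ | 0 ≤ p.1 ∧ 0 ≤ cos φ * p.1 + sin φ * p.2}
    (by
      have e : {p : ℝ × ℝ | 0 ≤ p.1 ∧ 0 ≤ cos φ * p.1 + sin φ * p.2} =
        {p : ℝ × ℝ | 0 ≤ p.1} ∩ {p : ℝ × ℝ | 0 ≤ cos φ * p.1 + sin φ * p.2} := by
        ext p; simp
      rw [e]
      exact (measurableSet_le (by fun_prop) (by fun_prop)).inter
        (measurableSet_le (by fun_prop) (by fun_prop))) (Icc (φ - π / 2) (π / 2)) measurableSet_Icc ?_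
  · simp only [mem_ofPred_eq] at this
    rw [this]
    congr 1
    have : volume (Icc (φ - π / 2) (π / 2) ∩ Ioo (-π) π) = volume (Icc (φ - π / 2) (π / 2)) := by
      congr 1
      apply inter_eq_left.2
      intro t ht
      exact ⟨by linarith [ht.1, pi_pos], by linarith [ht.2, pi_pos]⟩
    rw [this, Real.volume_Icc]
    congr 1
    ring
  · intro r t hr ht
    simp only [mem_ofPred_eq, mem_Icc]
    have e : cos φ * (r * cos t) + sin φ * (r * sin t) = r * cos (t - φ) := by
      rw [cos_sub]; ring
    rw [e, mul_nonneg_iff_of_pos_left hr, mul_nonneg_iff_of_pos_left hr]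
    constructor
    · rintro ⟨h2, h3⟩
      have ht2 : t ≤ π / 2 := by
        by_contra hc
        push Not at hc
        have := cos_neg_of_pi_div_two_lt_of_lt hc (by linarith [ht.2, pi_pos])
        linarith
      have ht3 : -(π / 2) ≤ t := by
        by_contra hc
        push Not at hc
        have := cos_neg_of_pi_div_two_lt_of_lt (x := -t) (by linarith) (by linarith [ht.1, pi_pos])
        rw [cos_neg] at this
        linarith
      refine ⟨?_, ht2⟩
      by_contra hc
      push Not at hc
      have := cos_neg_of_pi_div_two_lt_of_lt (x := -(t - φ)) (by linarith) (by linarith [ht.1, pi_pos])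
      rw [cos_neg] at this
      linarith
    · rintro ⟨h2, h3⟩
      exact ⟨cos_nonneg_of_mem_Icc ⟨by linarith, h3⟩, cos_nonneg_of_mem_Icc ⟨by linarith, by linarith⟩⟩

end RR


open MeasureTheory Metric

namespace RR
open Real Set
open scoped ENNReal

lemma wedge (ρ : ℝ) (hρ : 0 ≤ ρ) (n m : E3) (φ : ℝ) (h0 : 0 < φ) (h1 : φ < π)
    (hn : n ≠ 0) (hm : m ≠ 0) (hc : inner ℝ n m = ‖n‖ * ‖m‖ * cos φ) :
    volume (closedBall (0 : E3) ρ ∩ {x | 0 ≤ inner ℝ n x ∧ 0 ≤ inner ℝ m x}) =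
      kap ρ * ENNReal.ofReal (π - φ) := by
  have hs : 0 < sin φ := sin_pos_of_pos_of_lt_pi h0 h1
  have hn' : 0 < ‖n‖ := norm_pos_iff.2 hn
  have hm' : 0 < ‖m‖ := norm_pos_iff.2 hm
  have hsc := sin_sq_add_cos_sq φ
  obtain ⟨e1, he1⟩ : ∃ e1 : E3, e1 = ‖n‖⁻¹ • n := ⟨_, rfl⟩
  obtain ⟨m₁, hm₁⟩ : ∃ m₁ : E3, m₁ = ‖m‖⁻¹ • m := ⟨_, rfl⟩
  obtain ⟨e2, he2⟩ : ∃ e2 : E3, e2 = (sin φ)⁻¹ • (m₁ - cos φ • e1) := ⟨_, rfl⟩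
  have hn1 : n = ‖n‖ • e1 := by rw [he1, smul_smul, mul_inv_cancel₀ hn'.ne', one_smul]
  have hm1 : m = ‖m‖ • (cos φ • e1 + sin φ • e2) := by
    rw [he2, smul_smul (sin φ), mul_inv_cancel₀ hs.ne', one_smul, add_sub_cancel, hm₁, smul_smul,
      mul_inv_cancel₀ hm'.ne', one_smul]
  have i11 : inner ℝ e1 e1 = (1:ℝ) := by
    rw [he1, inner_smul_left, inner_smul_right, real_inner_self_eq_norm_sq]
    simp; field_simp
  have i1m : inner ℝ e1 m₁ = cos φ := by
    rw [he1, hm₁, inner_smul_left, inner_smul_right, hc]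
    simp; field_simp
  have imm : inner ℝ m₁ m₁ = (1:ℝ) := by
    rw [hm₁, inner_smul_left, inner_smul_right, real_inner_self_eq_norm_sq]
    simp; field_simp
  have i12 : inner ℝ e1 e2 = (0:ℝ) := by
    rw [he2, inner_smul_right, inner_sub_right, i1m, inner_smul_right, i11]
    simp
  have i22 : inner ℝ e2 e2 = (1:ℝ) := by
    have : inner ℝ e2 e2 = (sin φ)⁻¹ * (sin φ)⁻¹ * (1 - cos φ ^ 2) := by
      conv_lhs => rw [he2]
      rw [inner_smul_left, inner_smul_right, inner_sub_left, inner_sub_right, inner_sub_right,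
        imm, inner_smul_left, inner_smul_left, inner_smul_right, inner_smul_right, i11, real_inner_comm e1 m₁, i1m]
      simp only [conj_trivial]
      ring
    rw [this]
    field_simp
    linarith
  have hon : Orthonormal ℝ (({0, 1} : Set (Fin 3)).domRestrict ![e1, e2, 0]) := by
    have n1 : ‖e1‖ = 1 := by
      rw [norm_eq_sqrt_real_inner, i11, sqrt_one]
    have n2 : ‖e2‖ = 1 := by
      rw [norm_eq_sqrt_real_inner, i22, sqrt_one]
    have i21 : inner ℝ e2 e1 = (0:ℝ) := by rw [real_inner_comm, i12]
    constructor
    · rintro ⟨i, hi⟩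
      rcases hi with rfl | rfl
      · exact n1
      · exact n2
    · rintro ⟨i, hi⟩ ⟨j, hj⟩ hij
      rcases hi with rfl | rfl <;> rcases hj with rfl | rfl
      · exact absurd rfl hij
      · exact i12
      · exact i21
      · exact absurd rfl hij
  obtain ⟨b, hb⟩ := hon.exists_orthonormalBasis_extension_of_card_eq (by simp)
  have hb0 : b 0 = e1 := by rw [hb 0 (by simp)]; rfl
  have hb1 : b 1 = e2 := by rw [hb 1 (by simp)]; rfl
  rw [← wedge_std ρ hρ φ h0.le h1, ← b.measurePreserving_repr.measure_preimage
      (s := closedBall (0 : E3) ρ ∩ {x | 0 ≤ x 0 ∧ 0 ≤ cos φ * x 0 + sin φ * x 1})]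
  swap
  · have e : {x : E3 | 0 ≤ x 0 ∧ 0 ≤ cos φ * x 0 + sin φ * x 1} =
        {x : E3 | 0 ≤ x 0} ∩ {x : E3 | 0 ≤ cos φ * x 0 + sin φ * x 1} := by
      ext p; simp
    rw [e]
    exact (measurableSet_closedBall.inter ((measurableSet_le (by fun_prop) (by fun_prop)).inter
        (measurableSet_le (by fun_prop) (by fun_prop)))).nullMeasurableSet
  congr 1
  ext x
  simp only [mem_inter_iff, mem_preimage, mem_closedBall_zero_iff, mem_ofPred_eq]
  have r0 : inner ℝ n x = ‖n‖ * b.repr x 0 := by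
    rw [b.repr_apply_apply, hb0]
    conv_lhs => rw [hn1]
    rw [inner_smul_left]; simp
  have r1 : inner ℝ m x = ‖m‖ * (cos φ * b.repr x 0 + sin φ * b.repr x 1) := by
    rw [b.repr_apply_apply, b.repr_apply_apply, hb0, hb1]
    conv_lhs => rw [hm1]
    rw [inner_smul_left, inner_add_left, inner_smul_left, inner_smul_left]; simp
  rw [r0, r1, mul_nonneg_iff_of_pos_left hn', mul_nonneg_iff_of_pos_left hm',
    LinearIsometryEquiv.norm_map]

lemma null_plane (n : E3) (hn : n ≠ 0) : volume {x : E3 | inner ℝ n x = (0:ℝ)} = 0 := by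
  have h := Measure.addHaar_submodule (volume : Measure E3) ((innerSL ℝ n).toLinearMap.ker) ?_
  · convert h using 2
    ext x
    simp [LinearMap.mem_ker]
  · intro h
    have : n ∈ (innerSL ℝ n).toLinearMap.ker := by rw [h]; trivial
    simp [LinearMap.mem_ker] at this
    exact hn this

lemma meas_H (n : E3) : MeasurableSet {x : E3 | 0 ≤ inner ℝ n x} :=
  measurableSet_le (by fun_prop) (by fun_prop)

lemma ae_ne (n : E3) (hn : n ≠ 0) (μ : Measure E3) (hμ : μ ≪ volume) :
    ∀ᵐ x ∂μ, inner ℝ n x ≠ (0:ℝ) := by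
  have h : ∀ᵐ x ∂(volume : Measure E3), inner ℝ n x ≠ (0:ℝ) := by
    rw [ae_iff]
    simpa using null_plane n hn
  exact hμ.ae_le h

lemma neg_inv (ρ : ℝ) (s : Set E3) :
    (volume.restrict (closedBall (0:E3) ρ)).real (Neg.neg ⁻¹' s) =
      (volume.restrict (closedBall (0:E3) ρ)).real s := by
  rw [measureReal_restrict_apply' measurableSet_closedBall,
    measureReal_restrict_apply' measurableSet_closedBall]
  unfold Measure.real
  congr 1
  rw [← Measure.measure_preimage_neg volume (s ∩ _)]
  congr 1
  ext x
  simp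

lemma girard (ρ : ℝ) (hρ : 0 ≤ ρ) (n1 n2 n3 : E3) (φ12 φ13 φ23 : ℝ)
    (h12 : 0 < φ12) (h12' : φ12 < π) (h13 : 0 < φ13) (h13' : φ13 < π)
    (h23 : 0 < φ23) (h23' : φ23 < π)
    (hn1 : n1 ≠ 0) (hn2 : n2 ≠ 0) (hn3 : n3 ≠ 0)
    (hc12 : inner ℝ n1 n2 = ‖n1‖ * ‖n2‖ * cos φ12)
    (hc13 : inner ℝ n1 n3 = ‖n1‖ * ‖n3‖ * cos φ13)
    (hc23 : inner ℝ n2 n3 = ‖n2‖ * ‖n3‖ * cos φ23) :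
    (volume (closedBall (0 : E3) ρ ∩
      {x | 0 ≤ inner ℝ n1 x ∧ 0 ≤ inner ℝ n2 x ∧ 0 ≤ inner ℝ n3 x})).toReal =
      (kap ρ).toReal / 2 * (2 * π - φ12 - φ13 - φ23) := by
  set μ := volume.restrict (closedBall (0:E3) ρ) with hμ
  have hac : μ ≪ volume := Measure.absolutelyContinuous_of_le Measure.restrict_le_self
  haveI : IsFiniteMeasure μ := ⟨by
    rw [hμ, Measure.restrict_apply_univ]; exact measure_closedBall_lt_top⟩
  set H : E3 → Set E3 := fun n => {x | 0 ≤ inner ℝ n x} with hH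
  have mH : ∀ n, MeasurableSet (H n) := meas_H
  set k := (kap ρ).toReal with hk
  have W : ∀ (n m : E3) (φ : ℝ), 0 < φ → φ < π → n ≠ 0 → m ≠ 0 →
      inner ℝ n m = ‖n‖ * ‖m‖ * cos φ → μ.real (H n ∩ H m) = k * (π - φ) := by
    intro n m φ h0 h1 hn hm hc
    have := wedge ρ hρ n m φ h0 h1 hn hm hc
    rw [hμ, measureReal_restrict_apply' measurableSet_closedBall, inter_comm]
    unfold Measure.real
    have e : closedBall (0:E3) ρ ∩ (H n ∩ H m) = closedBall (0:E3) ρ ∩ {x | 0 ≤ inner ℝ n x ∧ 0 ≤ inner ℝ m x} := by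
      ext x; simp [hH]
    rw [e, this, ENNReal.toReal_mul, ENNReal.toReal_ofReal (by linarith)]
  have tot : μ.real univ = k * (2 * π) := by
    unfold Measure.real
    rw [hμ, Measure.restrict_apply_univ, kap_ball ρ hρ, ENNReal.toReal_mul,
      ENNReal.toReal_ofReal (by linarith [pi_pos])]
  have half : ∀ n : E3, n ≠ 0 → μ.real (H n) = k * π := by
    intro n hn
    have h1 : μ.real (H n)ᶜ = μ.real (H n) := by
      rw [← neg_inv ρ (H n), measureReal_congr]
      filter_upwards [ae_ne n hn μ hac] with x hx
      apply propext
      change (¬ (0 ≤ inner ℝ n x)) ↔ (0 ≤ inner ℝ n (-x))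
      rw [inner_neg_right, not_le]
      constructor
      · intro h; linarith
      · intro h; exact lt_of_le_of_ne (by linarith) hx
    have h2 := measureReal_add_measureReal_compl (μ := μ) (mH n)
    rw [tot] at h2
    linarith
  have hcompl : μ.real ((H n1 ∪ H n2) ∪ H n3)ᶜ = μ.real (H n1 ∩ H n2 ∩ H n3) := by
    rw [← neg_inv ρ (H n1 ∩ H n2 ∩ H n3), measureReal_congr]
    filter_upwards [ae_ne n1 hn1 μ hac, ae_ne n2 hn2 μ hac, ae_ne n3 hn3 μ hac] with x hx1 hx2 hx3
    apply propext
    change (¬ ((0 ≤ inner ℝ n1 x ∨ 0 ≤ inner ℝ n2 x) ∨ 0 ≤ inner ℝ n3 x)) ↔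
      ((0 ≤ inner ℝ n1 (-x) ∧ 0 ≤ inner ℝ n2 (-x)) ∧ 0 ≤ inner ℝ n3 (-x))
    simp only [inner_neg_right, not_or, not_le]
    constructor
    · rintro ⟨⟨a, b⟩, c⟩
      exact ⟨⟨by linarith, by linarith⟩, by linarith⟩
    · rintro ⟨⟨a, b⟩, c⟩
      exact ⟨⟨lt_of_le_of_ne (by linarith) hx1, lt_of_le_of_ne (by linarith) hx2⟩,
        lt_of_le_of_ne (by linarith) hx3⟩
  have a1 := measureReal_union_add_inter (μ := μ) (s := H n1) (t := H n2) (mH n2)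
  have a2 := measureReal_union_add_inter (μ := μ) (s := H n1 ∪ H n2) (t := H n3) (mH n3)
  have a3 := measureReal_union_add_inter (μ := μ) (s := H n1 ∩ H n3) (t := H n2 ∩ H n3)
    ((mH n2).inter (mH n3))
  have a4 := measureReal_add_measureReal_compl (μ := μ) (((mH n1).union (mH n2)).union (mH n3))
  have e1 : (H n1 ∪ H n2) ∩ H n3 = (H n1 ∩ H n3) ∪ (H n2 ∩ H n3) := union_inter_distrib_right _ _ _
  have e2 : (H n1 ∩ H n3) ∩ (H n2 ∩ H n3) = H n1 ∩ H n2 ∩ H n3 := by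
    ext x; simp only [mem_inter_iff]; tauto
  rw [e1] at a2
  rw [e2] at a3
  rw [hcompl, tot] at a4
  rw [half n1 hn1, half n2 hn2, W n1 n2 φ12 h12 h12' hn1 hn2 hc12] at a1
  rw [half n3 hn3] at a2
  rw [W n1 n3 φ13 h13 h13' hn1 hn3 hc13, W n2 n3 φ23 h23 h23' hn2 hn3 hc23] at a3
  have e3 : (volume (closedBall (0 : E3) ρ ∩
      {x | 0 ≤ inner ℝ n1 x ∧ 0 ≤ inner ℝ n2 x ∧ 0 ≤ inner ℝ n3 x})).toReal =
      μ.real (H n1 ∩ H n2 ∩ H n3) := by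
    rw [hμ, measureReal_restrict_apply' measurableSet_closedBall, inter_comm]
    unfold Measure.real
    congr 2
    ext x
    simp [hH, and_assoc]
  rw [e3]
  linarith

end RR


open MeasureTheory Metric
namespace RR
open Real Set
open scoped ENNReal

lemma kap_pos (ρ : ℝ) (hρ : 0 < ρ) : 0 < (kap ρ).toReal := by
  apply ENNReal.toReal_pos _ (kap_ne_top ρ hρ.le)
  intro h
  have h1 := kap_ball ρ hρ.le
  rw [h, zero_mul] at h1
  exact (measure_closedBall_pos volume (0:E3) hρ).ne' h1

/-- Angle with prescribed scaled cosine and sine. -/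
lemma ang_ex (x y A B : ℝ) (hA : 0 < A) (hB : 0 < B) (hy : 0 < y) (h : x ^ 2 + y ^ 2 = A * B) :
    ∃ φ, 0 < φ ∧ φ < π ∧ cos φ * (√A * √B) = x ∧ sin φ * (√A * √B) = y := by
  have hs : 0 < √A * √B := by positivity
  have hs2 : (√A * √B) ^ 2 = A * B := by rw [mul_pow, sq_sqrt hA.le, sq_sqrt hB.le]
  have hlt : |x / (√A * √B)| < 1 := by
    rw [abs_div, abs_of_pos hs, div_lt_one hs]
    apply abs_lt_of_sq_lt_sq _ hs.le
    nlinarith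
  have h1 := abs_lt.1 hlt
  have hc : cos (arccos (x / (√A * √B))) * (√A * √B) = x := by
    rw [cos_arccos h1.1.le h1.2.le]; field_simp
  refine ⟨arccos (x / (√A * √B)), arccos_pos.2 h1.2, ?_, hc, ?_⟩
  · rw [← arccos_neg_one]
    exact arccos_lt_arccos le_rfl h1.1 h1.2.le
  · have hsn : 0 ≤ sin (arccos (x / (√A * √B))) :=
      sin_nonneg_of_nonneg_of_le_pi (arccos_nonneg _) (arccos_le_pi _)
    have := sin_sq_add_cos_sq (arccos (x / (√A * √B)))
    have e : (sin (arccos (x / (√A * √B))) * (√A * √B)) ^ 2 = y ^ 2 := by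
      have : (sin (arccos (x / (√A * √B))) * (√A * √B)) ^ 2 =
        (√A * √B)^2 - (cos (arccos (x / (√A * √B))) * (√A * √B)) ^ 2 := by
        linear_combination (√A * √B)^2 * this
      rw [this, hc, hs2]; linarith
    exact (pow_left_inj₀ (by positivity) hy.le two_ne_zero).1 e

lemma solid_ang_aux (la lb lc p q s N d Ω φ1 φ2 φ3 A B C rA rB rC : ℝ) (hN : 0 < N) (hd : 0 < d)
    (hG : N ^ 2 = la ^ 2 * lb ^ 2 * lc ^ 2 + 2 * p * q * s - la ^ 2 * p ^ 2 - lb ^ 2 * q ^ 2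
      - lc ^ 2 * s ^ 2)
    (hdd : d = la * lb * lc + la * p + lb * q + lc * s)
    (eA : A = lb ^ 2 * lc ^ 2 - p ^ 2) (eB : B = la ^ 2 * lc ^ 2 - q ^ 2)
    (eC : C = la ^ 2 * lb ^ 2 - s ^ 2) (hA : 0 < A) (hB : 0 < B) (hC : 0 < C)
    (hrA : rA ^ 2 = A) (hrB : rB ^ 2 = B) (hrC : rC ^ 2 = C)
    (c1 : cos φ1 * (rA * rB) = p * q - s * lc ^ 2) (s1 : sin φ1 * (rA * rB) = lc * N)
    (c2 : cos φ2 * (rA * rC) = p * s - q * lb ^ 2) (s2 : sin φ2 * (rA * rC) = lb * N)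
    (c3 : cos φ3 * (rB * rC) = q * s - p * la ^ 2) (s3 : sin φ3 * (rB * rC) = la * N)
    (hΩ : Ω = 2 * π - φ1 - φ2 - φ3) (h0 : 0 ≤ Ω) (h1 : Ω < 2 * π) :
    Ω = 2 * arctan (N / d) := by
  have hK : cos (φ1 + φ2 + φ3) * (A * B * C) =
      (lb * lc - p) * (la * lc - q) * (la * lb - s) / 2 * (d ^ 2 - N ^ 2) := by
    have : cos (φ1 + φ2 + φ3) * (A * B * C) =
      (cos φ1 * (rA * rB)) * (cos φ2 * (rA * rC)) * (cos φ3 * (rB * rC))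
      - (cos φ1 * (rA * rB)) * (sin φ2 * (rA * rC)) * (sin φ3 * (rB * rC))
      - (sin φ1 * (rA * rB)) * (cos φ2 * (rA * rC)) * (sin φ3 * (rB * rC))
      - (sin φ1 * (rA * rB)) * (sin φ2 * (rA * rC)) * (cos φ3 * (rB * rC)) := by
      rw [cos_add, sin_add, cos_add, ← hrA, ← hrB, ← hrC]; ring
    rw [this, c1, c2, c3, s1, s2, s3, hdd]
    have e2 : ∀ G, N ^ 2 = G → (p * q - s * lc ^ 2) * (p * s - q * lb ^ 2) * (q * s - p * la ^ 2) - (p * q - s * lc ^ 2) * (lb * N) * (la * N) - lc * N * (p * s - q * lb ^ 2) * (la * N) -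
      lc * N * (lb * N) * (q * s - p * la ^ 2) = (p * q - s * lc ^ 2) * (p * s - q * lb ^ 2) * (q * s - p * la ^ 2) - G * ((p * q - s * lc ^ 2) * lb * la + lc * (p * s - q * lb ^ 2) * la +
      lc * lb * (q * s - p * la ^ 2)) := by
      intro G h; rw [← h]; ring
    rw [e2 _ hG, hG]
    ring
  have hS : sin (φ1 + φ2 + φ3) * (A * B * C) =
      -((lb * lc - p) * (la * lc - q) * (la * lb - s) / 2 * (2 * d * N)) := by
    have : sin (φ1 + φ2 + φ3) * (A * B * C) =
      (sin φ1 * (rA * rB)) * (cos φ2 * (rA * rC)) * (cos φ3 * (rB * rC))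
      + (cos φ1 * (rA * rB)) * (sin φ2 * (rA * rC)) * (cos φ3 * (rB * rC))
      + (cos φ1 * (rA * rB)) * (cos φ2 * (rA * rC)) * (sin φ3 * (rB * rC))
      - (sin φ1 * (rA * rB)) * (sin φ2 * (rA * rC)) * (sin φ3 * (rB * rC)) := by
      rw [sin_add, cos_add, sin_add, ← hrA, ← hrB, ← hrC]; ring
    rw [this, c1, c2, c3, s1, s2, s3, hdd]
    linear_combination (-la * lb * lc * N) * hG
  have hABC : A * B * C = (lb * lc - p) * (la * lc - q) * (la * lb - s) / 2 * (d ^ 2 + N ^ 2) := by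
    rw [hdd, hG, eA, eB, eC]; ring
  have hP : 0 < A * B * C := by positivity
  have hD : 0 < d ^ 2 + N ^ 2 := by positivity
  obtain ⟨K, hKe⟩ : ∃ K, K = (lb * lc - p) * (la * lc - q) * (la * lb - s) / 2 := ⟨_, rfl⟩
  rw [← hKe] at hK hS hABC
  have hK0 : K ≠ 0 := by rintro rfl; rw [zero_mul] at hABC; linarith
  have hc : cos Ω = (d ^ 2 - N ^ 2) / (d ^ 2 + N ^ 2) := by
    have : Ω = 2 * π - (φ1 + φ2 + φ3) := by rw [hΩ]; ring
    rw [this, cos_two_pi_sub, eq_div_iff hD.ne']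
    rw [hABC] at hK
    have : K * (cos (φ1 + φ2 + φ3) * (d ^ 2 + N ^ 2)) = K * (d ^ 2 - N ^ 2) := by linarith
    exact mul_left_cancel₀ hK0 this
  have hs : sin Ω = (2 * d * N) / (d ^ 2 + N ^ 2) := by
    have : Ω = 2 * π - (φ1 + φ2 + φ3) := by rw [hΩ]; ring
    rw [this, sin_two_pi_sub, eq_div_iff hD.ne']
    rw [hABC] at hS
    have : K * (-sin (φ1 + φ2 + φ3) * (d ^ 2 + N ^ 2)) = K * (2 * d * N) := by linarith
    exact mul_left_cancel₀ hK0 this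
  have hat : 0 < arctan (N / d) := arctan_pos.2 (by positivity)
  have hat2 := arctan_lt_pi_div_two (N / d)
  have hcs := cos_sq_arctan (N / d)
  have hc' : cos (2 * arctan (N / d)) = (d ^ 2 - N ^ 2) / (d ^ 2 + N ^ 2) := by
    rw [cos_two_mul, hcs]; field_simp; ring
  have hs' : sin (2 * arctan (N / d)) = (2 * d * N) / (d ^ 2 + N ^ 2) := by
    have hcp := cos_arctan_pos (N / d)
    have : sin (arctan (N/d)) = N / d * cos (arctan (N/d)) := by
      have := tan_mul_cos hcp.ne'
      rw [tan_arctan] at this; exact this.symm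
    rw [sin_two_mul, this]
    have : 2 * (N / d * cos (arctan (N / d))) * cos (arctan (N / d)) =
      2 * (N / d) * cos (arctan (N / d)) ^ 2 := by ring
    rw [this, hcs]; field_simp
  have h1' : cos (Ω - 2 * arctan (N / d)) = 1 := by
    rw [cos_sub, hc, hs, hc', hs']; field_simp; ring
  have := (cos_eq_one_iff_of_lt_of_lt (by linarith) (by linarith)).1 h1'
  linarith

noncomputable def cone3 (n1 n2 n3 : E3) : Set E3 :=
  {x | 0 ≤ inner ℝ n1 x ∧ 0 ≤ inner ℝ n2 x ∧ 0 ≤ inner ℝ n3 x}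

/-- Volume of a spherical sector. -/
lemma solid_angle (ρ : ℝ) (hρ : 0 < ρ) (a b c n1 n2 n3 : E3) (la lb lc p q s N d : ℝ)
    (ha : inner ℝ a a = la ^ 2) (hb : inner ℝ b b = lb ^ 2) (hc : inner ℝ c c = lc ^ 2)
    (hp : inner ℝ b c = p) (hq : inner ℝ a c = q) (hs : inner ℝ a b = s)
    (pa : 0 < la) (pb : 0 < lb) (pc : 0 < lc)
    (hN : 0 < N) (hd : 0 < d)
    (hG : N ^ 2 = la ^ 2 * lb ^ 2 * lc ^ 2 + 2 * p * q * s - la ^ 2 * p ^ 2 - lb ^ 2 * q ^ 2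
      - lc ^ 2 * s ^ 2)
    (hdd : d = la * lb * lc + la * p + lb * q + lc * s)
    (h1 : n1 = (lb ^ 2 * lc ^ 2 - p ^ 2) • a + (p * q - s * lc ^ 2) • b + (p * s - q * lb ^ 2) • c)
    (h2 : n2 = (p * q - s * lc ^ 2) • a + (la ^ 2 * lc ^ 2 - q ^ 2) • b + (q * s - p * la ^ 2) • c)
    (h3 : n3 = (p * s - q * lb ^ 2) • a + (q * s - p * la ^ 2) • b + (la ^ 2 * lb ^ 2 - s ^ 2) • c) :
    (volume (closedBall (0 : E3) ρ ∩ cone3 n1 n2 n3)).toReal = (kap ρ).toReal * arctan (N / d) := by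
  have hs' : inner ℝ b a = s := by rw [real_inner_comm]; exact hs
  have hq' : inner ℝ c a = q := by rw [real_inner_comm]; exact hq
  have hp' : inner ℝ c b = p := by rw [real_inner_comm]; exact hp
  have cs : ∀ x y : E3, inner ℝ x y ^ 2 ≤ inner ℝ x x * inner ℝ y y := fun x y => by
    have := real_inner_mul_inner_self_le x y
    nlinarith
  have hA0 : 0 ≤ lb ^ 2 * lc ^ 2 - p ^ 2 := by have := cs b c; rw [hb, hc, hp] at this; linarith
  have hB0 : 0 ≤ la ^ 2 * lc ^ 2 - q ^ 2 := by have := cs a c; rw [ha, hc, hq] at this; linarith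
  have hC0 : 0 ≤ la ^ 2 * lb ^ 2 - s ^ 2 := by have := cs a b; rw [ha, hb, hs] at this; linarith
  obtain ⟨A, eA⟩ : ∃ A, A = lb ^ 2 * lc ^ 2 - p ^ 2 := ⟨_, rfl⟩
  obtain ⟨B, eB⟩ : ∃ B, B = la ^ 2 * lc ^ 2 - q ^ 2 := ⟨_, rfl⟩
  obtain ⟨C, eC⟩ : ∃ C, C = la ^ 2 * lb ^ 2 - s ^ 2 := ⟨_, rfl⟩
  have i1 : (p * q - s * lc ^ 2) ^ 2 + (lc * N) ^ 2 = A * B := by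
    rw [mul_pow, hG, eA, eB]; ring
  have i2 : (p * s - q * lb ^ 2) ^ 2 + (lb * N) ^ 2 = A * C := by
    rw [mul_pow, hG, eA, eC]; ring
  have i3 : (q * s - p * la ^ 2) ^ 2 + (la * N) ^ 2 = B * C := by
    rw [mul_pow, hG, eB, eC]; ring
  have hAB : 0 < A * B := by rw [← i1]; positivity
  have hAC : 0 < A * C := by rw [← i2]; positivity
  rw [← eA] at hA0; rw [← eB] at hB0; rw [← eC] at hC0
  have hA : 0 < A := lt_of_le_of_ne hA0 (by rintro rfl; simp at hAB)
  have hB : 0 < B := pos_of_mul_pos_right hAB hA0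
  have hC : 0 < C := pos_of_mul_pos_right hAC hA0
  obtain ⟨φ1, p1, p1', c1, s1⟩ := ang_ex _ _ A B hA hB (by positivity) i1
  obtain ⟨φ2, p2, p2', c2, s2⟩ := ang_ex _ _ A C hA hC (by positivity) i2
  obtain ⟨φ3, p3, p3', c3, s3⟩ := ang_ex _ _ B C hB hC (by positivity) i3
  have nn1 : inner ℝ n1 n1 = N ^ 2 * A := by
    rw [h1]
    simp only [inner_add_left, inner_add_right, inner_smul_left, inner_smul_right, ha, hb, hc, hp, hq, hs, hp', hq', hs', conj_trivial]
    rw [hG, eA]; ring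
  have nn2 : inner ℝ n2 n2 = N ^ 2 * B := by
    rw [h2]
    simp only [inner_add_left, inner_add_right, inner_smul_left, inner_smul_right, ha, hb, hc, hp, hq, hs, hp', hq', hs', conj_trivial]
    rw [hG, eB]; ring
  have nn3 : inner ℝ n3 n3 = N ^ 2 * C := by
    rw [h3]
    simp only [inner_add_left, inner_add_right, inner_smul_left, inner_smul_right, ha, hb, hc, hp, hq, hs, hp', hq', hs', conj_trivial]
    rw [hG, eC]; ring
  have n12 : inner ℝ n1 n2 = N ^ 2 * (p * q - s * lc ^ 2) := by
    rw [h1, h2]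
    simp only [inner_add_left, inner_add_right, inner_smul_left, inner_smul_right, ha, hb, hc, hp, hq, hs, hp', hq', hs', conj_trivial]
    rw [hG]; ring
  have n13 : inner ℝ n1 n3 = N ^ 2 * (p * s - q * lb ^ 2) := by
    rw [h1, h3]
    simp only [inner_add_left, inner_add_right, inner_smul_left, inner_smul_right, ha, hb, hc, hp, hq, hs, hp', hq', hs', conj_trivial]
    rw [hG]; ring
  have n23 : inner ℝ n2 n3 = N ^ 2 * (q * s - p * la ^ 2) := by
    rw [h2, h3]
    simp only [inner_add_left, inner_add_right, inner_smul_left, inner_smul_right, ha, hb, hc, hp, hq, hs, hp', hq', hs', conj_trivial]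
    rw [hG]; ring
  have nrm : ∀ (n : E3) (A : ℝ), inner ℝ n n = N ^ 2 * A → ‖n‖ = N * √A := by
    intro n A h
    rw [@norm_eq_sqrt_real_inner E3, h, sqrt_mul (by positivity), sqrt_sq hN.le]
  have nz : ∀ (n : E3) (A : ℝ), 0 < A → inner ℝ n n = N ^ 2 * A → n ≠ 0 := by
    rintro n A h h' rfl
    simp at h'
    rcases h' with h' | h' <;> linarith
  have key := girard ρ hρ.le n1 n2 n3 φ1 φ2 φ3 p1 p1' p2 p2' p3 p3' (nz _ _ hA nn1)
    (nz _ _ hB nn2) (nz _ _ hC nn3)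
    (by rw [nrm _ _ nn1, nrm _ _ nn2, n12, ← c1]; ring)
    (by rw [nrm _ _ nn1, nrm _ _ nn3, n13, ← c2]; ring)
    (by rw [nrm _ _ nn2, nrm _ _ nn3, n23, ← c3]; ring)
  unfold cone3
  have hk := kap_pos ρ hρ
  have hΩ : 0 ≤ 2 * π - φ1 - φ2 - φ3 := by
    have h0 : 0 ≤ (kap ρ).toReal / 2 * (2 * π - φ1 - φ2 - φ3) := by
      rw [← key]; exact ENNReal.toReal_nonneg
    exact nonneg_of_mul_nonneg_right h0 (by positivity)
  rw [key, solid_ang_aux la lb lc p q s N d _ φ1 φ2 φ3 A B C √A √B √C hN hd hG hdd eA eB eC hA hB hC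
    (sq_sqrt hA0) (sq_sqrt hB0) (sq_sqrt hC0) c1 s1 c2 s2 c3 s3 rfl hΩ (by linarith)]
  ring

end RR


open MeasureTheory Metric
namespace RR
open Real Set
open scoped ENNReal

noncomputable def det3 (a b c : E3) : ℝ :=
  a 0 * (b 1 * c 2 - b 2 * c 1) - b 0 * (a 1 * c 2 - a 2 * c 1) + c 0 * (a 1 * b 2 - a 2 * b 1)

noncomputable def mat3 (a b c : E3) : Matrix (Fin 3) (Fin 3) ℝ :=
  !![a 0, b 0, c 0; a 1, b 1, c 1; a 2, b 2, c 2]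

lemma det_mat3 (a b c : E3) : (mat3 a b c).det = det3 a b c := by
  simp [mat3, det3, Matrix.det_fin_three]; ring

lemma inner3 (x y : E3) : inner ℝ x y = x 0 * y 0 + x 1 * y 1 + x 2 * y 2 := by
  simp [PiLp.inner_apply, Fin.sum_univ_three]; ring

lemma det3_sq (a b c : E3) : det3 a b c ^ 2 =
    inner ℝ a a * inner ℝ b b * inner ℝ c c + 2 * inner ℝ b c * inner ℝ a c * inner ℝ a b
    - inner ℝ a a * inner ℝ b c ^ 2 - inner ℝ b b * inner ℝ a c ^ 2 - inner ℝ c c * inner ℝ a b ^ 2 := by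
  simp only [inner3, det3]; ring

lemma cramer (a b c x : E3) (h : det3 a b c ≠ 0) :
    ∃ α β γ : ℝ, x = α • a + β • b + γ • c := by
  refine ⟨det3 x b c / det3 a b c, det3 a x c / det3 a b c, det3 a b x / det3 a b c, ?_⟩
  have : det3 a b c • x = det3 x b c • a + det3 a x c • b + det3 a b x • c := by
    ext i
    fin_cases i <;> simp [det3] <;> ring
  have h2 : (det3 a b c)⁻¹ • (det3 a b c • x) = x := by rw [smul_smul, inv_mul_cancel₀ h, one_smul]
  rw [this] at h2
  simp only [smul_add, smul_smul, ← div_eq_inv_mul] at h2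
  exact h2.symm

lemma det3_ne (A B C D : E3) (h : AffineIndependent ℝ ![A, B, C, D]) :
    det3 (B - A) (C - A) (D - A) ≠ 0 := by
  intro h0
  rw [← det_mat3] at h0
  obtain ⟨v, hv, hv0⟩ := Matrix.exists_mulVec_eq_zero_iff.2 h0
  apply hv
  rw [affineIndependent_iff] at h
  have key := h Finset.univ ![-(v 0 + v 1 + v 2), v 0, v 1, v 2] (by simp [Fin.sum_univ_four]; ring) ?_
  · ext i
    fin_cases i
    · simpa using key 1 (Finset.mem_univ _)
    · simpa using key 2 (Finset.mem_univ _)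
    · simpa using key 3 (Finset.mem_univ _)
  · simp only [Fin.sum_univ_four]
    ext i
    have := congrFun hv0 i
    fin_cases i <;> simp [mat3, Matrix.mulVec, dotProduct, Fin.sum_univ_three] at this ⊢ <;> linarith

lemma mem_tetra (A B C D x : E3) : x ∈ tetra A B C D ↔
    ∃ u v w : ℝ, 0 ≤ u ∧ 0 ≤ v ∧ 0 ≤ w ∧ u + v + w ≤ 1 ∧
      x - A = u • (B - A) + v • (C - A) + w • (D - A) := by
  constructor
  · intro hx
    have : tetra A B C D ⊆ {x | ∃ u v w : ℝ, 0 ≤ u ∧ 0 ≤ v ∧ 0 ≤ w ∧ u + v + w ≤ 1 ∧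
      x - A = u • (B - A) + v • (C - A) + w • (D - A)} := by
      apply convexHull_min
      · rintro y (rfl | rfl | rfl | rfl)
        · exact ⟨0, 0, 0, by simp⟩
        · exact ⟨1, 0, 0, by simp⟩
        · exact ⟨0, 1, 0, by simp⟩
        · exact ⟨0, 0, 1, by simp⟩
      · rintro y ⟨u, v, w, hu, hv, hw, hs, hy⟩ z ⟨u', v', w', hu', hv', hw', hs', hz⟩ α β hα hβ hαβ
        refine ⟨α * u + β * u', α * v + β * v', α * w + β * w', by positivity, by positivity,
          by positivity, by nlinarith, ?_⟩
        have e : α • y + β • z - A = α • (y - A) + β • (z - A) := by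
          have : A = (α + β) • A := by rw [hαβ, one_smul]
          conv_lhs => rw [this]
          module
        rw [e, hy, hz]; module
    exact this hx
  · rintro ⟨u, v, w, hu, hv, hw, hs, hx⟩
    have hx' : x = (1 - u - v - w) • A + u • B + v • C + w • D := by
      have : x = (x - A) + A := by abel
      rw [this, hx]; module
    have hc : Convex ℝ (tetra A B C D) := convex_convexHull ℝ _
    have h := hc.sum_mem (t := Finset.univ) (w := ![1 - u - v - w, u, v, w]) (z := ![A, B, C, D]) ?_ ?_ ?_
    · rw [hx']; simpa [Fin.sum_univ_four] using h
    · intro i _; fin_cases i <;> simp <;> linarith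
    · simp [Fin.sum_univ_four]; ring
    · intro i _
      apply subset_convexHull
      fin_cases i <;> simp

lemma vol_shift (A : E3) (s : Set E3) : volume ((fun x => x - A) ⁻¹' s) = volume s := by
  simp only [sub_eq_add_neg]
  exact measure_preimage_add_right volume (-A) s

noncomputable def kap3 : ℝ := (volume {y : E3 | 0 ≤ y 0 ∧ 0 ≤ y 1 ∧ 0 ≤ y 2 ∧ y 0 + y 1 + y 2 ≤ 1}).toReal

lemma vol_tetra (A B C D : E3) :
    (volume (tetra A B C D)).toReal = |det3 (B - A) (C - A) (D - A)| * kap3 := by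
  have e : tetra A B C D = (fun x => x - A) ⁻¹' ((Matrix.toLpLin 2 2 (mat3 (B - A) (C - A) (D - A))) ''
      {y : E3 | 0 ≤ y 0 ∧ 0 ≤ y 1 ∧ 0 ≤ y 2 ∧ y 0 + y 1 + y 2 ≤ 1}) := by
    have hL : ∀ y : E3, (Matrix.toLpLin 2 2 (mat3 (B - A) (C - A) (D - A))) y =
        y 0 • (B - A) + y 1 • (C - A) + y 2 • (D - A) := by
      intro y
      ext i
      fin_cases i <;> simp [mat3, Matrix.toLpLin_apply, Matrix.mulVec, dotProduct, Fin.sum_univ_three] <;> ring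
    ext x
    rw [mem_tetra]
    simp only [mem_preimage, mem_image, mem_ofPred_eq, hL]
    constructor
    · rintro ⟨u, v, w, hu, hv, hw, hs, hx⟩
      exact ⟨!₂[u, v, w], by simpa using ⟨hu, hv, hw, hs⟩, by simp [hx]⟩
    · rintro ⟨y, ⟨h0, h1, h2, h3⟩, hy⟩
      exact ⟨y 0, y 1, y 2, h0, h1, h2, h3, hy.symm⟩
  rw [e, vol_shift, Measure.addHaar_image_linearMap, ENNReal.toReal_mul,
    ENNReal.toReal_ofReal (abs_nonneg _), Matrix.toLpLin_eq_toLin, LinearMap.det_toLin, det_mat3]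
  rfl

/-- Gram determinant from edges: x at the vertex, y opposite. -/
noncomputable def gr (x1 x2 x3 y1 y2 y3 : ℝ) : ℝ :=
  x1 ^ 2 * x2 ^ 2 * x3 ^ 2 + 2 * ((x2 ^ 2 + x3 ^ 2 - y1 ^ 2) / 2) * ((x1 ^ 2 + x3 ^ 2 - y2 ^ 2) / 2)
    * ((x1 ^ 2 + x2 ^ 2 - y3 ^ 2) / 2) - x1 ^ 2 * ((x2 ^ 2 + x3 ^ 2 - y1 ^ 2) / 2) ^ 2
    - x2 ^ 2 * ((x1 ^ 2 + x3 ^ 2 - y2 ^ 2) / 2) ^ 2 - x3 ^ 2 * ((x1 ^ 2 + x2 ^ 2 - y3 ^ 2) / 2) ^ 2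

noncomputable def dd (x1 x2 x3 y1 y2 y3 : ℝ) : ℝ :=
  x1 * x2 * x3 + x1 * ((x2 ^ 2 + x3 ^ 2 - y1 ^ 2) / 2) + x2 * ((x1 ^ 2 + x3 ^ 2 - y2 ^ 2) / 2)
    + x3 * ((x1 ^ 2 + x2 ^ 2 - y3 ^ 2) / 2)

lemma inner_of_dist (A B C : E3) (x y z : ℝ) (h1 : dist A B = x) (h2 : dist A C = y)
    (h3 : dist B C = z) : inner ℝ (B - A) (C - A) = (x ^ 2 + y ^ 2 - z ^ 2) / 2 := by
  rw [real_inner_eq_norm_mul_self_add_norm_mul_self_sub_norm_sub_mul_self_div_two]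
  rw [← h1, ← h2, ← h3, dist_comm A B, dist_comm A C, dist_eq_norm, dist_eq_norm, dist_eq_norm]
  rw [show B - A - (C - A) = B - C by abel]
  ring

lemma inner_self_dist (A B : E3) (x : ℝ) (h1 : dist A B = x) :
    inner ℝ (B - A) (B - A) = x ^ 2 := by
  rw [real_inner_self_eq_norm_sq, ← h1, dist_comm, dist_eq_norm]

lemma det_gr (A B C D : E3) (x1 x2 x3 y1 y2 y3 : ℝ) (h1 : dist A B = x1) (h2 : dist A C = x2)
    (h3 : dist A D = x3) (k1 : dist C D = y1) (k2 : dist B D = y2) (k3 : dist B C = y3) :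
    det3 (B - A) (C - A) (D - A) ^ 2 = gr x1 x2 x3 y1 y2 y3 := by
  rw [det3_sq, inner_self_dist A B x1 h1, inner_self_dist A C x2 h2, inner_self_dist A D x3 h3,
    inner_of_dist A C D x2 x3 y1 h2 h3 k1, inner_of_dist A B D x1 x3 y2 h1 h3 k2,
    inner_of_dist A B C x1 x2 y3 h1 h2 k3, gr]

/-- The sector at a vertex. -/
lemma sector (ρ : ℝ) (hρ : 0 < ρ) (A B C D : E3) (x1 x2 x3 y1 y2 y3 N : ℝ) (h1 : dist A B = x1)
    (h2 : dist A C = x2)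
    (h3 : dist A D = x3) (k1 : dist C D = y1) (k2 : dist B D = y2) (k3 : dist B C = y3)
    (p1 : 0 < x1) (p2 : 0 < x2) (p3 : 0 < x3) (hN : 0 < N) (hN2 : N ^ 2 = gr x1 x2 x3 y1 y2 y3)
    (hd : 0 < dd x1 x2 x3 y1 y2 y3) :
    ∃ K : Set E3, MeasurableSet K ∧ (volume (closedBall A ρ ∩ K)).toReal =
        (kap ρ).toReal * arctan (N / dd x1 x2 x3 y1 y2 y3) ∧
      ∀ x, x ∈ K ↔ ∃ u v w : ℝ, 0 ≤ u ∧ 0 ≤ v ∧ 0 ≤ w ∧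
        x - A = u • (B - A) + v • (C - A) + w • (D - A) := by
  have e1 := inner_self_dist A B x1 h1
  have e2 := inner_self_dist A C x2 h2
  have e3 := inner_self_dist A D x3 h3
  have f1 := inner_of_dist A C D x2 x3 y1 h2 h3 k1
  have f2 := inner_of_dist A B D x1 x3 y2 h1 h3 k2
  have f3 := inner_of_dist A B C x1 x2 y3 h1 h2 k3
  obtain ⟨p, hp⟩ : ∃ p, p = (x2 ^ 2 + x3 ^ 2 - y1 ^ 2) / 2 := ⟨_, rfl⟩
  obtain ⟨q, hq⟩ : ∃ p, p = (x1 ^ 2 + x3 ^ 2 - y2 ^ 2) / 2 := ⟨_, rfl⟩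
  obtain ⟨s, hs⟩ : ∃ p, p = (x1 ^ 2 + x2 ^ 2 - y3 ^ 2) / 2 := ⟨_, rfl⟩
  have hdet := det_gr A B C D x1 x2 x3 y1 y2 y3 h1 h2 h3 k1 k2 k3
  rw [← hN2] at hdet
  have hdet0 : det3 (B - A) (C - A) (D - A) ≠ 0 := by
    intro h; rw [h] at hdet; nlinarith
  rw [← hp] at f1; rw [← hq] at f2; rw [← hs] at f3
  unfold gr at hN2
  unfold dd at hd ⊢
  rw [← hp, ← hq, ← hs] at hN2 hd ⊢
  obtain ⟨a, ha⟩ : ∃ a, a = B - A := ⟨_, rfl⟩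
  obtain ⟨b, hb⟩ : ∃ a, a = C - A := ⟨_, rfl⟩
  obtain ⟨c, hc⟩ : ∃ a, a = D - A := ⟨_, rfl⟩
  rw [← ha] at e1 f2 f3 hdet0
  rw [← hb] at e2 f1 f3 hdet0
  rw [← hc] at e3 f1 f2 hdet0
  rw [← ha, ← hb, ← hc]
  have key := solid_angle ρ hρ a b c _ _ _ x1 x2 x3 p q s N _ e1 e2 e3 f1 f2 f3 p1 p2 p3 hN hd hN2 rfl
    rfl rfl rfl
  have g1 : inner ℝ c b = p := by rw [real_inner_comm]; exact f1
  have g2 : inner ℝ c a = q := by rw [real_inner_comm]; exact f2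
  have g3 : inner ℝ b a = s := by rw [real_inner_comm]; exact f3
  obtain ⟨n1, d1⟩ : ∃ n : E3, n = (x2 ^ 2 * x3 ^ 2 - p ^ 2) • a + (p * q - s * x3 ^ 2) • b + (p * s - q * x2 ^ 2) • c := ⟨_, rfl⟩
  obtain ⟨n2, d2⟩ : ∃ n : E3, n = (p * q - s * x3 ^ 2) • a + (x1 ^ 2 * x3 ^ 2 - q ^ 2) • b + (q * s - p * x1 ^ 2) • c := ⟨_, rfl⟩
  obtain ⟨n3, d3⟩ : ∃ n : E3, n = (p * s - q * x2 ^ 2) • a + (q * s - p * x1 ^ 2) • b + (x1 ^ 2 * x2 ^ 2 - s ^ 2) • c := ⟨_, rfl⟩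
  rw [← d1, ← d2, ← d3] at key
  have in1 : ∀ u v w : ℝ, inner ℝ n1 (u • a + v • b + w • c) = N ^ 2 * u := by
    intro u v w
    rw [d1]
    simp only [inner_add_left, inner_add_right, inner_smul_left, inner_smul_right, e1, e2, e3, f1, f2, f3, g1, g2, g3, conj_trivial]
    rw [hN2]; ring
  have in2 : ∀ u v w : ℝ, inner ℝ n2 (u • a + v • b + w • c) = N ^ 2 * v := by
    intro u v w
    rw [d2]
    simp only [inner_add_left, inner_add_right, inner_smul_left, inner_smul_right, e1, e2, e3, f1, f2, f3, g1, g2, g3, conj_trivial]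
    rw [hN2]; ring
  have in3 : ∀ u v w : ℝ, inner ℝ n3 (u • a + v • b + w • c) = N ^ 2 * w := by
    intro u v w
    rw [d3]
    simp only [inner_add_left, inner_add_right, inner_smul_left, inner_smul_right, e1, e2, e3, f1, f2, f3, g1, g2, g3, conj_trivial]
    rw [hN2]; ring
  have hN2p : 0 < N ^ 2 := by positivity
  refine ⟨(fun x => x - A) ⁻¹' (cone3 n1 n2 n3), ?_, ?_, ?_⟩
  · apply measurableSet_preimage (by fun_prop)
    have e : cone3 n1 n2 n3 = {x | 0 ≤ inner ℝ n1 x} ∩ ({x | 0 ≤ inner ℝ n2 x} ∩ {x | 0 ≤ inner ℝ n3 x}) := by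
      ext x; simp [cone3]
    rw [e]
    exact (meas_H n1).inter ((meas_H n2).inter (meas_H n3))
  · rw [← key]
    congr 1
    rw [← vol_shift A (closedBall 0 ρ ∩ cone3 n1 n2 n3)]
    congr 1
    ext x
    simp [mem_closedBall, dist_eq_norm]
  · intro x
    obtain ⟨α, β, γ, hx⟩ := cramer a b c (x - A) hdet0
    simp only [mem_preimage, cone3, mem_ofPred_eq]
    rw [hx, in1, in2, in3, mul_nonneg_iff_of_pos_left hN2p, mul_nonneg_iff_of_pos_left hN2p,
      mul_nonneg_iff_of_pos_left hN2p]
    constructor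
    · rintro ⟨i, j, k⟩; exact ⟨α, β, γ, i, j, k, rfl⟩
    · rintro ⟨u, v, w, hu, hv, hw, he⟩
      have j1 := in1 u v w
      have j2 := in2 u v w
      have j3 := in3 u v w
      rw [← he, in1] at j1
      rw [← he, in2] at j2
      rw [← he, in3] at j3
      rw [mul_left_cancel₀ hN2p.ne' j1, mul_left_cancel₀ hN2p.ne' j2, mul_left_cancel₀ hN2p.ne' j3]
      exact ⟨hu, hv, hw⟩

end RR


open MeasureTheory Metric
namespace RR
open Real Set
open scoped ENNReal

lemma sec_up (ρ : ℝ) (hρ : 0 < ρ) (A B C D : E3) (x1 x2 x3 y1 y2 y3 N : ℝ) (h1 : dist A B = x1)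
    (h2 : dist A C = x2)
    (h3 : dist A D = x3) (k1 : dist C D = y1) (k2 : dist B D = y2) (k3 : dist B C = y3)
    (p1 : 0 < x1) (p2 : 0 < x2) (p3 : 0 < x3) (hN : 0 < N) (hN2 : N ^ 2 = gr x1 x2 x3 y1 y2 y3)
    (hd : 0 < dd x1 x2 x3 y1 y2 y3) :
    (volume (tetra A B C D ∩ closedBall A ρ)).toReal ≤
      (kap ρ).toReal * arctan (N / dd x1 x2 x3 y1 y2 y3) := by
  obtain ⟨K, -, hv, hK⟩ := sector ρ hρ A B C D x1 x2 x3 y1 y2 y3 N h1 h2 h3 k1 k2 k3 p1 p2 p3 hN hN2 hd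
  rw [← hv]
  apply ENNReal.toReal_mono
  · exact ((measure_mono inter_subset_left).trans_lt measure_closedBall_lt_top).ne
  · apply measure_mono
    rintro x ⟨hx, hb⟩
    refine ⟨hb, (hK x).2 ?_⟩
    obtain ⟨u, v, w, hu, hv, hw, -, he⟩ := (mem_tetra A B C D x).1 hx
    exact ⟨u, v, w, hu, hv, hw, he⟩

lemma sec_lo (ρ : ℝ) (hρ : 0 < ρ) (A B C D : E3) (x1 x2 x3 y1 y2 y3 N : ℝ) (h1 : dist A B = x1)
    (h2 : dist A C = x2)
    (h3 : dist A D = x3) (k1 : dist C D = y1) (k2 : dist B D = y2) (k3 : dist B C = y3)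
    (p1 : 0 < x1) (p2 : 0 < x2) (p3 : 0 < x3) (hN : 0 < N) (hN2 : N ^ 2 = gr x1 x2 x3 y1 y2 y3)
    (hd : 0 < dd x1 x2 x3 y1 y2 y3)
    (hq : ∀ u v w : ℝ, 0 ≤ u → 0 ≤ v → 0 ≤ w → ρ ^ 2 * (u + v + w) ^ 2 ≤
      u ^ 2 * x1 ^ 2 + v ^ 2 * x2 ^ 2 + w ^ 2 * x3 ^ 2 + v * w * (x2 ^ 2 + x3 ^ 2 - y1 ^ 2)
      + u * w * (x1 ^ 2 + x3 ^ 2 - y2 ^ 2) + u * v * (x1 ^ 2 + x2 ^ 2 - y3 ^ 2)) :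
    ∃ S, MeasurableSet S ∧ S ⊆ tetra A B C D ∧ S ⊆ ball A ρ ∧ (volume S).toReal =
      (kap ρ).toReal * arctan (N / dd x1 x2 x3 y1 y2 y3) := by
  obtain ⟨K, hm, hv, hK⟩ := sector ρ hρ A B C D x1 x2 x3 y1 y2 y3 N h1 h2 h3 k1 k2 k3 p1 p2 p3 hN hN2 hd
  refine ⟨ball A ρ ∩ K, measurableSet_ball.inter hm, ?_, inter_subset_left, ?_⟩
  · rintro x ⟨hxb, hxK⟩
    obtain ⟨u, v, w, hu, hv, hw, he⟩ := (hK x).1 hxK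
    refine (mem_tetra A B C D x).2 ⟨u, v, w, hu, hv, hw, ?_, he⟩
    have hn : ‖x - A‖ ^ 2 = u ^ 2 * x1 ^ 2 + v ^ 2 * x2 ^ 2 + w ^ 2 * x3 ^ 2 + v * w * (x2 ^ 2 + x3 ^ 2 - y1 ^ 2)
      + u * w * (x1 ^ 2 + x3 ^ 2 - y2 ^ 2) + u * v * (x1 ^ 2 + x2 ^ 2 - y3 ^ 2) := by
      rw [← real_inner_self_eq_norm_sq, he]
      have e1 := inner_self_dist A B x1 h1
      have e2 := inner_self_dist A C x2 h2
      have e3 := inner_self_dist A D x3 h3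
      have f1 := inner_of_dist A C D x2 x3 y1 h2 h3 k1
      have f2 := inner_of_dist A B D x1 x3 y2 h1 h3 k2
      have f3 := inner_of_dist A B C x1 x2 y3 h1 h2 k3
      have g1 : inner ℝ (D - A) (C - A) = (x2 ^ 2 + x3 ^ 2 - y1 ^ 2) / 2 := by rw [real_inner_comm]; exact f1
      have g2 : inner ℝ (D - A) (B - A) = (x1 ^ 2 + x3 ^ 2 - y2 ^ 2) / 2 := by rw [real_inner_comm]; exact f2
      have g3 : inner ℝ (C - A) (B - A) = (x1 ^ 2 + x2 ^ 2 - y3 ^ 2) / 2 := by rw [real_inner_comm]; exact f3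
      simp only [inner_add_left, inner_add_right, inner_smul_left, inner_smul_right, e1, e2, e3, f1, f2, f3, g1, g2, g3, conj_trivial]
      ring
    have hlt : ‖x - A‖ < ρ := by rwa [mem_ball, dist_eq_norm] at hxb
    have h := hq u v w hu hv hw
    rw [← hn, ← mul_pow] at h
    have h' := abs_le_of_sq_le_sq h (norm_nonneg _)
    have h'' := (abs_le.1 (abs_le_of_sq_le_sq h (norm_nonneg _))).2
    have : ρ * (u + v + w) < ρ * 1 := by linarith
    exact (lt_of_mul_lt_mul_left this hρ.le).le
  · rw [← hv]
    congr 1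
    apply le_antisymm
    · exact measure_mono (inter_subset_inter_left _ ball_subset_closedBall)
    · have : closedBall A ρ ∩ K ⊆ (ball A ρ ∩ K) ∪ sphere A ρ := by
        rintro x ⟨hx, hk⟩
        rw [← ball_union_sphere] at hx
        rcases hx with hx | hx
        · exact Or.inl ⟨hx, hk⟩
        · exact Or.inr hx
      refine (measure_mono this).trans ((measure_union_le _ _).trans ?_)
      rw [Measure.addHaar_sphere, add_zero]

lemma tetra_B (A B C D : E3) : tetra B A C D = tetra A B C D := by
  unfold tetra; congr 1; ext x; simp; tauto
lemma tetra_C (A B C D : E3) : tetra C A B D = tetra A B C D := by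
  unfold tetra; congr 1; ext x; simp; tauto
lemma tetra_D (A B C D : E3) : tetra D A B C = tetra A B C D := by
  unfold tetra; congr 1; ext x; simp; tauto

lemma gr_B (a b p q s t : ℝ) : gr a q s t p b = gr a b p t s q := by unfold gr; ring
lemma gr_C (a b p q s t : ℝ) : gr b q t s p a = gr a b p t s q := by unfold gr; ring
lemma gr_D (a b p q s t : ℝ) : gr p s t q b a = gr a b p t s q := by unfold gr; ring

noncomputable def angs (N a b p q s t : ℝ) : ℝ :=
  arctan (N / dd a b p t s q) + arctan (N / dd a q s t p b) + arctan (N / dd b q t s p a)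
    + arctan (N / dd p s t q b a)

lemma dens_up (ρ : ℝ) (hρ : 0 < ρ) (A B C D : E3) (a b p q s t N : ℝ) (hAB : dist A B = a)
    (hAC : dist A C = b) (hAD : dist A D = p) (hBC : dist B C = q) (hBD : dist B D = s)
    (hCD : dist C D = t) (pa : 0 < a) (pb : 0 < b) (pp : 0 < p) (pq : 0 < q) (ps : 0 < s)
    (pt : 0 < t) (hN : 0 < N) (hN2 : N ^ 2 = gr a b p t s q) (dA : 0 < dd a b p t s q)
    (dB : 0 < dd a q s t p b) (dC : 0 < dd b q t s p a) (dD : 0 < dd p s t q b a) :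
    density A B C D ρ ρ ρ ρ ≤ (kap ρ).toReal * angs N a b p q s t / (N * kap3) := by
  have hV : (volume (tetra A B C D)).toReal = N * kap3 := by
    rw [vol_tetra]
    congr 1
    rw [← abs_of_pos hN]
    apply (sq_eq_sq_iff_abs_eq_abs _ _).1
    rw [det_gr A B C D a b p t s q hAB hAC hAD hCD hBD hBC, hN2]
  have hk3 : 0 ≤ kap3 := ENNReal.toReal_nonneg
  unfold density
  rw [hV]
  apply div_le_div_of_nonneg_right _ (by positivity)
  have uA := sec_up ρ hρ A B C D a b p t s q N hAB hAC hAD hCD hBD hBC pa pb pp hN hN2 dA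
  have uB := sec_up ρ hρ B A C D a q s t p b N (by rw [dist_comm]; exact hAB) hBC hBD hCD hAD hAC
    pa pq ps hN (by rw [gr_B]; exact hN2) dB
  have uC := sec_up ρ hρ C A B D b q t s p a N (by rw [dist_comm]; exact hAC)
    (by rw [dist_comm]; exact hBC) hCD hBD hAD hAB
    pb pq pt hN (by rw [gr_C]; exact hN2) dC
  have uD := sec_up ρ hρ D A B C p s t q b a N (by rw [dist_comm]; exact hAD)
    (by rw [dist_comm]; exact hBD) (by rw [dist_comm]; exact hCD) hBC hAC hAB
    pp ps pt hN (by rw [gr_D]; exact hN2) dD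
  rw [tetra_B] at uB
  rw [tetra_C] at uC
  rw [tetra_D] at uD
  have ne : ∀ X : E3, volume (tetra A B C D ∩ closedBall X ρ) ≠ ⊤ := fun X =>
    ((measure_mono inter_subset_right).trans_lt measure_closedBall_lt_top).ne
  have : (volume (tetra A B C D ∩ (closedBall A ρ ∪ closedBall B ρ ∪ closedBall C ρ ∪ closedBall D ρ))).toReal
      ≤ (volume (tetra A B C D ∩ closedBall A ρ)).toReal + (volume (tetra A B C D ∩ closedBall B ρ)).toReal
      + (volume (tetra A B C D ∩ closedBall C ρ)).toReal + (volume (tetra A B C D ∩ closedBall D ρ)).toReal := by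
    rw [← ENNReal.toReal_add (ne A) (ne B), ← ENNReal.toReal_add (by simp [ne]) (ne C),
      ← ENNReal.toReal_add (by simp [ne]) (ne D)]
    apply ENNReal.toReal_mono (by simp [ne])
    rw [inter_union_distrib_left, inter_union_distrib_left, inter_union_distrib_left]
    refine (measure_union_le _ _).trans (add_le_add_left ?_ _)
    refine (measure_union_le _ _).trans (add_le_add_left ?_ _)
    exact measure_union_le _ _
  unfold angs
  linarith

def QF (ρ x1 x2 x3 y1 y2 y3 : ℝ) : Prop :=
  ∀ u v w : ℝ, 0 ≤ u → 0 ≤ v → 0 ≤ w → ρ ^ 2 * (u + v + w) ^ 2 ≤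
      u ^ 2 * x1 ^ 2 + v ^ 2 * x2 ^ 2 + w ^ 2 * x3 ^ 2 + v * w * (x2 ^ 2 + x3 ^ 2 - y1 ^ 2)
      + u * w * (x1 ^ 2 + x3 ^ 2 - y2 ^ 2) + u * v * (x1 ^ 2 + x2 ^ 2 - y3 ^ 2)

lemma dens_lo (ρ : ℝ) (hρ : 0 < ρ) (A B C D : E3) (a b p q s t N : ℝ) (hAB : dist A B = a)
    (hAC : dist A C = b) (hAD : dist A D = p) (hBC : dist B C = q) (hBD : dist B D = s)
    (hCD : dist C D = t) (pa : 2 * ρ ≤ a) (pb : 2 * ρ ≤ b) (pp : 2 * ρ ≤ p) (pq : 2 * ρ ≤ q)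
    (ps : 2 * ρ ≤ s)
    (pt : 2 * ρ ≤ t) (hN : 0 < N) (hN2 : N ^ 2 = gr a b p t s q) (dA : 0 < dd a b p t s q)
    (dB : 0 < dd a q s t p b) (dC : 0 < dd b q t s p a) (dD : 0 < dd p s t q b a)
    (qA : QF ρ a b p t s q) (qB : QF ρ a q s t p b) (qC : QF ρ b q t s p a) (qD : QF ρ p s t q b a) :
    (kap ρ).toReal * angs N a b p q s t / (N * kap3) ≤ density A B C D ρ ρ ρ ρ := by
  have hV : (volume (tetra A B C D)).toReal = N * kap3 := by
    rw [vol_tetra]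
    congr 1
    rw [← abs_of_pos hN]
    apply (sq_eq_sq_iff_abs_eq_abs _ _).1
    rw [det_gr A B C D a b p t s q hAB hAC hAD hCD hBD hBC, hN2]
  have hk3 : 0 ≤ kap3 := ENNReal.toReal_nonneg
  unfold density
  rw [hV]
  apply div_le_div_of_nonneg_right _ (by positivity)
  obtain ⟨SA, mA, iA, jA, vA⟩ := sec_lo ρ hρ A B C D a b p t s q N hAB hAC hAD hCD hBD hBC (by linarith) (by linarith) (by linarith) hN hN2 dA qA
  obtain ⟨SB, mB, iB, jB, vB⟩ := sec_lo ρ hρ B A C D a q s t p b N (by rw [dist_comm]; exact hAB) hBC hBD hCD hAD hAC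
    (by linarith) (by linarith) (by linarith) hN (by rw [gr_B]; exact hN2) dB qB
  obtain ⟨SC, mC, iC, jC, vC⟩ := sec_lo ρ hρ C A B D b q t s p a N (by rw [dist_comm]; exact hAC)
    (by rw [dist_comm]; exact hBC) hCD hBD hAD hAB
    (by linarith) (by linarith) (by linarith) hN (by rw [gr_C]; exact hN2) dC qC
  obtain ⟨SD, mD, iD, jD, vD⟩ := sec_lo ρ hρ D A B C p s t q b a N (by rw [dist_comm]; exact hAD)
    (by rw [dist_comm]; exact hBD) (by rw [dist_comm]; exact hCD) hBC hAC hAB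
    (by linarith) (by linarith) (by linarith) hN (by rw [gr_D]; exact hN2) dD qD
  rw [tetra_B] at iB
  rw [tetra_C] at iC
  rw [tetra_D] at iD
  have dj : ∀ (X Y : E3) (S T : Set E3), S ⊆ ball X ρ → T ⊆ ball Y ρ → 2 * ρ ≤ dist X Y → Disjoint S T := by
    intro X Y S T h1 h2 h3
    exact (ball_disjoint_ball (by linarith)).mono h1 h2
  have fin : ∀ (X : E3) (S : Set E3), S ⊆ ball X ρ → volume S ≠ ⊤ := fun X S h =>
    ((measure_mono h).trans_lt measure_ball_lt_top).ne
  have hU : volume (SA ∪ SB ∪ SC ∪ SD) = volume SA + volume SB + volume SC + volume SD := by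
    rw [measure_union _ mD, measure_union _ mC, measure_union _ mB]
    · exact dj A B _ _ jA jB (by linarith)
    · exact (dj A C _ _ jA jC (by linarith)).union_left (dj B C _ _ jB jC (by linarith))
    · exact ((dj A D _ _ jA jD (by linarith)).union_left (dj B D _ _ jB jD (by linarith))).union_left
        (dj C D _ _ jC jD (by linarith))
  have hsub : SA ∪ SB ∪ SC ∪ SD ⊆ tetra A B C D ∩ (closedBall A ρ ∪ closedBall B ρ ∪ closedBall C ρ ∪ closedBall D ρ) := by
    rintro x (((h | h) | h) | h)
    · exact ⟨iA h, Or.inl (Or.inl (Or.inl (ball_subset_closedBall (jA h))))⟩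
    · exact ⟨iB h, Or.inl (Or.inl (Or.inr (ball_subset_closedBall (jB h))))⟩
    · exact ⟨iC h, Or.inl (Or.inr (ball_subset_closedBall (jC h)))⟩
    · exact ⟨iD h, Or.inr (ball_subset_closedBall (jD h))⟩
  have hle := ENNReal.toReal_mono ?_ (measure_mono (μ := volume) hsub)
  · rw [hU, ENNReal.toReal_add (by simp [fin A SA jA, fin B SB jB, fin C SC jC]) (fin D SD jD),
      ENNReal.toReal_add (by simp [fin A SA jA, fin B SB jB]) (fin C SC jC),
      ENNReal.toReal_add (fin A SA jA) (fin B SB jB), vA, vB, vC, vD] at hle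
    unfold angs
    linarith
  · refine ((measure_mono inter_subset_right).trans_lt ?_).ne
    refine (measure_union_le _ _).trans_lt (ENNReal.add_lt_top.2 ⟨?_, measure_closedBall_lt_top⟩)
    refine (measure_union_le _ _).trans_lt (ENNReal.add_lt_top.2 ⟨?_, measure_closedBall_lt_top⟩)
    exact (measure_union_le _ _).trans_lt (ENNReal.add_lt_top.2 ⟨measure_closedBall_lt_top, measure_closedBall_lt_top⟩)

/-- Crelle-type formula for the circumradius. -/
lemma circum (A B C D O : E3) (a b p q s t ρ : ℝ) (hAB : dist A B = a)
    (hAC : dist A C = b) (hAD : dist A D = p) (hBC : dist B C = q) (hBD : dist B D = s)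
    (hCD : dist C D = t) (haff : AffineIndependent ℝ ![A, B, C, D])
    (hA : dist O A = ρ) (hB : dist O B = ρ) (hC : dist O C = ρ) (hD : dist O D = ρ) :
    ((a * t + b * s) ^ 2 - (p * q) ^ 2) * ((p * q) ^ 2 - (a * t - b * s) ^ 2) =
      16 * ρ ^ 2 * gr a b p t s q := by
  obtain ⟨u, v, w, ho⟩ := cramer _ _ _ (O - A) (det3_ne A B C D haff)
  have e1 := inner_self_dist A B a hAB
  have e2 := inner_self_dist A C b hAC
  have e3 := inner_self_dist A D p hAD
  have f1 := inner_of_dist A C D b p t hAC hAD hCD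
  have f2 := inner_of_dist A B D a p s hAB hAD hBD
  have f3 := inner_of_dist A B C a b q hAB hAC hBC
  have g1 : inner ℝ (D - A) (C - A) = (b ^ 2 + p ^ 2 - t ^ 2) / 2 := by rw [real_inner_comm]; exact f1
  have g2 : inner ℝ (D - A) (B - A) = (a ^ 2 + p ^ 2 - s ^ 2) / 2 := by rw [real_inner_comm]; exact f2
  have g3 : inner ℝ (C - A) (B - A) = (a ^ 2 + b ^ 2 - q ^ 2) / 2 := by rw [real_inner_comm]; exact f3
  have o1 := inner_of_dist A O B ρ a ρ (by rw [dist_comm]; exact hA) hAB hB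
  have o2 := inner_of_dist A O C ρ b ρ (by rw [dist_comm]; exact hA) hAC hC
  have o3 := inner_of_dist A O D ρ p ρ (by rw [dist_comm]; exact hA) hAD hD
  have o4 := inner_self_dist A O ρ (by rw [dist_comm]; exact hA)
  have o5 : ρ ^ 2 = u * (a ^ 2 / 2) + v * (b ^ 2 / 2) + w * (p ^ 2 / 2) := by
    rw [← o4]
    conv_lhs => arg 3; rw [ho]
    simp only [inner_add_right, inner_smul_right, o1, o2, o3]
    ring
  rw [ho] at o1 o2 o3
  simp only [inner_add_left, inner_smul_left, e1, e2, e3, f1, f2, f3, g1, g2, g3, conj_trivial] at o1 o2 o3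
  obtain ⟨X, hX⟩ : ∃ X, X = (b ^ 2 + p ^ 2 - t ^ 2) / 2 := ⟨_, rfl⟩
  obtain ⟨Y, hY⟩ : ∃ X, X = (a ^ 2 + p ^ 2 - s ^ 2) / 2 := ⟨_, rfl⟩
  obtain ⟨Z, hZ⟩ : ∃ X, X = (a ^ 2 + b ^ 2 - q ^ 2) / 2 := ⟨_, rfl⟩
  have hG : gr a b p t s q = a ^ 2 * b ^ 2 * p ^ 2 + 2 * X * Y * Z - a ^ 2 * X ^ 2 - b ^ 2 * Y ^ 2 - p ^ 2 * Z ^ 2 := by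
    rw [hX, hY, hZ]; rfl
  rw [← hZ, ← hY] at o1
  rw [← hZ, ← hX] at o2
  rw [← hY, ← hX] at o3
  have k1 : gr a b p t s q * u = (b ^ 2 * p ^ 2 - X ^ 2) * (a ^ 2 / 2) + (X * Y - Z * p ^ 2) * (b ^ 2 / 2)
      + (X * Z - Y * b ^ 2) * (p ^ 2 / 2) := by
    rw [hG]
    linear_combination (b ^ 2 * p ^ 2 - X ^ 2) * o1 + (X * Y - Z * p ^ 2) * o2 + (X * Z - Y * b ^ 2) * o3
  have k2 : gr a b p t s q * v = (X * Y - Z * p ^ 2) * (a ^ 2 / 2) + (a ^ 2 * p ^ 2 - Y ^ 2) * (b ^ 2 / 2)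
      + (Y * Z - X * a ^ 2) * (p ^ 2 / 2) := by
    rw [hG]
    linear_combination (X * Y - Z * p ^ 2) * o1 + (a ^ 2 * p ^ 2 - Y ^ 2) * o2 + (Y * Z - X * a ^ 2) * o3
  have k3 : gr a b p t s q * w = (X * Z - Y * b ^ 2) * (a ^ 2 / 2) + (Y * Z - X * a ^ 2) * (b ^ 2 / 2)
      + (a ^ 2 * b ^ 2 - Z ^ 2) * (p ^ 2 / 2) := by
    rw [hG]
    linear_combination (X * Z - Y * b ^ 2) * o1 + (Y * Z - X * a ^ 2) * o2 + (a ^ 2 * b ^ 2 - Z ^ 2) * o3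
  have : 16 * ρ ^ 2 * gr a b p t s q = 8 * (a ^ 2 * (gr a b p t s q * u) + b ^ 2 * (gr a b p t s q * v)
      + p ^ 2 * (gr a b p t s q * w)) := by rw [o5]; ring
  rw [this, k1, k2, k3, hX, hY, hZ]
  ring

end RR


namespace RR

/-- Fixed-point interval (scale 10^8). -/
structure Iv where
  lo : ℤ
  hi : ℤ

def mem (x : ℝ) (i : Iv) : Prop := (i.lo : ℝ) ≤ 100000000 * x ∧ 100000000 * x ≤ (i.hi : ℝ)

def mlo (a b : Iv) : ℤ := min (min (a.lo * b.lo) (a.lo * b.hi)) (min (a.hi * b.lo) (a.hi * b.hi))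
def mhi (a b : Iv) : ℤ := max (max (a.lo * b.lo) (a.lo * b.hi)) (max (a.hi * b.lo) (a.hi * b.hi))

lemma bil_lo (x y a b c d : ℝ) (h1 : a ≤ x) (h2 : x ≤ b) (h3 : c ≤ y) (h4 : y ≤ d) :
    min (min (a * c) (a * d)) (min (b * c) (b * d)) ≤ x * y := by
  by_contra! h
  simp only [lt_min_iff] at h
  obtain ⟨⟨k1, k2⟩, k3, k4⟩ := h
  rcases le_total 0 x with hx | hx
  · rcases le_total 0 c with hc | hc
    · nlinarith [mul_nonneg hx (sub_nonneg.2 h3), mul_nonneg hc (sub_nonneg.2 h1)]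
    · nlinarith [mul_nonneg hx (sub_nonneg.2 h3), mul_nonneg (neg_nonneg.2 hc) (sub_nonneg.2 h2)]
  · rcases le_total 0 d with hc | hc
    · nlinarith [mul_nonneg (neg_nonneg.2 hx) (sub_nonneg.2 h4), mul_nonneg hc (sub_nonneg.2 h1)]
    · nlinarith [mul_nonneg (neg_nonneg.2 hx) (sub_nonneg.2 h4), mul_nonneg (neg_nonneg.2 hc) (sub_nonneg.2 h2)]

lemma bil_hi (x y a b c d : ℝ) (h1 : a ≤ x) (h2 : x ≤ b) (h3 : c ≤ y) (h4 : y ≤ d) :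
    x * y ≤ max (max (a * c) (a * d)) (max (b * c) (b * d)) := by
  by_contra! h
  simp only [max_lt_iff] at h
  obtain ⟨⟨k1, k2⟩, k3, k4⟩ := h
  rcases le_total 0 x with hx | hx
  · rcases le_total 0 d with hc | hc
    · nlinarith [mul_nonneg hx (sub_nonneg.2 h4), mul_nonneg hc (sub_nonneg.2 h2)]
    · nlinarith [mul_nonneg hx (sub_nonneg.2 h4), mul_nonneg (neg_nonneg.2 hc) (sub_nonneg.2 h1)]
  · rcases le_total 0 c with hc | hc
    · nlinarith [mul_nonneg (neg_nonneg.2 hx) (sub_nonneg.2 h3), mul_nonneg hc (sub_nonneg.2 h2)]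
    · nlinarith [mul_nonneg (neg_nonneg.2 hx) (sub_nonneg.2 h3), mul_nonneg (neg_nonneg.2 hc) (sub_nonneg.2 h1)]

lemma mem_mul {x y : ℝ} {a b : Iv} (hx : mem x a) (hy : mem y b) :
    (mlo a b : ℝ) ≤ 10000000000000000 * (x * y) ∧ 10000000000000000 * (x * y) ≤ (mhi a b : ℝ) := by
  have e : 10000000000000000 * (x * y) = (100000000 * x) * (100000000 * y) := by ring
  rw [e]
  unfold mlo mhi
  push_cast
  exact ⟨bil_lo _ _ _ _ _ _ hx.1 hx.2 hy.1 hy.2, bil_hi _ _ _ _ _ _ hx.1 hx.2 hy.1 hy.2⟩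

structure SF where
  b : Iv
  r : Iv
  s0 : Iv
  s1 : Iv
  s2 : Iv
  s3 : Iv
  s4 : Iv
  s5 : Iv

def V0 : Iv := ⟨-2791200, 2791200⟩
def V1 : Iv := ⟨0, 19478⟩
def V2 : Iv := ⟨0, 1395600⟩

def VV (v : Fin 6 → ℝ) : Prop :=
  mem (v 0) V0 ∧ mem (v 1) V1 ∧ mem (v 2) V2 ∧ mem (v 3) V2 ∧ mem (v 4) V2 ∧ mem (v 5) V2

def M (v : Fin 6 → ℝ) (X0 X : ℝ) (z : SF) : Prop :=
  mem X0 z.b ∧ mem X z.r ∧ ∃ s : Fin 6 → ℝ, mem (s 0) z.s0 ∧ mem (s 1) z.s1 ∧ mem (s 2) z.s2 ∧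
    mem (s 3) z.s3 ∧ mem (s 4) z.s4 ∧ mem (s 5) z.s5 ∧
    X = X0 + (s 0 * v 0 + s 1 * v 1 + s 2 * v 2 + s 3 * v 3 + s 4 * v 4 + s 5 * v 5)

def rchk (z : SF) : Bool :=
  decide (z.r.lo * 100000000 ≤ z.b.lo * 100000000 + (mlo z.s0 V0 + mlo z.s1 V1 + mlo z.s2 V2
    + mlo z.s3 V2 + mlo z.s4 V2 + mlo z.s5 V2)) &&
  decide (z.b.hi * 100000000 + (mhi z.s0 V0 + mhi z.s1 V1 + mhi z.s2 V2
    + mhi z.s3 V2 + mhi z.s4 V2 + mhi z.s5 V2) ≤ z.r.hi * 100000000)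

lemma M_mk (v : Fin 6 → ℝ) (hv : VV v) (X0 X : ℝ) (z : SF) (h : rchk z = true) (h0 : mem X0 z.b)
    (s : Fin 6 → ℝ) (m0 : mem (s 0) z.s0) (m1 : mem (s 1) z.s1) (m2 : mem (s 2) z.s2)
    (m3 : mem (s 3) z.s3) (m4 : mem (s 4) z.s4) (m5 : mem (s 5) z.s5)
    (e : X = X0 + (s 0 * v 0 + s 1 * v 1 + s 2 * v 2 + s 3 * v 3 + s 4 * v 4 + s 5 * v 5)) :
    M v X0 X z := by
  refine ⟨h0, ?_, s, m0, m1, m2, m3, m4, m5, e⟩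
  obtain ⟨v0, v1, v2, v3, v4, v5⟩ := hv
  have k0 := mem_mul m0 v0
  have k1 := mem_mul m1 v1
  have k2 := mem_mul m2 v2
  have k3 := mem_mul m3 v3
  have k4 := mem_mul m4 v4
  have k5 := mem_mul m5 v5
  unfold rchk at h
  rw [Bool.and_eq_true, decide_eq_true_eq, decide_eq_true_eq] at h
  obtain ⟨ha, hb⟩ := h
  have ha' : (z.r.lo : ℝ) * 100000000 ≤ z.b.lo * 100000000 + (mlo z.s0 V0 + mlo z.s1 V1 + mlo z.s2 V2
    + mlo z.s3 V2 + mlo z.s4 V2 + mlo z.s5 V2) := by exact_mod_cast ha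
  have hb' : (z.b.hi : ℝ) * 100000000 + (mhi z.s0 V0 + mhi z.s1 V1 + mhi z.s2 V2
    + mhi z.s3 V2 + mhi z.s4 V2 + mhi z.s5 V2) ≤ z.r.hi * 100000000 := by exact_mod_cast hb
  obtain ⟨c1, c2⟩ := h0
  constructor <;> rw [e] <;> linarith

def lchk (n m d : ℤ) (x y z : Iv) : Bool :=
  decide (d * z.lo ≤ min (n * x.lo) (n * x.hi) + min (m * y.lo) (m * y.hi)) &&
  decide (max (n * x.lo) (n * x.hi) + max (m * y.lo) (m * y.hi) ≤ d * z.hi)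

lemma sc_lo (n x a b : ℝ) (h1 : a ≤ x) (h2 : x ≤ b) : min (n * a) (n * b) ≤ n * x := by
  rcases le_total 0 n with h | h
  · exact (min_le_left _ _).trans (mul_le_mul_of_nonneg_left h1 h)
  · exact (min_le_right _ _).trans (mul_le_mul_of_nonpos_left h2 h)

lemma sc_hi (n x a b : ℝ) (h1 : a ≤ x) (h2 : x ≤ b) : n * x ≤ max (n * a) (n * b) := by
  rcases le_total 0 n with h | h
  · exact (mul_le_mul_of_nonneg_left h2 h).trans (le_max_right _ _)
  · exact (mul_le_mul_of_nonpos_left h1 h).trans (le_max_left _ _)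

lemma lchk_mem {n m d : ℤ} (hd : 0 < d) {x y z : Iv} (h : lchk n m d x y z = true) {X Y : ℝ}
    (hx : mem X x) (hy : mem Y y) : mem ((n * X + m * Y) / d) z := by
  unfold lchk at h
  rw [Bool.and_eq_true, decide_eq_true_eq, decide_eq_true_eq] at h
  obtain ⟨ha, hb⟩ := h
  have ha' : (d : ℝ) * z.lo ≤ min ((n : ℝ) * x.lo) (n * x.hi) + min ((m : ℝ) * y.lo) (m * y.hi) := by
    exact_mod_cast ha
  have hb' : max ((n : ℝ) * x.lo) (n * x.hi) + max ((m : ℝ) * y.lo) (m * y.hi) ≤ (d : ℝ) * z.hi := by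
    exact_mod_cast hb
  have hd' : (0 : ℝ) < d := by exact_mod_cast hd
  have e : 100000000 * ((n * X + m * Y) / d) = (n * (100000000 * X) + m * (100000000 * Y)) / d := by ring
  have i1 := sc_lo n _ _ _ hx.1 hx.2
  have i2 := sc_lo m _ _ _ hy.1 hy.2
  have j1 := sc_hi n _ _ _ hx.1 hx.2
  have j2 := sc_hi m _ _ _ hy.1 hy.2
  unfold mem
  rw [e, le_div_iff₀ hd', div_le_iff₀ hd']
  constructor <;> linarith

def linchk (n m d : ℤ) (x y z : SF) : Bool :=
  decide (0 < d) && rchk z && lchk n m d x.b y.b z.b && lchk n m d x.s0 y.s0 z.s0 &&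
  lchk n m d x.s1 y.s1 z.s1 && lchk n m d x.s2 y.s2 z.s2 && lchk n m d x.s3 y.s3 z.s3 &&
  lchk n m d x.s4 y.s4 z.s4 && lchk n m d x.s5 y.s5 z.s5

lemma op_lin {v : Fin 6 → ℝ} (hv : VV v) {X0 X Y0 Y : ℝ} {x y : SF} (hx : M v X0 X x)
    (hy : M v Y0 Y y) (n m d : ℤ) (z : SF) (h : linchk n m d x y z = true) :
    ∃ Z0 Z : ℝ, Z0 = (n * X0 + m * Y0) / d ∧ Z = (n * X + m * Y) / d ∧ M v Z0 Z z := by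
  simp only [linchk, Bool.and_eq_true, decide_eq_true_eq] at h
  obtain ⟨⟨⟨⟨⟨⟨⟨⟨hd, hr⟩, cb⟩, c0⟩, c1⟩, c2⟩, c3⟩, c4⟩, c5⟩ := h
  obtain ⟨x0, -, s, x1, x2, x3, x4, x5, x6, ex⟩ := hx
  obtain ⟨y0, -, t, y1, y2, y3, y4, y5, y6, ey⟩ := hy
  refine ⟨_, _, rfl, rfl, M_mk v hv _ _ z hr (lchk_mem hd cb x0 y0) (fun j => (n * s j + m * t j) / d)
    (lchk_mem hd c0 x1 y1) (lchk_mem hd c1 x2 y2) (lchk_mem hd c2 x3 y3)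
    (lchk_mem hd c3 x4 y4) (lchk_mem hd c4 x5 y5) (lchk_mem hd c5 x6 y6) ?_⟩
  rw [ex, ey]; ring

def m1chk (x y z : Iv) : Bool :=
  decide (100000000 * z.lo ≤ mlo x y) && decide (mhi x y ≤ 100000000 * z.hi)

lemma m1chk_mem {x y z : Iv} (h : m1chk x y z = true) {X Y : ℝ}
    (hx : mem X x) (hy : mem Y y) : mem (X * Y) z := by
  unfold m1chk at h
  rw [Bool.and_eq_true, decide_eq_true_eq, decide_eq_true_eq] at h
  obtain ⟨ha, hb⟩ := h
  have ha' : 100000000 * (z.lo : ℝ) ≤ mlo x y := by exact_mod_cast ha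
  have hb' : (mhi x y : ℝ) ≤ 100000000 * z.hi := by exact_mod_cast hb
  have := mem_mul hx hy
  constructor <;> linarith

def m2chk (x y u w z : Iv) : Bool :=
  decide (100000000 * z.lo ≤ mlo x y + mlo u w) && decide (mhi x y + mhi u w ≤ 100000000 * z.hi)

lemma m2chk_mem {x y u w z : Iv} (h : m2chk x y u w z = true) {X Y U W : ℝ}
    (hx : mem X x) (hy : mem Y y) (hu : mem U u) (hw : mem W w) : mem (X * Y + U * W) z := by
  unfold m2chk at h
  rw [Bool.and_eq_true, decide_eq_true_eq, decide_eq_true_eq] at h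
  obtain ⟨ha, hb⟩ := h
  have ha' : 100000000 * (z.lo : ℝ) ≤ mlo x y + mlo u w := by exact_mod_cast ha
  have hb' : (mhi x y : ℝ) + mhi u w ≤ 100000000 * z.hi := by exact_mod_cast hb
  have := mem_mul hx hy
  have := mem_mul hu hw
  constructor <;> linarith

def mulchk (x y z : SF) : Bool :=
  rchk z && m1chk x.b y.b z.b && m2chk x.b y.s0 y.r x.s0 z.s0 &&
  m2chk x.b y.s1 y.r x.s1 z.s1 && m2chk x.b y.s2 y.r x.s2 z.s2 && m2chk x.b y.s3 y.r x.s3 z.s3 &&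
  m2chk x.b y.s4 y.r x.s4 z.s4 && m2chk x.b y.s5 y.r x.s5 z.s5

lemma op_mul {v : Fin 6 → ℝ} (hv : VV v) {X0 X Y0 Y : ℝ} {x y : SF} (hx : M v X0 X x)
    (hy : M v Y0 Y y) (z : SF) (h : mulchk x y z = true) :
    ∃ Z0 Z : ℝ, Z0 = X0 * Y0 ∧ Z = X * Y ∧ M v Z0 Z z := by
  simp only [mulchk, Bool.and_eq_true] at h
  obtain ⟨⟨⟨⟨⟨⟨⟨hr, cb⟩, c0⟩, c1⟩, c2⟩, c3⟩, c4⟩, c5⟩ := h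
  obtain ⟨x0, -, s, x1, x2, x3, x4, x5, x6, ex⟩ := hx
  obtain ⟨y0, yr, t, y1, y2, y3, y4, y5, y6, ey⟩ := hy
  refine ⟨_, _, rfl, rfl, M_mk v hv _ _ z hr (m1chk_mem cb x0 y0) (fun j => X0 * t j + Y * s j)
    (m2chk_mem c0 x0 y1 yr x1) (m2chk_mem c1 x0 y2 yr x2) (m2chk_mem c2 x0 y3 yr x3)
    (m2chk_mem c3 x0 y4 yr x4) (m2chk_mem c4 x0 y5 yr x5) (m2chk_mem c5 x0 y6 yr x6) ?_⟩
  have : X * Y = X0 * Y0 + ((X - X0) * Y + X0 * (Y - Y0)) := by ring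
  rw [this]
  have e1 : X - X0 = s 0 * v 0 + s 1 * v 1 + s 2 * v 2 + s 3 * v 3 + s 4 * v 4 + s 5 * v 5 := by rw [ex]; ring
  have e2 : Y - Y0 = t 0 * v 0 + t 1 * v 1 + t 2 * v 2 + t 3 * v 3 + t 4 * v 4 + t 5 * v 5 := by rw [ey]; ring
  rw [e1, e2]; ring

def Iv.plus (x y : Iv) : Iv := ⟨x.lo + y.lo, x.hi + y.hi⟩

lemma mem_add {X Y : ℝ} {x y : Iv} (hx : mem X x) (hy : mem Y y) : mem (X + Y) (x.plus y) := by
  obtain ⟨a, b⟩ := hx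
  obtain ⟨c, d⟩ := hy
  unfold mem Iv.plus
  push_cast
  constructor <;> linarith

def sqchk (x z : SF) : Bool :=
  rchk z && m1chk x.b x.b z.b && m1chk (x.b.plus x.r) x.s0 z.s0 &&
  m1chk (x.b.plus x.r) x.s1 z.s1 && m1chk (x.b.plus x.r) x.s2 z.s2 && m1chk (x.b.plus x.r) x.s3 z.s3 &&
  m1chk (x.b.plus x.r) x.s4 z.s4 && m1chk (x.b.plus x.r) x.s5 z.s5

lemma op_sq {v : Fin 6 → ℝ} (hv : VV v) {X0 X : ℝ} {x : SF} (hx : M v X0 X x)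
    (z : SF) (h : sqchk x z = true) :
    ∃ Z0 Z : ℝ, Z0 = X0 * X0 ∧ Z = X * X ∧ M v Z0 Z z := by
  simp only [sqchk, Bool.and_eq_true] at h
  obtain ⟨⟨⟨⟨⟨⟨⟨hr, cb⟩, c0⟩, c1⟩, c2⟩, c3⟩, c4⟩, c5⟩ := h
  obtain ⟨x0, xr, s, x1, x2, x3, x4, x5, x6, ex⟩ := hx
  have k := mem_add x0 xr
  refine ⟨_, _, rfl, rfl, M_mk v hv _ _ z hr (m1chk_mem cb x0 x0) (fun j => (X0 + X) * s j)
    (m1chk_mem c0 k x1) (m1chk_mem c1 k x2) (m1chk_mem c2 k x3)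
    (m1chk_mem c3 k x4) (m1chk_mem c4 k x5) (m1chk_mem c5 k x6) ?_⟩
  have : X * X = X0 * X0 + (X0 + X) * (X - X0) := by ring
  rw [this]
  have e1 : X - X0 = s 0 * v 0 + s 1 * v 1 + s 2 * v 2 + s 3 * v 3 + s 4 * v 4 + s 5 * v 5 := by rw [ex]; ring
  rw [e1]; ring

def scchk (g : Iv) (x z : SF) : Bool :=
  rchk z && m1chk g x.s0 z.s0 &&
  m1chk g x.s1 z.s1 && m1chk g x.s2 z.s2 && m1chk g x.s3 z.s3 &&
  m1chk g x.s4 z.s4 && m1chk g x.s5 z.s5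

lemma op_sc {v : Fin 6 → ℝ} (hv : VV v) {X0 X : ℝ} {x : SF} (hx : M v X0 X x)
    (g : Iv) (z : SF) (h : scchk g x z = true) (G Z0 Z : ℝ) (hG : mem G g) (hz : mem Z0 z.b)
    (e : Z = Z0 + G * (X - X0)) : M v Z0 Z z := by
  simp only [scchk, Bool.and_eq_true] at h
  obtain ⟨⟨⟨⟨⟨⟨hr, c0⟩, c1⟩, c2⟩, c3⟩, c4⟩, c5⟩ := h
  obtain ⟨x0, xr, s, x1, x2, x3, x4, x5, x6, ex⟩ := hx
  refine M_mk v hv _ _ z hr hz (fun j => G * s j)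
    (m1chk_mem c0 hG x1) (m1chk_mem c1 hG x2) (m1chk_mem c2 hG x3)
    (m1chk_mem c3 hG x4) (m1chk_mem c4 hG x5) (m1chk_mem c5 hG x6) ?_
  have e1 : X - X0 = s 0 * v 0 + s 1 * v 1 + s 2 * v 2 + s 3 * v 3 + s 4 * v 4 + s 5 * v 5 := by rw [ex]; ring
  rw [e, e1]; ring

def cst (i : Iv) : SF := ⟨i, i, ⟨0, 0⟩, ⟨0, 0⟩, ⟨0, 0⟩, ⟨0, 0⟩, ⟨0, 0⟩, ⟨0, 0⟩⟩

lemma mem_zero : mem 0 ⟨0, 0⟩ := by unfold mem; norm_num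

lemma op_cst {v : Fin 6 → ℝ} {X0 : ℝ} {i : Iv} (h : mem X0 i) : M v X0 X0 (cst i) :=
  ⟨h, h, fun _ => 0, mem_zero, mem_zero, mem_zero, mem_zero, mem_zero, mem_zero, by simp⟩

def fchk (f c : SF) : Bool :=
  decide (c.s0.hi < 0) && decide (0 ≤ f.s0.lo) &&
  decide (mhi f.s0 c.s1 ≤ mlo f.s1 c.s0) && decide (mhi f.s0 c.s2 ≤ mlo f.s2 c.s0) &&
  decide (mhi f.s0 c.s3 ≤ mlo f.s3 c.s0) && decide (mhi f.s0 c.s4 ≤ mlo f.s4 c.s0) &&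
  decide (mhi f.s0 c.s5 ≤ mlo f.s5 c.s0)

lemma prod_cmp {f0 cj fj c0 v : ℝ} {F0 CJ FJ C0 : Iv} (h : mhi F0 CJ ≤ mlo FJ C0)
    (h1 : mem f0 F0) (h2 : mem cj CJ) (h3 : mem fj FJ) (h4 : mem c0 C0) (hv : 0 ≤ v) :
    (f0 * cj - fj * c0) * v ≤ 0 := by
  have a := (mem_mul h1 h2).2
  have b := (mem_mul h3 h4).1
  have : (mhi F0 CJ : ℝ) ≤ mlo FJ C0 := by exact_mod_cast h
  exact mul_nonpos_of_nonpos_of_nonneg (by linarith) hv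

lemma op_final {v : Fin 6 → ℝ} (hv : VV v) {F C : ℝ} {f c : SF} (hf : M v 0 F f)
    (hc : M v 0 C c) (h : fchk f c = true) (hC : 0 ≤ C) : F ≤ 0 := by
  simp only [fchk, Bool.and_eq_true, decide_eq_true_eq] at h
  obtain ⟨⟨⟨⟨⟨⟨k0, l0⟩, k1⟩, k2⟩, k3⟩, k4⟩, k5⟩ := h
  obtain ⟨-, -, s, x1, x2, x3, x4, x5, x6, ex⟩ := hf
  obtain ⟨-, -, t, y1, y2, y3, y4, y5, y6, ey⟩ := hc
  obtain ⟨v0, v1, v2, v3, v4, v5⟩ := hv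
  have ps : ∀ x (i : Iv), 0 ≤ i.lo → mem x i → 0 ≤ x := by
    intro x i hi hm
    have : (0 : ℝ) ≤ i.lo := by exact_mod_cast hi
    have := hm.1
    linarith
  have p1 := prod_cmp k1 x1 y2 x2 y1 (ps _ _ (by decide) v1)
  have p2 := prod_cmp k2 x1 y3 x3 y1 (ps _ _ (by decide) v2)
  have p3 := prod_cmp k3 x1 y4 x4 y1 (ps _ _ (by decide) v3)
  have p4 := prod_cmp k4 x1 y5 x5 y1 (ps _ _ (by decide) v4)
  have p5 := prod_cmp k5 x1 y6 x6 y1 (ps _ _ (by decide) v5)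
  have hs0 := ps _ _ l0 x1
  have ht0 : t 0 < 0 := by
    have : (c.s0.hi : ℝ) < 0 := by exact_mod_cast k0
    have := y1.2
    linarith
  have hsC := mul_nonneg hs0 hC
  by_contra! hF
  have : F * t 0 < 0 := mul_neg_of_pos_of_neg hF ht0
  rw [ey] at hsC
  rw [ex] at this
  nlinarith

lemma mem_mono {x : ℝ} {i j : Iv} (h : mem x i) (h1 : j.lo ≤ i.lo) (h2 : i.hi ≤ j.hi) : mem x j := by
  have a : (j.lo : ℝ) ≤ i.lo := by exact_mod_cast h1
  have b : (i.hi : ℝ) ≤ j.hi := by exact_mod_cast h2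
  exact ⟨a.trans h.1, h.2.trans b⟩

lemma arctan_le {x : ℝ} (hx : 0 ≤ x) : Real.arctan x ≤ x := by
  have := Real.le_tan (Real.arctan_nonneg.2 hx) (Real.arctan_lt_pi_div_two x)
  rwa [Real.tan_arctan] at this

lemma le_arctan {x : ℝ} (hx : 0 ≤ x) : x - x ^ 3 / 3 ≤ Real.arctan x := by
  have h : MonotoneOn (fun x : ℝ => Real.arctan x - (x - x ^ 3 / 3)) (Set.Ici 0) := by
    apply monotoneOn_of_deriv_nonneg (convex_Ici 0)
    · fun_prop
    · exact ((Real.differentiable_arctan.sub (by fun_prop : Differentiable ℝ fun x : ℝ => x - x ^ 3 / 3)).differentiableOn)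
    · intro y hy
      have : HasDerivAt (fun x : ℝ => Real.arctan x - (x - x ^ 3 / 3)) (1 / (1 + y ^ 2) - (1 - 3 * y ^ 2 / 3)) y := by
        refine (Real.hasDerivAt_arctan y).sub ((hasDerivAt_id y).sub ?_)
        simpa using (hasDerivAt_pow 3 y).div_const 3
      rw [this.deriv]
      have e : 1 / (1 + y ^ 2) - (1 - 3 * y ^ 2 / 3) = y ^ 4 / (1 + y ^ 2) := by
        field_simp; ring
      rw [e]; positivity
  have := h (Set.mem_Ici.2 le_rfl) (Set.mem_Ici.2 hx) hx
  simp at this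
  linarith

lemma arctan_fac (x : ℝ) (h : |x| ≤ 5 / 100) : ∃ g : ℝ, mem g ⟨99900000, 100000000⟩ ∧ Real.arctan x = g * x := by
  rcases eq_or_ne x 0 with rfl | hx
  · exact ⟨1, by unfold mem; norm_num, by simp⟩
  refine ⟨Real.arctan x / x, ?_, by field_simp⟩
  have h2 : x ^ 2 ≤ (5 / 100) ^ 2 := by rw [← sq_abs]; gcongr
  have key : ∀ y : ℝ, 0 < y → y ^ 2 ≤ (5 / 100) ^ 2 → 999 / 1000 ≤ Real.arctan y / y ∧ Real.arctan y / y ≤ 1 := by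
    intro y hy hy2
    rw [le_div_iff₀ hy, div_le_iff₀ hy]
    have a := arctan_le hy.le
    have b := le_arctan hy.le
    constructor <;> nlinarith
  have : 999 / 1000 ≤ Real.arctan x / x ∧ Real.arctan x / x ≤ 1 := by
    rcases lt_or_gt_of_ne hx with hx | hx
    · have := key (-x) (by linarith) (by nlinarith)
      rwa [Real.arctan_neg, neg_div_neg_eq] at this
    · exact key x hx h2
  unfold mem
  push_cast
  constructor <;> linarith

lemma mem_inv {D : ℝ} {g i : Iv} (hD : mem D i) (h : (decide (0 < i.lo) && decide (0 ≤ g.lo) &&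
    decide (g.lo * i.hi ≤ 10000000000000000) && decide (10000000000000000 ≤ g.hi * i.lo)) = true) :
    mem (1 / D) g := by
  simp only [Bool.and_eq_true, decide_eq_true_eq] at h
  obtain ⟨⟨⟨h1, h2⟩, h3⟩, h4⟩ := h
  have k1 : (0 : ℝ) < i.lo := by exact_mod_cast h1
  have k2 : (0 : ℝ) ≤ g.lo := by exact_mod_cast h2
  have k3 : (g.lo : ℝ) * i.hi ≤ 10000000000000000 := by exact_mod_cast h3
  have k4 : (10000000000000000 : ℝ) ≤ g.hi * i.lo := by exact_mod_cast h4
  obtain ⟨a, b⟩ := hD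
  have hp : 0 < D := by linarith
  have hg : (0 : ℝ) ≤ g.hi := by
    by_contra! hc
    nlinarith
  unfold mem
  rw [mul_one_div, le_div_iff₀ hp, div_le_iff₀ hp]
  constructor <;> nlinarith [mul_le_mul_of_nonneg_left b k2, mul_le_mul_of_nonneg_left a hg]

lemma mem_pos {x : ℝ} {i : Iv} (h : mem x i) (hi : decide (0 < i.lo) = true) : 0 < x := by
  have : (0 : ℝ) < i.lo := by exact_mod_cast of_decide_eq_true hi
  have := h.1
  linarith

lemma op_ang {v : Fin 6 → ℝ} (hv : VV v) {y0 y x0 x n d0 d : ℝ} {nn dn : SF}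
    (hn : M v 0 n nn) (hd : M v d0 d dn) (en : n = y * x0 - y0 * x) (ed : d = x * x0 + y * y0)
    (py0 : 0 < y0) (py : 0 < y) (px0 : 0 < x0) (px : 0 < x) (g : Iv) (z w : SF)
    (hg : (decide (0 < dn.r.lo) && decide (0 ≤ g.lo) &&
      decide (g.lo * dn.r.hi ≤ 10000000000000000) &&
      decide (10000000000000000 ≤ g.hi * dn.r.lo)) = true)
    (h1 : scchk g nn z = true) (h2 : scchk ⟨99900000, 100000000⟩ z w = true)
    (h3 : (decide (z.b.lo ≤ 0) && decide (0 ≤ z.b.hi) && decide (w.b.lo ≤ 0) && decide (0 ≤ w.b.hi) &&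
      decide (-5000000 ≤ z.r.lo) && decide (z.r.hi ≤ 5000000)) = true) :
    M v 0 (Real.arctan (y / x) - Real.arctan (y0 / x0)) w := by
  simp only [Bool.and_eq_true, decide_eq_true_eq] at h3
  obtain ⟨⟨⟨⟨⟨a1, a2⟩, a3⟩, a4⟩, a5⟩, a6⟩ := h3
  have hz0 : mem 0 z.b := by
    have b1 : (z.b.lo : ℝ) ≤ 0 := by exact_mod_cast a1
    have b2 : (0 : ℝ) ≤ z.b.hi := by exact_mod_cast a2
    unfold mem; constructor <;> linarith
  have hw0 : mem 0 w.b := by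
    have b1 : (w.b.lo : ℝ) ≤ 0 := by exact_mod_cast a3
    have b2 : (0 : ℝ) ≤ w.b.hi := by exact_mod_cast a4
    unfold mem; constructor <;> linarith
  have hG := mem_inv hd.2.1 hg
  have hdp : 0 < d := by rw [ed]; positivity
  have hτ : M v 0 (n / d) z := op_sc hv hn g z h1 (1 / d) 0 (n / d) hG hz0 (by ring)
  have hab : |n / d| ≤ 5 / 100 := by
    have b1 : (-5000000 : ℝ) ≤ z.r.lo := by exact_mod_cast a5
    have b2 : (z.r.hi : ℝ) ≤ 5000000 := by exact_mod_cast a6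
    obtain ⟨c1, c2⟩ := hτ.2.1
    rw [abs_le]; constructor <;> linarith
  obtain ⟨G, hG1, hG2⟩ := arctan_fac _ hab
  refine op_sc hv hτ _ w h2 G 0 _ hG1 hw0 ?_
  have e1 : Real.arctan (y / x) + Real.arctan (-(y0 / x0)) = Real.arctan (n / d) := by
    rw [Real.arctan_add]
    · congr 1
      rw [en, ed]
      have : 0 < x * x0 + y * y0 := by positivity
      have : 0 < 1 + y / x * (y0 / x0) := by positivity
      have : 1 - y / x * -(y0 / x0) ≠ 0 := by
        have e : 1 - y / x * -(y0 / x0) = 1 + y / x * (y0 / x0) := by ring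
        rw [e]; positivity
      rw [div_eq_div_iff this (by positivity)]
      field_simp
      ring
    · have : 0 < y / x * (y0 / x0) := by positivity
      linarith
  rw [Real.arctan_neg, hG2] at e1
  rw [sub_eq_add_neg, e1]; ring

end RR


set_option linter.unusedSimpArgs false
open MeasureTheory Metric
namespace RR

def zN : SF := ⟨⟨3959591780, 3959591827⟩, ⟨3902465703, 4281382435⟩, ⟨-1948775370, -1842706640⟩, ⟨-14025352111, -13466775221⟩, ⟨7014519862, 7340303707⟩, ⟨2273736012, 2496942096⟩, ⟨4095790186, 4661356640⟩, ⟨4095790186, 4661356640⟩⟩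
def zA : SF := ⟨⟨7557737502, 7557737579⟩, ⟨7450575532, 7686959579⟩, ⟨2942892673, 2969720149⟩, ⟨-332927225, -328740424⟩, ⟨3282722409, 3319802969⟩, ⟨-401395600, -400000000⟩, ⟨-666538261, -656309526⟩, ⟨-666538261, -656309526⟩⟩
def zD : SF := ⟨⟨620204099, 620204114⟩, ⟨596094798, 688444958⟩, ⟨-661667650, -658876448⟩, ⟨-200000000, -200000000⟩, ⟨1397199061, 1414004693⟩, ⟨-401395600, -400000000⟩, ⟨1043703913, 1076186817⟩, ⟨1043703913, 1076186817⟩⟩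
def zS : SF := ⟨⟨6941428174, 6941428202⟩, ⟨6894930844, 7076398093⟩, ⟨1258876448, 1264458850⟩, ⟨200000000, 200000000⟩, ⟨-802791200, -800000000⟩, ⟨4504946270, 4579328877⟩, ⟨1241907983, 1280031715⟩, ⟨1241907983, 1280031715⟩⟩
def zM : SF := ⟨⟨116498970910, 116498971929⟩, ⟨114703343687, 121169115456⟩, ⟨45388372874, 46261186662⟩, ⟨-47812964441, -45134038991⟩, ⟨-35473772689, -34687237898⟩, ⟨153333192775, 158206855852⟩, ⟨37107642460, 41952078097⟩, ⟨37107642460, 41952078097⟩⟩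
def zC : SF := ⟨⟨-1296, 3424⟩, ⟨-7226341773, 14027947864⟩, ⟨-212798003206, -202174102014⟩, ⟨-644208661600, -604910755530⟩, ⟨216641316516, 243173289738⟩, ⟨-83207484051, -67172102109⟩, ⟨108808797319, 168192897032⟩, ⟨108808797319, 168192897032⟩⟩

noncomputable def vv (ℓ a b p q s t : ℝ) : Fin 6 → ℝ := ![a + b - 2 * ℓ, ((a - b) / 2) ^ 2, p - 2, q - 2, s - 2, t - 2]

lemma vv_mem (ℓ a b p q s t : ℝ) (ha : |a - ℓ| ≤ 13956 / 1000000) (hb : |b - ℓ| ≤ 13956 / 1000000)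
    (hp : p ∈ Set.Icc 2 (2 + 13956 / 1000000)) (hq : q ∈ Set.Icc 2 (2 + 13956 / 1000000))
    (hs : s ∈ Set.Icc 2 (2 + 13956 / 1000000)) (ht : t ∈ Set.Icc 2 (2 + 13956 / 1000000)) :
    VV (vv ℓ a b p q s t) := by
  rw [abs_le] at ha hb
  obtain ⟨hp1, hp2⟩ := hp
  obtain ⟨hq1, hq2⟩ := hq
  obtain ⟨hs1, hs2⟩ := hs
  obtain ⟨ht1, ht2⟩ := ht
  have hd : |(a - b) / 2| ≤ 13956 / 1000000 := by rw [abs_le]; constructor <;> linarith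
  have hd2 : ((a - b) / 2) ^ 2 ≤ (13956 / 1000000) ^ 2 := by rw [← sq_abs]; gcongr
  have hd3 := sq_nonneg ((a - b) / 2)
  refine ⟨?_, ?_, ?_, ?_, ?_, ?_⟩ <;> simp only [mem, vv, V0, V1, V2] <;> simp <;> constructor <;> linarith

lemma poly (ℓ a b p q s t : ℝ) (hl : mem ℓ ⟨330136024, 330136025⟩) (ha : |a - ℓ| ≤ 13956 / 1000000)
    (hb : |b - ℓ| ≤ 13956 / 1000000)
    (hp : p ∈ Set.Icc 2 (2 + 13956 / 1000000)) (hq : q ∈ Set.Icc 2 (2 + 13956 / 1000000))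
    (hs : s ∈ Set.Icc 2 (2 + 13956 / 1000000)) (ht : t ∈ Set.Icc 2 (2 + 13956 / 1000000))
    (v : Fin 6 → ℝ) (ev : v = vv ℓ a b p q s t) :
    M v (gr ℓ ℓ 2 2 2 2) (gr a b p t s q) zN ∧
    M v (dd ℓ ℓ 2 2 2 2) (dd a b p t s q) zA ∧
    M v (dd 2 2 2 2 ℓ ℓ) (dd p s t q b a) zD ∧
    M v (dd ℓ 2 2 2 2 ℓ + dd ℓ 2 2 2 2 ℓ) (dd a q s t p b + dd b q t s p a) zS ∧
    M v (dd ℓ 2 2 2 2 ℓ * dd ℓ 2 2 2 2 ℓ - gr ℓ ℓ 2 2 2 2) (dd a q s t p b * dd b q t s p a - gr a b p t s q) zM ∧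
    M v (64 * gr ℓ ℓ 2 2 2 2 - ((ℓ * 2 + ℓ * 2) ^ 2 - (2 * 2) ^ 2) * ((2 * 2) ^ 2 - (ℓ * 2 - ℓ * 2) ^ 2)) (64 * gr a b p t s q - ((a * t + b * s) ^ 2 - (p * q) ^ 2) * ((p * q) ^ 2 - (a * t - b * s) ^ 2)) zC := by
  have hv : VV v := by rw [ev]; exact vv_mem ℓ a b p q s t ha hb hp hq hs ht
  have z0 : mem 0 ⟨0, 0⟩ := mem_zero
  have z1 : mem 1 ⟨100000000, 100000000⟩ := by unfold mem; norm_num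
  rw [abs_le] at ha hb
  obtain ⟨hs1, hs2⟩ := hs
  obtain ⟨ht1, ht2⟩ := ht
  have w0 : v 0 = a + b - 2 * ℓ := by rw [ev]; rfl
  have w1 : v 1 = ((a - b) / 2) ^ 2 := by rw [ev]; rfl
  have w2 : v 2 = p - 2 := by rw [ev]; rfl
  have w3 : v 3 = q - 2 := by rw [ev]; rfl
  have w4 : v 4 = s - 2 := by rw [ev]; rfl
  have w5 : v 5 = t - 2 := by rw [ev]; rfl
  have y1 : mem (a - b) ⟨-2791200, 2791200⟩ := by unfold mem; push_cast; constructor <;> linarith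
  have y2 : mem (-(a - b)) ⟨-2791200, 2791200⟩ := by unfold mem; push_cast; constructor <;> linarith
  have y3 : mem (s - t) ⟨-1395600, 1395600⟩ := by unfold mem; push_cast; constructor <;> linarith
  have y4 : mem (-(s - t)) ⟨-1395600, 1395600⟩ := by unfold mem; push_cast; constructor <;> linarith
  have hsg : M v (2 * ℓ) (a + b) ⟨⟨660272048, 660272050⟩, ⟨657480848, 663063250⟩, ⟨100000000, 100000000⟩, ⟨0, 0⟩, ⟨0, 0⟩, ⟨0, 0⟩, ⟨0, 0⟩, ⟨0, 0⟩⟩ := by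
    refine M_mk v hv _ _ _ (by decide +kernel) ?_ ![1, 0, 0, 0, 0, 0] z1 z0 z0 z0 z0 z0 ?_
    · obtain ⟨l1, l2⟩ := hl; unfold mem; push_cast at *; constructor <;> linarith
    · simp only [w0, w1, w2, w3, w4, w5]; simp; try ring
  have hS : M v (4) (s + t) ⟨⟨400000000, 400000000⟩, ⟨400000000, 402791200⟩, ⟨0, 0⟩, ⟨0, 0⟩, ⟨0, 0⟩, ⟨0, 0⟩, ⟨100000000, 100000000⟩, ⟨100000000, 100000000⟩⟩ := by
    refine M_mk v hv _ _ _ (by decide +kernel) ?_ ![0, 0, 0, 0, 1, 1] z0 z0 z0 z0 z1 z1 ?_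
    · unfold mem; norm_num
    · simp only [w0, w1, w2, w3, w4, w5]; simp; try ring
  have hp : M v (2) (p) ⟨⟨200000000, 200000000⟩, ⟨200000000, 201395600⟩, ⟨0, 0⟩, ⟨0, 0⟩, ⟨100000000, 100000000⟩, ⟨0, 0⟩, ⟨0, 0⟩, ⟨0, 0⟩⟩ := by
    refine M_mk v hv _ _ _ (by decide +kernel) ?_ ![0, 0, 1, 0, 0, 0] z0 z0 z1 z0 z0 z0 ?_
    · unfold mem; norm_num
    · simp only [w0, w1, w2, w3, w4, w5]; simp; try ring
  have hq : M v (2) (q) ⟨⟨200000000, 200000000⟩, ⟨200000000, 201395600⟩, ⟨0, 0⟩, ⟨0, 0⟩, ⟨0, 0⟩, ⟨100000000, 100000000⟩, ⟨0, 0⟩, ⟨0, 0⟩⟩ := by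
    refine M_mk v hv _ _ _ (by decide +kernel) ?_ ![0, 0, 0, 1, 0, 0] z0 z0 z0 z1 z0 z0 ?_
    · unfold mem; norm_num
    · simp only [w0, w1, w2, w3, w4, w5]; simp; try ring
  have hE : M v (0) ((a - b) * (s - t)) ⟨⟨0, 0⟩, ⟨-77908, 77908⟩, ⟨0, 0⟩, ⟨0, 0⟩, ⟨0, 0⟩, ⟨0, 0⟩, ⟨-2791200, 2791200⟩, ⟨-2791200, 2791200⟩⟩ := by
    refine M_mk v hv _ _ _ (by decide +kernel) ?_ ![0, 0, 0, 0, a - b, -(a - b)] z0 z0 z0 z0 y1 y2 ?_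
    · exact z0
    · simp only [w0, w1, w2, w3, w4, w5]; simp; try ring
  have hDz : M v (0) ((a - b) ^ 2) ⟨⟨0, 0⟩, ⟨0, 77912⟩, ⟨0, 0⟩, ⟨400000000, 400000000⟩, ⟨0, 0⟩, ⟨0, 0⟩, ⟨0, 0⟩, ⟨0, 0⟩⟩ := by
    refine M_mk v hv _ _ _ (by decide +kernel) ?_ ![0, 4, 0, 0, 0, 0] z0 (by unfold mem; norm_num) z0 z0 z0 z0 ?_
    · exact z0
    · simp only [w0, w1, w2, w3, w4, w5]; simp; try ring
  have hDs : M v (0) ((s - t) ^ 2) ⟨⟨0, 0⟩, ⟨-38954, 38954⟩, ⟨0, 0⟩, ⟨0, 0⟩, ⟨0, 0⟩, ⟨0, 0⟩, ⟨-1395600, 1395600⟩, ⟨-1395600, 1395600⟩⟩ := by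
    refine M_mk v hv _ _ _ (by decide +kernel) ?_ ![0, 0, 0, 0, s - t, -(s - t)] z0 z0 z0 z0 y3 y4 ?_
    · exact z0
    · simp only [w0, w1, w2, w3, w4, w5]; simp; try ring
  obtain ⟨Z1, X1, f1, e1, h1⟩ := op_sq hv hq ⟨⟨400000000, 400000000⟩, ⟨400000000, 405601877⟩, ⟨0, 0⟩, ⟨0, 0⟩, ⟨0, 0⟩, ⟨400000000, 401395600⟩, ⟨0, 0⟩, ⟨0, 0⟩⟩ (by decide +kernel)
  obtain ⟨Z2, X2, f2, e2, h2⟩ := op_sq hv hp ⟨⟨400000000, 400000000⟩, ⟨400000000, 405601877⟩, ⟨0, 0⟩, ⟨0, 0⟩, ⟨400000000, 401395600⟩, ⟨0, 0⟩, ⟨0, 0⟩, ⟨0, 0⟩⟩ (by decide +kernel)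
  obtain ⟨Z3, X3, f3, e3, h3⟩ := op_sq hv hS ⟨⟨1600000000, 1600000000⟩, ⟨1600000000, 1622407508⟩, ⟨0, 0⟩, ⟨0, 0⟩, ⟨0, 0⟩, ⟨0, 0⟩, ⟨800000000, 802791200⟩, ⟨800000000, 802791200⟩⟩ (by decide +kernel)
  obtain ⟨Z4, X4, f4, e4, h4⟩ := op_sq hv hsg ⟨⟨4359591773, 4359591801⟩, ⟨4322654838, 4396528736⟩, ⟨1317752896, 1323335300⟩, ⟨0, 0⟩, ⟨0, 0⟩, ⟨0, 0⟩, ⟨0, 0⟩, ⟨0, 0⟩⟩ (by decide +kernel)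
  obtain ⟨Z5, X5, f5, e5, h5⟩ := op_lin hv h4 hDz (1) (-1) 4 ⟨⟨1089897943, 1089897951⟩, ⟨1080644231, 1099132185⟩, ⟨329438224, 330833825⟩, ⟨-100000000, -100000000⟩, ⟨0, 0⟩, ⟨0, 0⟩, ⟨0, 0⟩, ⟨0, 0⟩⟩ (by decide +kernel)
  obtain ⟨Z6, X6, f6, e6, h6⟩ := op_lin hv h3 hDs (1) (-1) 4 ⟨⟨400000000, 400000000⟩, ⟨400000000, 405611616⟩, ⟨0, 0⟩, ⟨0, 0⟩, ⟨0, 0⟩, ⟨0, 0⟩, ⟨199651100, 201046700⟩, ⟨199651100, 201046700⟩⟩ (by decide +kernel)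
  obtain ⟨Z7, X7, f7, e7, h7⟩ := op_lin hv h4 hDz (1) (1) 2 ⟨⟨2179795886, 2179795901⟩, ⟨2161327418, 2198303325⟩, ⟨658876448, 661667650⟩, ⟨200000000, 200000000⟩, ⟨0, 0⟩, ⟨0, 0⟩, ⟨0, 0⟩, ⟨0, 0⟩⟩ (by decide +kernel)
  obtain ⟨Z8, X8, f8, e8, h8⟩ := op_lin hv h3 hDs (1) (1) 2 ⟨⟨800000000, 800000000⟩, ⟨800000000, 811223231⟩, ⟨0, 0⟩, ⟨0, 0⟩, ⟨0, 0⟩, ⟨0, 0⟩, ⟨399302200, 402093400⟩, ⟨399302200, 402093400⟩⟩ (by decide +kernel)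
  obtain ⟨Z9, X9, f9, e9, h9⟩ := op_lin hv h8 h7 (1) (-1) 2 ⟨⟨-689897951, -689897943⟩, ⟨-699151663, -675052093⟩, ⟨-330833825, -329438224⟩, ⟨-100000000, -100000000⟩, ⟨0, 0⟩, ⟨0, 0⟩, ⟨199651100, 201046700⟩, ⟨199651100, 201046700⟩⟩ (by decide +kernel)
  obtain ⟨Z10, X10, f10, e10, h10⟩ := op_lin hv h2 h9 (1) (1) 1 ⟨⟨-289897951, -289897943⟩, ⟨-299151663, -269450216⟩, ⟨-330833825, -329438224⟩, ⟨-100000000, -100000000⟩, ⟨400000000, 401395600⟩, ⟨0, 0⟩, ⟨199651100, 201046700⟩, ⟨199651100, 201046700⟩⟩ (by decide +kernel)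
  obtain ⟨Z11, X11, f11, e11, h11⟩ := op_mul hv hE hS ⟨⟨0, 0⟩, ⟨-313807, 313807⟩, ⟨0, 0⟩, ⟨0, 0⟩, ⟨0, 0⟩, ⟨0, 0⟩, ⟨-11242708, 11242708⟩, ⟨-11242708, 11242708⟩⟩ (by decide +kernel)
  obtain ⟨Z12, X12, f12, e12, h12⟩ := op_mul hv hE hsg ⟨⟨0, 0⟩, ⟨-516580, 516580⟩, ⟨0, 0⟩, ⟨0, 0⟩, ⟨0, 0⟩, ⟨0, 0⟩, ⟨-18507422, 18507422⟩, ⟨-18507422, 18507422⟩⟩ (by decide +kernel)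
  obtain ⟨Z13, X13, f13, e13, h13⟩ := op_mul hv h11 hsg ⟨⟨0, 0⟩, ⟨-2080736, 2080736⟩, ⟨0, 0⟩, ⟨0, 0⟩, ⟨0, 0⟩, ⟨0, 0⟩, ⟨-74546266, 74546266⟩, ⟨-74546266, 74546266⟩⟩ (by decide +kernel)
  obtain ⟨Z14, X14, f14, e14, h14⟩ := op_mul hv hDs h3 ⟨⟨0, 0⟩, ⟨-631993, 631993⟩, ⟨0, 0⟩, ⟨0, 0⟩, ⟨0, 0⟩, ⟨0, 0⟩, ⟨-22642320, 22642320⟩, ⟨-22642320, 22642320⟩⟩ (by decide +kernel)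
  obtain ⟨Z15, X15, f15, e15, h15⟩ := op_mul hv hDz h3 ⟨⟨0, 0⟩, ⟨0, 1264051⟩, ⟨0, 0⟩, ⟨6400000000, 6489630032⟩, ⟨0, 0⟩, ⟨0, 0⟩, ⟨0, 0⟩, ⟨0, 0⟩⟩ (by decide +kernel)
  obtain ⟨Z16, X16, f16, e16, h16⟩ := op_mul hv hDs h4 ⟨⟨0, 0⟩, ⟨-1712624, 1712624⟩, ⟨0, 0⟩, ⟨0, 0⟩, ⟨0, 0⟩, ⟨0, 0⟩, ⟨-61357956, 61357956⟩, ⟨-61357956, 61357956⟩⟩ (by decide +kernel)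
  obtain ⟨Z17, X17, f17, e17, h17⟩ := op_mul hv hDz h4 ⟨⟨0, 0⟩, ⟨0, 3425424⟩, ⟨0, 0⟩, ⟨17290619352, 17586114944⟩, ⟨0, 0⟩, ⟨0, 0⟩, ⟨0, 0⟩, ⟨0, 0⟩⟩ (by decide +kernel)
  obtain ⟨Z18, X18, f18, e18, h18⟩ := op_lin hv h14 h17 (1) (1) 1 ⟨⟨0, 0⟩, ⟨-631993, 4057416⟩, ⟨0, 0⟩, ⟨17290619352, 17586114944⟩, ⟨0, 0⟩, ⟨0, 0⟩, ⟨-22642320, 22642320⟩, ⟨-22642320, 22642320⟩⟩ (by decide +kernel)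
  obtain ⟨Z19, X19, f19, e19, h19⟩ := op_lin hv h18 h13 (1) (-2) 4 ⟨⟨0, 0⟩, ⟨-1198366, 2054722⟩, ⟨0, 0⟩, ⟨4322654838, 4396528736⟩, ⟨0, 0⟩, ⟨0, 0⟩, ⟨-42933713, 42933713⟩, ⟨-42933713, 42933713⟩⟩ (by decide +kernel)
  obtain ⟨Z20, X20, f20, e20, h20⟩ := op_mul hv hDs hS ⟨⟨0, 0⟩, ⟨-156904, 156904⟩, ⟨0, 0⟩, ⟨0, 0⟩, ⟨0, 0⟩, ⟨0, 0⟩, ⟨-5621354, 5621354⟩, ⟨-5621354, 5621354⟩⟩ (by decide +kernel)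
  obtain ⟨Z21, X21, f21, e21, h21⟩ := op_lin hv h20 h12 (1) (-1) 2 ⟨⟨0, 0⟩, ⟨-336742, 336742⟩, ⟨0, 0⟩, ⟨0, 0⟩, ⟨0, 0⟩, ⟨0, 0⟩, ⟨-12064388, 12064388⟩, ⟨-12064388, 12064388⟩⟩ (by decide +kernel)
  obtain ⟨Z22, X22, f22, e22, h22⟩ := op_lin hv h3 h1 (1) (-1) 1 ⟨⟨1200000000, 1200000000⟩, ⟨1194398123, 1222407508⟩, ⟨0, 0⟩, ⟨0, 0⟩, ⟨0, 0⟩, ⟨-401395600, -400000000⟩, ⟨800000000, 802791200⟩, ⟨800000000, 802791200⟩⟩ (by decide +kernel)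
  obtain ⟨Z23, X23, f23, e23, h23⟩ := op_mul hv h2 h22 ⟨⟨4800000000, 4800000000⟩, ⟨4777592492, 4958107797⟩, ⟨0, 0⟩, ⟨0, 0⟩, ⟨4777592492, 4906689952⟩, ⟨-1605582400, -1600000000⟩, ⟨3200000000, 3211164800⟩, ⟨3200000000, 3211164800⟩⟩ (by decide +kernel)
  obtain ⟨Z24, X24, f24, e24, h24⟩ := op_lin hv h1 hDs (1) (-1) 1 ⟨⟨400000000, 400000000⟩, ⟨399961046, 405640831⟩, ⟨0, 0⟩, ⟨0, 0⟩, ⟨0, 0⟩, ⟨400000000, 401395600⟩, ⟨-1395600, 1395600⟩, ⟨-1395600, 1395600⟩⟩ (by decide +kernel)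
  obtain ⟨Z25, X25, f25, e25, h25⟩ := op_mul hv h23 h24 ⟨⟨19200000000, 19200000000⟩, ⟨19200000000, 20022799967⟩, ⟨0, 0⟩, ⟨0, 0⟩, ⟨19108508904, 19903537896⟩, ⟨12687102210, 12867612064⟩, ⟨12731764672, 13092784380⟩, ⟨12731764672, 13092784380⟩⟩ (by decide +kernel)
  obtain ⟨Z26, X26, f26, e26, h26⟩ := op_sq hv h10 ⟨⟨840408173, 840408220⟩, ⟨719960920, 894917174⟩, ⟨1842706640, 1948775370⟩, ⟨559348159, 589049614⟩, ⟨-2364419233, -2237392636⟩, ⟨0, 0⟩, ⟨-1184264811, -1116744752⟩, ⟨-1184264811, -1116744752⟩⟩ (by decide +kernel)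
  obtain ⟨Z27, X27, f27, e27, h27⟩ := op_mul hv h1 h26 ⟨⟨3361632692, 3361632880⟩, ⟨2879843682, 3629800853⟩, ⟨7370826560, 7795101480⟩, ⟨2237392636, 2356198456⟩, ⟨-9457676932, -8949570544⟩, ⟨2879843680, 3592158161⟩, ⟨-4737059244, -4466979008⟩, ⟨-4737059244, -4466979008⟩⟩ (by decide +kernel)
  obtain ⟨Z28, X28, f28, e28, h28⟩ := op_lin hv h3 hDs (1) (1) 1 ⟨⟨1600000000, 1600000000⟩, ⟨1600000000, 1622446462⟩, ⟨0, 0⟩, ⟨0, 0⟩, ⟨0, 0⟩, ⟨0, 0⟩, ⟨798604400, 804186800⟩, ⟨798604400, 804186800⟩⟩ (by decide +kernel)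
  obtain ⟨Z29, X29, f29, e29, h29⟩ := op_lin hv h28 h1 (1) (-1) 1 ⟨⟨1200000000, 1200000000⟩, ⟨1194398123, 1222446462⟩, ⟨0, 0⟩, ⟨0, 0⟩, ⟨0, 0⟩, ⟨-401395600, -400000000⟩, ⟨798604400, 804186800⟩, ⟨798604400, 804186800⟩⟩ (by decide +kernel)
  obtain ⟨Z30, X30, f30, e30, h30⟩ := op_mul hv h19 h29 ⟨⟨0, 0⟩, ⟨-14649381, 25117873⟩, ⟨0, 0⟩, ⟨51629708248, 53745209985⟩, ⟨0, 0⟩, ⟨0, 0⟩, ⟨-524841656, 524841656⟩, ⟨-524841656, 524841656⟩⟩ (by decide +kernel)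
  obtain ⟨Z31, X31, f31, e31, h31⟩ := op_mul hv h21 hS ⟨⟨0, 0⟩, ⟨-1356364, 1356364⟩, ⟨0, 0⟩, ⟨0, 0⟩, ⟨0, 0⟩, ⟨0, 0⟩, ⟨-48594294, 48594294⟩, ⟨-48594294, 48594294⟩⟩ (by decide +kernel)
  obtain ⟨Z32, X32, f32, e32, h32⟩ := op_mul hv h31 h10 ⟨⟨0, 0⟩, ⟨-4057586, 4057586⟩, ⟨0, 0⟩, ⟨0, 0⟩, ⟨0, 0⟩, ⟨0, 0⟩, ⟨-145370639, 145370639⟩, ⟨-145370639, 145370639⟩⟩ (by decide +kernel)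
  obtain ⟨Z33, X33, f33, e33, h33⟩ := op_lin hv h25 h27 (1) (-1) 1 ⟨⟨15838367120, 15838367308⟩, ⟨15620331307, 17102765186⟩, ⟨-7795101480, -7370826560⟩, ⟨-2356198456, -2237392636⟩, ⟨28058079448, 29361214828⟩, ⟨9094944049, 9987768384⟩, ⟨17198743680, 17829843624⟩, ⟨17198743680, 17829843624⟩⟩ (by decide +kernel)
  obtain ⟨Z34, X34, f34, e34, h34⟩ := op_lin hv h30 h32 (-1) (2) 1 ⟨⟨0, 0⟩, ⟨-33233043, 22764551⟩, ⟨0, 0⟩, ⟨-53745209985, -51629708248⟩, ⟨0, 0⟩, ⟨0, 0⟩, ⟨-815582934, 815582934⟩, ⟨-815582934, 815582934⟩⟩ (by decide +kernel)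
  obtain ⟨Z35, X35, f35, e35, h35⟩ := op_lin hv h33 h34 (1) (1) 4 zN (by decide +kernel)
  obtain ⟨Z36, X36, f36, e36, h36⟩ := op_mul hv h5 hp ⟨⟨2179795886, 2179795902⟩, ⟨2161159317, 2213603859⟩, ⟨658876448, 666284767⟩, ⟨-201395600, -200000000⟩, ⟨1089897943, 1089897951⟩, ⟨0, 0⟩, ⟨0, 0⟩, ⟨0, 0⟩⟩ (by decide +kernel)
  obtain ⟨Z37, X37, f37, e37, h37⟩ := op_mul hv h5 hsg ⟨⟨7196291469, 7196291544⟩, ⟨7104512275, 7287941586⟩, ⟨3255891171, 3283535464⟩, ⟨-663063250, -657480848⟩, ⟨0, 0⟩, ⟨0, 0⟩, ⟨0, 0⟩, ⟨0, 0⟩⟩ (by decide +kernel)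
  obtain ⟨Z38, X38, f38, e38, h38⟩ := op_mul hv h2 hsg ⟨⟨2641088192, 2641088200⟩, ⟨2629923392, 2689396988⟩, ⟨400000000, 400000000⟩, ⟨0, 0⟩, ⟨2629923392, 2661506711⟩, ⟨0, 0⟩, ⟨0, 0⟩, ⟨0, 0⟩⟩ (by decide +kernel)
  obtain ⟨Z39, X39, f39, e39, h39⟩ := op_mul hv hsg h8 ⟨⟨5282176384, 5282176400⟩, ⟨5259533521, 5378923121⟩, ⟨800000000, 811223231⟩, ⟨0, 0⟩, ⟨0, 0⟩, ⟨0, 0⟩, ⟨2636480813, 2654910336⟩, ⟨2636480813, 2654910336⟩⟩ (by decide +kernel)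
  obtain ⟨Z40, X40, f40, e40, h40⟩ := op_lin hv h39 h11 (1) (-1) 2 ⟨⟨2641088192, 2641088200⟩, ⟨2629766760, 2689618464⟩, ⟨400000000, 405611616⟩, ⟨0, 0⟩, ⟨0, 0⟩, ⟨0, 0⟩, ⟨1312619052, 1333076522⟩, ⟨1312619052, 1333076522⟩⟩ (by decide +kernel)
  obtain ⟨Z41, X41, f41, e41, h41⟩ := op_lin hv h7 h1 (1) (-1) 1 ⟨⟨1779795886, 1779795901⟩, ⟨1755725541, 1798303325⟩, ⟨658876448, 661667650⟩, ⟨200000000, 200000000⟩, ⟨0, 0⟩, ⟨-401395600, -400000000⟩, ⟨0, 0⟩, ⟨0, 0⟩⟩ (by decide +kernel)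
  obtain ⟨Z42, X42, f42, e42, h42⟩ := op_mul hv hp h41 ⟨⟨3559591772, 3559591802⟩, ⟨3511451083, 3621703771⟩, ⟨1317752896, 1323335300⟩, ⟨400000000, 400000000⟩, ⟨1755725541, 1798303325⟩, ⟨-802791200, -800000000⟩, ⟨0, 0⟩, ⟨0, 0⟩⟩ (by decide +kernel)
  obtain ⟨Z43, X43, f43, e43, h43⟩ := op_lin hv h37 h38 (1) (1) 1 ⟨⟨9837379661, 9837379744⟩, ⟨9734435667, 9977338574⟩, ⟨3655891171, 3683535464⟩, ⟨-663063250, -657480848⟩, ⟨2629923392, 2661506711⟩, ⟨0, 0⟩, ⟨0, 0⟩, ⟨0, 0⟩⟩ (by decide +kernel)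
  obtain ⟨Z44, X44, f44, e44, h44⟩ := op_lin hv h43 h40 (1) (-1) 1 ⟨⟨7196291461, 7196291552⟩, ⟨7067303435, 7325085582⟩, ⟨3250279555, 3283535464⟩, ⟨-663063250, -657480848⟩, ⟨2629923392, 2661506711⟩, ⟨0, 0⟩, ⟨-1333076522, -1312619052⟩, ⟨-1333076522, -1312619052⟩⟩ (by decide +kernel)
  obtain ⟨Z45, X45, f45, e45, h45⟩ := op_lin hv h44 h42 (1) (1) 2 ⟨⟨5377941616, 5377941677⟩, ⟨5289416214, 5473355720⟩, ⟨2284016225, 2303435382⟩, ⟨-131531625, -128740424⟩, ⟨2192824466, 2229905018⟩, ⟨-401395600, -400000000⟩, ⟨-666538261, -656309526⟩, ⟨-666538261, -656309526⟩⟩ (by decide +kernel)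
  obtain ⟨Z46, X46, f46, e46, h46⟩ := op_lin hv h36 h45 (1) (1) 1 zA (by decide +kernel)
  obtain ⟨Z47, X47, f47, e47, h47⟩ := op_mul hv h6 hp ⟨⟨800000000, 800000000⟩, ⟨800000000, 816883947⟩, ⟨0, 0⟩, ⟨0, 0⟩, ⟨400000000, 400000000⟩, ⟨0, 0⟩, ⟨399302200, 404899208⟩, ⟨399302200, 404899208⟩⟩ (by decide +kernel)
  obtain ⟨Z48, X48, f48, e48, h48⟩ := op_mul hv h6 hS ⟨⟨1600000000, 1600000000⟩, ⟨1600000000, 1633767894⟩, ⟨0, 0⟩, ⟨0, 0⟩, ⟨0, 0⟩, ⟨0, 0⟩, ⟨1198604400, 1209798416⟩, ⟨1198604400, 1209798416⟩⟩ (by decide +kernel)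
  obtain ⟨Z49, X49, f49, e49, h49⟩ := op_mul hv h2 hS ⟨⟨1600000000, 1600000000⟩, ⟨1600000000, 1633728668⟩, ⟨0, 0⟩, ⟨0, 0⟩, ⟨1600000000, 1616786154⟩, ⟨0, 0⟩, ⟨400000000, 400000000⟩, ⟨400000000, 400000000⟩⟩ (by decide +kernel)
  obtain ⟨Z50, X50, f50, e50, h50⟩ := op_mul hv hS h7 ⟨⟨8719183544, 8719183604⟩, ⟨8645309674, 8854572341⟩, ⟨2635505792, 2646670600⟩, ⟨800000000, 800000000⟩, ⟨0, 0⟩, ⟨0, 0⟩, ⟨2161327418, 2198303325⟩, ⟨2161327418, 2198303325⟩⟩ (by decide +kernel)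
  obtain ⟨Z51, X51, f51, e51, h51⟩ := op_lin hv h50 h12 (1) (-1) 2 ⟨⟨4359591772, 4359591802⟩, ⟨4322654837, 4427544460⟩, ⟨1317752896, 1323335300⟩, ⟨400000000, 400000000⟩, ⟨0, 0⟩, ⟨0, 0⟩, ⟨1071409998, 1108405374⟩, ⟨1071409998, 1108405374⟩⟩ (by decide +kernel)
  obtain ⟨Z52, X52, f52, e52, h52⟩ := op_lin hv h8 h1 (1) (-1) 1 ⟨⟨400000000, 400000000⟩, ⟨394398123, 411223231⟩, ⟨0, 0⟩, ⟨0, 0⟩, ⟨0, 0⟩, ⟨-401395600, -400000000⟩, ⟨399302200, 402093400⟩, ⟨399302200, 402093400⟩⟩ (by decide +kernel)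
  obtain ⟨Z53, X53, f53, e53, h53⟩ := op_mul hv hp h52 ⟨⟨800000000, 800000000⟩, ⟨788796246, 828185494⟩, ⟨0, 0⟩, ⟨0, 0⟩, ⟨394398123, 411223231⟩, ⟨-802791200, -800000000⟩, ⟨798604400, 804186800⟩, ⟨798604400, 804186800⟩⟩ (by decide +kernel)
  obtain ⟨Z54, X54, f54, e54, h54⟩ := op_lin hv h48 h49 (1) (1) 1 ⟨⟨3200000000, 3200000000⟩, ⟨3200000000, 3267496561⟩, ⟨0, 0⟩, ⟨0, 0⟩, ⟨1600000000, 1616786154⟩, ⟨0, 0⟩, ⟨1598604400, 1609798416⟩, ⟨1598604400, 1609798416⟩⟩ (by decide +kernel)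
  obtain ⟨Z55, X55, f55, e55, h55⟩ := op_lin hv h54 h51 (1) (-1) 1 ⟨⟨-1159591802, -1159591772⟩, ⟨-1196606649, -1085063472⟩, ⟨-1323335300, -1317752896⟩, ⟨-400000000, -400000000⟩, ⟨1600000000, 1616786154⟩, ⟨0, 0⟩, ⟨490199026, 538388418⟩, ⟨490199026, 538388418⟩⟩ (by decide +kernel)
  obtain ⟨Z56, X56, f56, e56, h56⟩ := op_lin hv h55 h53 (1) (1) 2 ⟨⟨-179795901, -179795886⟩, ⟨-203905202, -128438989⟩, ⟨-661667650, -658876448⟩, ⟨-200000000, -200000000⟩, ⟨997199061, 1014004693⟩, ⟨-401395600, -400000000⟩, ⟨644401713, 671287609⟩, ⟨644401713, 671287609⟩⟩ (by decide +kernel)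
  obtain ⟨Z57, X57, f57, e57, h57⟩ := op_lin hv h47 h56 (1) (1) 1 zD (by decide +kernel)
  obtain ⟨Z58, X58, f58, e58, h58⟩ := op_mul hv hsg hS ⟨⟨2641088192, 2641088200⟩, ⟨2629845484, 2670760422⟩, ⟨400000000, 402791200⟩, ⟨0, 0⟩, ⟨0, 0⟩, ⟨0, 0⟩, ⟨660272048, 660272050⟩, ⟨660272048, 660272050⟩⟩ (by decide +kernel)
  obtain ⟨Z59, X59, f59, e59, h59⟩ := op_lin hv h58 hE (1) (1) 2 ⟨⟨1320544096, 1320544100⟩, ⟨1314922742, 1335419165⟩, ⟨200000000, 201395600⟩, ⟨0, 0⟩, ⟨0, 0⟩, ⟨0, 0⟩, ⟨328740424, 331531625⟩, ⟨328740424, 331531625⟩⟩ (by decide +kernel)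
  obtain ⟨Z60, X60, f60, e60, h60⟩ := op_mul hv hq h59 ⟨⟨2641088192, 2641088200⟩, ⟨2629845484, 2689475440⟩, ⟨400000000, 402791200⟩, ⟨0, 0⟩, ⟨0, 0⟩, ⟨1314922742, 1335419165⟩, ⟨657480848, 663063250⟩, ⟨657480848, 663063250⟩⟩ (by decide +kernel)
  obtain ⟨Z61, X61, f61, e61, h61⟩ := op_mul hv h1 hsg ⟨⟨2641088192, 2641088200⟩, ⟨2629923392, 2689396988⟩, ⟨400000000, 400000000⟩, ⟨0, 0⟩, ⟨0, 0⟩, ⟨2629923392, 2661506711⟩, ⟨0, 0⟩, ⟨0, 0⟩⟩ (by decide +kernel)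
  obtain ⟨Z62, X62, f62, e62, h62⟩ := op_lin hv h61 h11 (1) (1) 2 ⟨⟨1320544096, 1320544100⟩, ⟨1314804792, 1344855398⟩, ⟨200000000, 200000000⟩, ⟨0, 0⟩, ⟨0, 0⟩, ⟨1314961696, 1330753356⟩, ⟨-5621354, 5621354⟩, ⟨-5621354, 5621354⟩⟩ (by decide +kernel)
  obtain ⟨Z63, X63, f63, e63, h63⟩ := op_lin hv h7 h8 (1) (1) 1 ⟨⟨2979795886, 2979795901⟩, ⟨2961327418, 3009526556⟩, ⟨658876448, 661667650⟩, ⟨200000000, 200000000⟩, ⟨0, 0⟩, ⟨0, 0⟩, ⟨399302200, 402093400⟩, ⟨399302200, 402093400⟩⟩ (by decide +kernel)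
  obtain ⟨Z64, X64, f64, e64, h64⟩ := op_lin hv h63 h2 (1) (-2) 2 ⟨⟨1089897943, 1089897951⟩, ⟨1075061832, 1104763279⟩, ⟨329438224, 330833825⟩, ⟨100000000, 100000000⟩, ⟨-401395600, -400000000⟩, ⟨0, 0⟩, ⟨199651100, 201046700⟩, ⟨199651100, 201046700⟩⟩ (by decide +kernel)
  obtain ⟨Z65, X65, f65, e65, h65⟩ := op_mul hv hq h64 ⟨⟨2179795886, 2179795902⟩, ⟨2150123664, 2224944633⟩, ⟨658876448, 661667650⟩, ⟨200000000, 200000000⟩, ⟨-802791200, -800000000⟩, ⟨1075061832, 1104763279⟩, ⟨399302200, 402093400⟩, ⟨399302200, 402093400⟩⟩ (by decide +kernel)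
  obtain ⟨Z66, X66, f66, e66, h66⟩ := op_mul hv h1 hS ⟨⟨1600000000, 1600000000⟩, ⟨1600000000, 1633728668⟩, ⟨0, 0⟩, ⟨0, 0⟩, ⟨0, 0⟩, ⟨1600000000, 1616786154⟩, ⟨400000000, 400000000⟩, ⟨400000000, 400000000⟩⟩ (by decide +kernel)
  obtain ⟨Z67, X67, f67, e67, h67⟩ := op_lin hv h66 h12 (1) (1) 2 ⟨⟨800000000, 800000000⟩, ⟨800000000, 817122624⟩, ⟨0, 0⟩, ⟨0, 0⟩, ⟨0, 0⟩, ⟨800000000, 808393077⟩, ⟨190746289, 209253711⟩, ⟨190746289, 209253711⟩⟩ (by decide +kernel)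
  obtain ⟨Z68, X68, f68, e68, h68⟩ := op_lin hv h60 h62 (1) (1) 1 ⟨⟨3961632288, 3961632300⟩, ⟨3944807180, 4034330837⟩, ⟨600000000, 602791200⟩, ⟨0, 0⟩, ⟨0, 0⟩, ⟨2629884438, 2666172521⟩, ⟨651859494, 668684604⟩, ⟨651859494, 668684604⟩⟩ (by decide +kernel)
  obtain ⟨Z69, X69, f69, e69, h69⟩ := op_lin hv h65 h67 (1) (1) 1 ⟨⟨2979795886, 2979795902⟩, ⟨2950123664, 3042067257⟩, ⟨658876448, 661667650⟩, ⟨200000000, 200000000⟩, ⟨-802791200, -800000000⟩, ⟨1875061832, 1913156356⟩, ⟨590048489, 611347111⟩, ⟨590048489, 611347111⟩⟩ (by decide +kernel)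
  obtain ⟨Z70, X70, f70, e70, h70⟩ := op_lin hv h68 h69 (1) (1) 1 zS (by decide +kernel)
  obtain ⟨Z71, X71, f71, e71, h71⟩ := op_lin hv hq hsg (1) (1) 1 ⟨⟨860272048, 860272050⟩, ⟨857480848, 864458850⟩, ⟨100000000, 100000000⟩, ⟨0, 0⟩, ⟨0, 0⟩, ⟨100000000, 100000000⟩, ⟨0, 0⟩, ⟨0, 0⟩⟩ (by decide +kernel)
  obtain ⟨Z72, X72, f72, e72, h72⟩ := op_lin hv hq hS (1) (1) 2 ⟨⟨300000000, 300000000⟩, ⟨300000000, 302093400⟩, ⟨0, 0⟩, ⟨0, 0⟩, ⟨0, 0⟩, ⟨50000000, 50000000⟩, ⟨50000000, 50000000⟩, ⟨50000000, 50000000⟩⟩ (by decide +kernel)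
  obtain ⟨Z73, X73, f73, e73, h73⟩ := op_mul hv h71 h72 ⟨⟨2580816144, 2580816150⟩, ⟨2572384113, 2611473132⟩, ⟨300000000, 302093400⟩, ⟨0, 0⟩, ⟨0, 0⟩, ⟨730136024, 732229425⟩, ⟨430136024, 430136025⟩, ⟨430136024, 430136025⟩⟩ (by decide +kernel)
  obtain ⟨Z74, X74, f74, e74, h74⟩ := op_lin hv hDz hDs (1) (1) 1 ⟨⟨0, 0⟩, ⟨-38954, 116866⟩, ⟨0, 0⟩, ⟨400000000, 400000000⟩, ⟨0, 0⟩, ⟨0, 0⟩, ⟨-1395600, 1395600⟩, ⟨-1395600, 1395600⟩⟩ (by decide +kernel)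
  obtain ⟨Z75, X75, f75, e75, h75⟩ := op_lin hv h74 hE (1) (2) 1 ⟨⟨0, 0⟩, ⟨-194770, 272682⟩, ⟨0, 0⟩, ⟨400000000, 400000000⟩, ⟨0, 0⟩, ⟨0, 0⟩, ⟨-6978000, 6978000⟩, ⟨-6978000, 6978000⟩⟩ (by decide +kernel)
  obtain ⟨Z76, X76, f76, e76, h76⟩ := op_sq hv h73 ⟨⟨66606119691, 66606120002⟩, ⟨66168304250, 68197919171⟩, ⟨15459600771, 15685563230⟩, ⟨0, 0⟩, ⟨0, 0⟩, ⟨37625371465, 38019469954⟩, ⟨22165770694, 22333906725⟩, ⟨22165770694, 22333906725⟩⟩ (by decide +kernel)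
  obtain ⟨Z77, X77, f77, e77, h77⟩ := op_mul hv h75 h76 ⟨⟨0, 0⟩, ⟨-132829044, 185963407⟩, ⟨0, 0⟩, ⟨264673217000, 272791676684⟩, ⟨0, 0⟩, ⟨0, 0⟩, ⟨-4758850800, 4758850800⟩, ⟨-4758850800, 4758850800⟩⟩ (by decide +kernel)
  obtain ⟨Z78, X78, f78, e78, h78⟩ := op_sq hv h70 ⟨⟨481834250948, 481834254836⟩, ⟨475316336079, 500754099631⟩, ⟨174182664938, 177249645165⟩, ⟨27672718036, 28035652590⟩, ⟨-112533875928, -110690872144⟩, ⟨623320539485, 641922367455⟩, ⟨171834847201, 179432622330⟩, ⟨171834847201, 179432622330⟩⟩ (by decide +kernel)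
  obtain ⟨Z79, X79, f79, e79, h79⟩ := op_lin hv h78 h77 (1) (-1) 4 ⟨⟨120458562737, 120458563709⟩, ⟨118817147952, 125220366973⟩, ⟨43545666234, 44312411292⟩, ⟨-61279739662, -59159391102⟩, ⟨-28133468982, -27672718036⟩, ⟨155830134871, 160480591864⟩, ⟨41768999100, 46047868283⟩, ⟨41768999100, 46047868283⟩⟩ (by decide +kernel)
  obtain ⟨Z80, X80, f80, e80, h80⟩ := op_lin hv h79 h35 (1) (-1) 1 zM (by decide +kernel)
  obtain ⟨Z81, X81, f81, e81, h81⟩ := op_mul hv hsg hS ⟨⟨2641088192, 2641088200⟩, ⟨2629845484, 2670760422⟩, ⟨400000000, 402791200⟩, ⟨0, 0⟩, ⟨0, 0⟩, ⟨0, 0⟩, ⟨660272048, 660272050⟩, ⟨660272048, 660272050⟩⟩ (by decide +kernel)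
  obtain ⟨Z82, X82, f82, e82, h82⟩ := op_lin hv h81 hE (1) (-1) 2 ⟨⟨1320544096, 1320544100⟩, ⟨1314922742, 1335419165⟩, ⟨200000000, 201395600⟩, ⟨0, 0⟩, ⟨0, 0⟩, ⟨0, 0⟩, ⟨328740424, 331531625⟩, ⟨328740424, 331531625⟩⟩ (by decide +kernel)
  obtain ⟨Z83, X83, f83, e83, h83⟩ := op_lin hv h15 h16 (1) (1) 1 ⟨⟨0, 0⟩, ⟨-1712624, 2976674⟩, ⟨0, 0⟩, ⟨6400000000, 6489630032⟩, ⟨0, 0⟩, ⟨0, 0⟩, ⟨-61357956, 61357956⟩, ⟨-61357956, 61357956⟩⟩ (by decide +kernel)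
  obtain ⟨Z84, X84, f84, e84, h84⟩ := op_lin hv h83 h13 (1) (-2) 4 ⟨⟨0, 0⟩, ⟨-1468524, 1784537⟩, ⟨0, 0⟩, ⟨1600000000, 1622407508⟩, ⟨0, 0⟩, ⟨0, 0⟩, ⟨-52612622, 52612622⟩, ⟨-52612622, 52612622⟩⟩ (by decide +kernel)
  obtain ⟨Z85, X85, f85, e85, h85⟩ := op_mul hv h2 h1 ⟨⟨1600000000, 1600000000⟩, ⟨1600000000, 1645128827⟩, ⟨0, 0⟩, ⟨0, 0⟩, ⟨1600000000, 1628068088⟩, ⟨1600000000, 1605582400⟩, ⟨0, 0⟩, ⟨0, 0⟩⟩ (by decide +kernel)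
  obtain ⟨Z86, X86, f86, e86, h86⟩ := op_sq hv h82 ⟨⟨17438367094, 17438367201⟩, ⟨17289065997, 17833443456⟩, ⟨5270933676, 5348993154⟩, ⟨0, 0⟩, ⟨0, 0⟩, ⟨0, 0⟩, ⟨8663844857, 8805358172⟩, ⟨8663844857, 8805358172⟩⟩ (by decide +kernel)
  obtain ⟨Z87, X87, f87, e87, h87⟩ := op_lin hv h86 h85 (1) (-1) 1 ⟨⟨15838367094, 15838367201⟩, ⟨15643937170, 16233443456⟩, ⟨5270933676, 5348993154⟩, ⟨0, 0⟩, ⟨-1628068088, -1600000000⟩, ⟨-1605582400, -1600000000⟩, ⟨8663844857, 8805358172⟩, ⟨8663844857, 8805358172⟩⟩ (by decide +kernel)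
  obtain ⟨Z88, X88, f88, e88, h88⟩ := op_lin hv h85 h84 (1) (-1) 1 ⟨⟨1600000000, 1600000000⟩, ⟨1598215463, 1646597350⟩, ⟨0, 0⟩, ⟨-1622407508, -1600000000⟩, ⟨1600000000, 1628068088⟩, ⟨1600000000, 1605582400⟩, ⟨-52612622, 52612622⟩, ⟨-52612622, 52612622⟩⟩ (by decide +kernel)
  obtain ⟨Z89, X89, f89, e89, h89⟩ := op_mul hv h87 h88 ⟨⟨253413873504, 253413875216⟩, ⟨250905434373, 266585699463⟩, ⟨84240877054, 88076379526⟩, ⟨-256962858614, -253413873504⟩, ⟨226606147510, 232287954652⟩, ⟨226976396253, 228726588819⟩, ⟨130133927928, 153321774585⟩, ⟨130133927928, 153321774585⟩⟩ (by decide +kernel)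
  obtain ⟨Z90, X90, f90, e90, h90⟩ := op_lin hv h35 h89 (64) (-1) 1 zC (by decide +kernel)
  have b35 : Z35 = gr ℓ ℓ 2 2 2 2 := by
    simp only [f35, f34, f33, f32, f31, f30, f29, f28, f27, f26, f25, f24, f23, f22, f21, f20, f19, f18, f17, f14, f13, f12, f11, f10, f9, f8, f7, f4, f3, f2, f1]; simp only [gr, dd]; push_cast; ring
  have c35 : X35 = gr a b p t s q := by
    simp only [e35, e34, e33, e32, e31, e30, e29, e28, e27, e26, e25, e24, e23, e22, e21, e20, e19, e18, e17, e14, e13, e12, e11, e10, e9, e8, e7, e4, e3, e2, e1]; simp only [gr, dd]; push_cast; ring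
  have b46 : Z46 = dd ℓ ℓ 2 2 2 2 := by
    simp only [f46, f45, f44, f43, f42, f41, f40, f39, f38, f37, f36, f11, f8, f7, f5, f4, f3, f2, f1]; simp only [gr, dd]; push_cast; ring
  have c46 : X46 = dd a b p t s q := by
    simp only [e46, e45, e44, e43, e42, e41, e40, e39, e38, e37, e36, e11, e8, e7, e5, e4, e3, e2, e1]; simp only [gr, dd]; push_cast; ring
  have b57 : Z57 = dd 2 2 2 2 ℓ ℓ := by
    simp only [f57, f56, f55, f54, f53, f52, f51, f50, f49, f48, f47, f12, f8, f7, f6, f4, f3, f2, f1]; simp only [gr, dd]; push_cast; ring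
  have c57 : X57 = dd p s t q b a := by
    simp only [e57, e56, e55, e54, e53, e52, e51, e50, e49, e48, e47, e12, e8, e7, e6, e4, e3, e2, e1]; simp only [gr, dd]; push_cast; ring
  have b70 : Z70 = dd ℓ 2 2 2 2 ℓ + dd ℓ 2 2 2 2 ℓ := by
    simp only [f70, f69, f68, f67, f66, f65, f64, f63, f62, f61, f60, f59, f58, f12, f11, f8, f7, f4, f3, f2, f1]; simp only [gr, dd]; push_cast; ring
  have c70 : X70 = dd a q s t p b + dd b q t s p a := by
    simp only [e70, e69, e68, e67, e66, e65, e64, e63, e62, e61, e60, e59, e58, e12, e11, e8, e7, e4, e3, e2, e1]; simp only [gr, dd]; push_cast; ring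
  have b80 : Z80 = dd ℓ 2 2 2 2 ℓ * dd ℓ 2 2 2 2 ℓ - gr ℓ ℓ 2 2 2 2 := by
    simp only [f80, f79, f78, f77, f76, f75, f74, f73, f72, f71, f70, f69, f68, f67, f66, f65, f64, f63, f62, f61, f60, f59, f58, f35, f34, f33, f32, f31, f30, f29, f28, f27, f26, f25, f24, f23, f22, f21, f20, f19, f18, f17, f14, f13, f12, f11, f10, f9, f8, f7, f4, f3, f2, f1]; simp only [gr, dd]; push_cast; ring
  have c80 : X80 = dd a q s t p b * dd b q t s p a - gr a b p t s q := by
    simp only [e80, e79, e78, e77, e76, e75, e74, e73, e72, e71, e70, e69, e68, e67, e66, e65, e64, e63, e62, e61, e60, e59, e58, e35, e34, e33, e32, e31, e30, e29, e28, e27, e26, e25, e24, e23, e22, e21, e20, e19, e18, e17, e14, e13, e12, e11, e10, e9, e8, e7, e4, e3, e2, e1]; simp only [gr, dd]; push_cast; ring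
  have b90 : Z90 = 64 * gr ℓ ℓ 2 2 2 2 - ((ℓ * 2 + ℓ * 2) ^ 2 - (2 * 2) ^ 2) * ((2 * 2) ^ 2 - (ℓ * 2 - ℓ * 2) ^ 2) := by
    simp only [f90, f89, f88, f87, f86, f85, f84, f83, f82, f81, f35, f34, f33, f32, f31, f30, f29, f28, f27, f26, f25, f24, f23, f22, f21, f20, f19, f18, f17, f16, f15, f14, f13, f12, f11, f10, f9, f8, f7, f4, f3, f2, f1]; simp only [gr, dd]; push_cast; ring
  have c90 : X90 = 64 * gr a b p t s q - ((a * t + b * s) ^ 2 - (p * q) ^ 2) * ((p * q) ^ 2 - (a * t - b * s) ^ 2) := by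
    simp only [e90, e89, e88, e87, e86, e85, e84, e83, e82, e81, e35, e34, e33, e32, e31, e30, e29, e28, e27, e26, e25, e24, e23, e22, e21, e20, e19, e18, e17, e16, e15, e14, e13, e12, e11, e10, e9, e8, e7, e4, e3, e2, e1]; simp only [gr, dd]; push_cast; ring
  refine ⟨?_, ?_, ?_, ?_, ?_, ?_⟩
  · rw [← b35, ← c35]; exact h35
  · rw [← b46, ← c46]; exact h46
  · rw [← b57, ← c57]; exact h57
  · rw [← b70, ← c70]; exact h70
  · rw [← b80, ← c80]; exact h80
  · rw [← b90, ← c90]; exact h90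

end RR


open MeasureTheory Metric
namespace RR

def zNN : SF := ⟨⟨629252872, 629252877⟩, ⟨624697181, 654915035⟩, ⟨-155410939, -143560409⟩, ⟨-1118493781, -1049160905⟩, ⟨546482724, 585374541⟩, ⟨177140770, 199126139⟩, ⟨319092200, 371733870⟩, ⟨319092200, 371733870⟩⟩
def zY : SF := ⟨⟨43679136, 43679137⟩, ⟨43578107, 45830705⟩, ⟨-3075981, -1941747⟩, ⟨-77890567, -71080413⟩, ⟨32628019, 36389410⟩, ⟨40561237, 42906518⟩, ⟨29815928, 34360005⟩, ⟨29815928, 34360005⟩⟩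
def zX : SF := ⟨⟨116498970, 116498972⟩, ⟨114703342, 121169116⟩, ⟨45388372, 46261187⟩, ⟨-47812965, -45134038⟩, ⟨-35473773, -34687237⟩, ⟨153333192, 158206856⟩, ⟨37107642, 41952079⟩, ⟨37107642, 41952079⟩⟩
def zF : SF := ⟨⟨-1, 1⟩, ⟨-7127897, 1651874⟩, ⟨44964574, 54787562⟩, ⟨68782972, 106653007⟩, ⟨-151183253, -125857032⟩, ⟨-7762220, 7299226⟩, ⟨-121109992, -91641962⟩, ⟨-121109992, -91641962⟩⟩

lemma mem_sqrt {x : ℝ} {i j : Iv} (hx : 0 < x) (h : mem (x ^ 2) i)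
    (hj : (decide (0 ≤ j.lo) && decide (0 ≤ j.hi) && decide (j.lo * j.lo ≤ 100000000 * i.lo) &&
      decide (100000000 * i.hi ≤ j.hi * j.hi)) = true) : mem x j := by
  simp only [Bool.and_eq_true, decide_eq_true_eq] at hj
  obtain ⟨⟨⟨h1, h2⟩, h3⟩, h4⟩ := hj
  have k1 : (0 : ℝ) ≤ j.lo := by exact_mod_cast h1
  have k2 : (0 : ℝ) ≤ j.hi := by exact_mod_cast h2
  have k3 : (j.lo : ℝ) * j.lo ≤ 100000000 * i.lo := by exact_mod_cast h3
  have k4 : (100000000 : ℝ) * i.hi ≤ j.hi * j.hi := by exact_mod_cast h4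
  obtain ⟨a, b⟩ := h
  constructor
  · apply le_of_sq_le_sq _ (by positivity)
    nlinarith
  · apply le_of_sq_le_sq _ k2
    nlinarith

lemma op_N {v : Fin 6 → ℝ} (hv : VV v) (G0 G N N0 : ℝ) (h : M v G0 G zN) (hN : 0 < N) (hN0 : 0 < N0)
    (e : N ^ 2 = G) (e0 : N0 ^ 2 = G0) : M v N0 N zNN := by
  have m0 : mem N0 ⟨629252872, 629252877⟩ := mem_sqrt hN0 (by rw [e0]; exact h.1) (by decide +kernel)
  have m1 : mem N ⟨624697182, 654322737⟩ := mem_sqrt hN (by rw [e]; exact h.2.1) (by decide +kernel)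
  have hs := mem_add m0 m1
  have hg : mem (1 / (N0 + N)) ⟨7790736, 7974800⟩ := mem_inv hs (by decide +kernel)
  refine op_sc hv h _ zNN (by decide +kernel) _ N0 N hg m0 ?_
  rw [← e, ← e0]
  field_simp
  ring

def wA : SF := ⟨⟨0, 0⟩, ⟨-152614, 409987⟩, ⟨-5366181, -5015465⟩, ⟨-14540916, -13183779⟩, ⟨3485902, 4158646⟩, ⟨2716214, 3099040⟩, ⟨4823824, 5693499⟩, ⟨4823824, 5693499⟩⟩

lemma angA {v : Fin 6 → ℝ} (hv : VV v) {y0 y x0 x : ℝ} (hy : M v y0 y zNN) (hx : M v x0 x zA)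
    (py0 : 0 < y0) (py : 0 < y) (px0 : 0 < x0) (px : 0 < x) :
    M v 0 (Real.arctan (y / x) - Real.arctan (y0 / x0)) wA := by
  have cx : M v x0 x0 (cst zA.b) := op_cst hx.1
  have cy : M v y0 y0 (cst zNN.b) := op_cst hy.1
  obtain ⟨Z1, X1, f1, e1, h1⟩ := op_mul hv hy cx ⟨⟨47557280289, 47557281152⟩, ⟨47212973167, 49496759666⟩, ⟨-11745550939, -10849918869⟩, ⟨-84532824806, -79292827173⟩, ⟨41301729773, 44241071664⟩, ⟨13387834405, 15049431037⟩, ⟨24116150865, 28094670387⟩, ⟨24116150865, 28094670387⟩⟩ (by decide +kernel)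
  obtain ⟨Z2, X2, f2, e2, h2⟩ := op_mul hv hx cy ⟨⟨47557280289, 47557281152⟩, ⟨46882960514, 48370414299⟩, ⟨18518236664, 18687049477⟩, ⟨-2094954142, -2068608559⟩, ⟨20656625038, 20889955694⟩, ⟨-2525793362, -2517011488⟩, ⟨-4194211184, -4129846541⟩, ⟨-4194211184, -4129846541⟩⟩ (by decide +kernel)
  obtain ⟨Z3, X3, f3, e3, h3⟩ := op_lin hv h1 h2 1 (-1) 1 ⟨⟨-863, 863⟩, ⟨-865497986, 2325107238⟩, ⟨-30432600416, -29368155533⟩, ⟨-82464216247, -77197873031⟩, ⟨20411774079, 23584446626⟩, ⟨15904845893, 17575224399⟩, ⟨28245997406, 32288881571⟩, ⟨28245997406, 32288881571⟩⟩ (by decide +kernel)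
  obtain ⟨Z4, X4, f4, e4, h4⟩ := op_mul hv hx cx ⟨⟨571193961491, 571193973131⟩, ⟨563094941066, 580960232713⟩, ⟨222416103190, 224443655693⟩, ⟨-25161765995, -24845338308⟩, ⟨248099542591, 250901996537⟩, ⟨-30336426102, -30230950008⟩, ⟨-50375212631, -49602151175⟩, ⟨-50375212631, -49602151175⟩⟩ (by decide +kernel)
  obtain ⟨Z5, X5, f5, e5, h5⟩ := op_mul hv hy cy ⟨⟨3959591769, 3959591833⟩, ⟨3930924956, 4121071697⟩, ⟨-977927805, -903357996⟩, ⟨-7038154297, -6601875126⟩, ⟨3438758235, 3683486141⟩, ⟨1114663382, 1253006959⟩, ⟨2007896832, 2339146072⟩, ⟨2007896832, 2339146072⟩⟩ (by decide +kernel)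
  obtain ⟨Z6, X6, f6, e6, h6⟩ := op_lin hv h4 h5 1 1 1 ⟨⟨575153553260, 575153564964⟩, ⟨567149977131, 584946016750⟩, ⟨221438175385, 223540297697⟩, ⟨-32199920292, -31447213434⟩, ⟨251538300826, 254585482678⟩, ⟨-29221762720, -28977943049⟩, ⟨-48367315799, -47263005103⟩, ⟨-48367315799, -47263005103⟩⟩ (by decide +kernel)
  have g3 : Z3 = 0 := by rw [f3, f1, f2]; push_cast; ring
  rw [g3] at h3
  refine op_ang hv h3 h6 (by rw [e3, e1, e2]; push_cast; ring) (by rw [e6, e4, e5]; push_cast; ring)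
    py0 py px0 px ⟨17095, 17633⟩ ⟨⟨0, 0⟩, ⟨-152614, 409987⟩, ⟨-5366181, -5020486⟩, ⟨-14540916, -13196976⟩, ⟨3489392, 4158646⟩, ⟨2718933, 3099040⟩, ⟨4828653, 5693499⟩, ⟨4828653, 5693499⟩⟩ _ (by decide +kernel)
    (by decide +kernel) (by decide +kernel) (by decide +kernel)

def wD : SF := ⟨⟨0, 0⟩, ⟨-3965757, 1881955⟩, ⟨37965107, 42823344⟩, ⟨-74291241, -62617519⟩, ⟨-72066055, -61579131⟩, ⟨43137211, 49202460⟩, ⟨-62705881, -50849009⟩, ⟨-62705881, -50849009⟩⟩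

lemma angD {v : Fin 6 → ℝ} (hv : VV v) {y0 y x0 x : ℝ} (hy : M v y0 y zNN) (hx : M v x0 x zD)
    (py0 : 0 < y0) (py : 0 < y) (px0 : 0 < x0) (px : 0 < x) :
    M v 0 (Real.arctan (y / x) - Real.arctan (y0 / x0)) wD := by
  have cx : M v x0 x0 (cst zD.b) := op_cst hx.1
  have cy : M v y0 y0 (cst zNN.b) := op_cst hy.1
  obtain ⟨Z1, X1, f1, e1, h1⟩ := op_mul hv hy cx ⟨⟨3902652105, 3902652231⟩, ⟨3874397526, 4061809987⟩, ⟨-963865038, -890367541⟩, ⟨-6936944445, -6506938937⟩, ⟨3389308254, 3630516986⟩, ⟨1098634316, 1234988507⟩, ⟨1979022903, 2305508755⟩, ⟨1979022903, 2305508755⟩⟩ (by decide +kernel)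
  obtain ⟨Z2, X2, f2, e2, h2⟩ := op_mul hv hx cy ⟨⟨3902652105, 3902652231⟩, ⟨3750943638, 4332059702⟩, ⟨-4163562724, -4145998971⟩, ⟨-1258505754, -1258505744⟩, ⟨8791915218, 8897665212⟩, ⟨-2525793362, -2517011488⟩, ⟨6567536847, 6771936508⟩, ⟨6567536847, 6771936508⟩⟩ (by decide +kernel)
  obtain ⟨Z3, X3, f3, e3, h3⟩ := op_lin hv h1 h2 1 (-1) 1 ⟨⟨-126, 126⟩, ⟨-303122031, 143847022⟩, ⟨3182133933, 3273195183⟩, ⟨-5678438701, -5248433183⟩, ⟨-5508356958, -5161398232⟩, ⟨3615645804, 3760781869⟩, ⟨-4792913605, -4262028092⟩, ⟨-4792913605, -4262028092⟩⟩ (by decide +kernel)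
  obtain ⟨Z4, X4, f4, e4, h4⟩ := op_mul hv hx cx ⟨⟨3846531244, 3846531431⟩, ⟨3697004370, 4269763950⟩, ⟨-4103689987, -4086378737⟩, ⟨-1240408228, -1240408198⟩, ⟨8665485847, 8769715279⟩, ⟨-2489472025, -2480816396⟩, ⟨6473094449, 6674554914⟩, ⟨6473094449, 6674554914⟩⟩ (by decide +kernel)
  obtain ⟨Z5, X5, f5, e5, h5⟩ := op_mul hv hy cy ⟨⟨3959591769, 3959591833⟩, ⟨3930924956, 4121071697⟩, ⟨-977927805, -903357996⟩, ⟨-7038154297, -6601875126⟩, ⟨3438758235, 3683486141⟩, ⟨1114663382, 1253006959⟩, ⟨2007896832, 2339146072⟩, ⟨2007896832, 2339146072⟩⟩ (by decide +kernel)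
  obtain ⟨Z6, X6, f6, e6, h6⟩ := op_lin hv h4 h5 1 1 1 ⟨⟨7806123013, 7806123264⟩, ⟨7643485569, 8373348681⟩, ⟨-5081617792, -4989736733⟩, ⟨-8278562525, -7842283324⟩, ⟨12104244082, 12453201420⟩, ⟨-1374808643, -1227809437⟩, ⟨8480991281, 9013700986⟩, ⟨8480991281, 9013700986⟩⟩ (by decide +kernel)
  have g3 : Z3 = 0 := by rw [f3, f1, f2]; push_cast; ring
  rw [g3] at h3
  refine op_ang hv h3 h6 (by rw [e3, e1, e2]; push_cast; ring) (by rw [e6, e4, e5]; push_cast; ring)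
    py0 py px0 px ⟨1194265, 1308304⟩ ⟨⟨0, 0⟩, ⟨-3965757, 1881955⟩, ⟨38003111, 42823344⟩, ⟨-74291241, -62680200⟩, ⟨-72066055, -61640772⟩, ⟨43180392, 49202460⟩, ⟨-62705881, -50899909⟩, ⟨-62705881, -50899909⟩⟩ _ (by decide +kernel)
    (by decide +kernel) (by decide +kernel) (by decide +kernel)

def wB : SF := ⟨⟨0, 0⟩, ⟨-642677, 1397303⟩, ⟨-15556851, -13713978⟩, ⟨-46446667, -38448217⟩, ⟨33008372, 37854342⟩, ⟨-14288232, -10548395⟩, ⟨10189505, 15576980⟩, ⟨10189505, 15576980⟩⟩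

lemma angB {v : Fin 6 → ℝ} (hv : VV v) {y0 y x0 x : ℝ} (hy : M v y0 y zY) (hx : M v x0 x zX)
    (py0 : 0 < y0) (py : 0 < y) (px0 : 0 < x0) (px : 0 < x) :
    M v 0 (Real.arctan (y / x) - Real.arctan (y0 / x0)) wB := by
  have cx : M v x0 x0 (cst zX.b) := op_cst hx.1
  have cy : M v y0 y0 (cst zY.b) := op_cst hy.1
  obtain ⟨Z1, X1, f1, e1, h1⟩ := op_mul hv hy cx ⟨⟨50885743, 50885746⟩, ⟨50768046, 53392300⟩, ⟨-3583487, -2262115⟩, ⟨-90741710, -82807949⟩, ⟨38011306, 42393289⟩, ⟨47253423, 49985653⟩, ⟨34735249, 40029053⟩, ⟨34735249, 40029053⟩⟩ (by decide +kernel)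
  obtain ⟨Z2, X2, f2, e2, h2⟩ := op_mul hv hx cy ⟨⟨50885743, 50885746⟩, ⟨50101428, 52925625⟩, ⟨19825248, 20206488⟩, ⟨-20884291, -19714157⟩, ⟨-15494638, -15151085⟩, ⟨66974613, 69103390⟩, ⟨16208297, 18324307⟩, ⟨16208297, 18324307⟩⟩ (by decide +kernel)
  obtain ⟨Z3, X3, f3, e3, h3⟩ := op_lin hv h1 h2 1 (-1) 1 ⟨⟨-3, 3⟩, ⟨-982802, 2136798⟩, ⟨-23789975, -22087363⟩, ⟨-71027553, -61923658⟩, ⟨53162391, 57887927⟩, ⟨-21849967, -16988960⟩, ⟨16410942, 23820756⟩, ⟨16410942, 23820756⟩⟩ (by decide +kernel)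
  obtain ⟨Z4, X4, f4, e4, h4⟩ := op_mul hv hx cx ⟨⟨135720100, 135720105⟩, ⟨133628212, 141160775⟩, ⟨52876985, 53893808⟩, ⟨-55701613, -52580689⟩, ⟨-41326581, -40410273⟩, ⟨178631589, 184309361⟩, ⟨43230020, 48873741⟩, ⟨43230020, 48873741⟩⟩ (by decide +kernel)
  obtain ⟨Z5, X5, f5, e5, h5⟩ := op_mul hv hy cy ⟨⟨19078669, 19078671⟩, ⟨19034540, 20018458⟩, ⟨-1343562, -848138⟩, ⟨-34021928, -31047310⟩, ⟨14251636, 15894581⟩, ⟨17716797, 18741197⟩, ⟨13023339, 15008154⟩, ⟨13023339, 15008154⟩⟩ (by decide +kernel)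
  obtain ⟨Z6, X6, f6, e6, h6⟩ := op_lin hv h4 h5 1 1 1 ⟨⟨154798769, 154798776⟩, ⟨152922823, 160896232⟩, ⟨51533423, 53045670⟩, ⟨-89723541, -83627999⟩, ⟨-27074945, -24515692⟩, ⟨196348386, 203050558⟩, ⟨56253359, 63881895⟩, ⟨56253359, 63881895⟩⟩ (by decide +kernel)
  have g3 : Z3 = 0 := by rw [f3, f1, f2]; push_cast; ring
  rw [g3] at h3
  refine op_ang hv h3 h6 (by rw [e3, e1, e2]; push_cast; ring) (by rw [e6, e4, e5]; push_cast; ring)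
    py0 py px0 px ⟨62151859, 65392463⟩ ⟨⟨0, 0⟩, ⟨-642677, 1397303⟩, ⟨-15556851, -13727706⟩, ⟨-46446667, -38486704⟩, ⟨33041414, 37854342⟩, ⟨-14288232, -10558954⟩, ⟨10199705, 15576980⟩, ⟨10199705, 15576980⟩⟩ _ (by decide +kernel)
    (by decide +kernel) (by decide +kernel) (by decide +kernel)

lemma op_Y {v : Fin 6 → ℝ} (hv : VV v) {N0 N s0 s : ℝ} (hN : M v N0 N zNN) (hs : M v s0 s zS) :
    M v (N0 * s0 / 1000) (N * s / 1000) zY := by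
  obtain ⟨Z1, X1, f1, e1, h1⟩ := op_mul hv hN hs ⟨⟨43679136142, 43679136666⟩, ⟨43578107849, 45830703847⟩, ⟨-3075980520, -1941747227⟩, ⟨-77890566846, -71080413088⟩, ⟨32628019171, 36389409881⟩, ⟨40561237374, 42906517009⟩, ⟨29815928169, 34360004881⟩, ⟨29815928169, 34360004881⟩⟩ (by decide +kernel)
  obtain ⟨Z2, X2, f2, e2, h2⟩ := op_lin hv h1 h1 1 0 1000 zY (by decide +kernel)
  have g1 : Z2 = N0 * s0 / 1000 := by rw [f2, f1]; push_cast; ring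
  have g2 : X2 = N * s / 1000 := by rw [e2, e1]; push_cast; ring
  rwa [g1, g2] at h2

lemma op_X {v : Fin 6 → ℝ} (hv : VV v) {m0 m : ℝ} (hm : M v m0 m zM) :
    M v (m0 / 1000) (m / 1000) zX := by
  obtain ⟨Z2, X2, f2, e2, h2⟩ := op_lin hv hm hm 1 0 1000 zX (by decide +kernel)
  have g1 : Z2 = m0 / 1000 := by rw [f2]; push_cast; ring
  have g2 : X2 = m / 1000 := by rw [e2]; push_cast; ring
  rwa [g1, g2] at h2

lemma op_F {v : Fin 6 → ℝ} (hv : VV v) {A B D c N0 N : ℝ} (hA : M v 0 A wA) (hD : M v 0 D wD) (hB : M v 0 B wB)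
    (hN : M v N0 N zNN) (hc : mem c ⟨19450000, 19750000⟩) : M v 0 (A + D + B - c * (N - N0)) zF := by
  have cN : M v N0 N0 (cst zNN.b) := op_cst hN.1
  have cc : M v c c (cst ⟨19450000, 19750000⟩) := op_cst hc
  obtain ⟨Z1, X1, f1, e1, h1⟩ := op_lin hv hN cN 1 (-1) 1 ⟨⟨-5, 5⟩, ⟨-4555696, 25662163⟩, ⟨-155410939, -143560409⟩, ⟨-1118493781, -1049160905⟩, ⟨546482724, 585374541⟩, ⟨177140770, 199126139⟩, ⟨319092200, 371733870⟩, ⟨319092200, 371733870⟩⟩ (by decide +kernel)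
  obtain ⟨Z2, X2, f2, e2, h2⟩ := op_mul hv h1 cc ⟨⟨-1, 1⟩, ⟨-899750, 5068278⟩, ⟨-30693661, -27922499⟩, ⟨-220902522, -204061796⟩, ⟨106290889, 115611472⟩, ⟨34453879, 39327413⟩, ⟨62063432, 73417440⟩, ⟨62063432, 73417440⟩⟩ (by decide +kernel)
  obtain ⟨Z3, X3, f3, e3, h3⟩ := op_lin hv hA hD 1 1 1 ⟨⟨0, 0⟩, ⟨-3645305, 1785214⟩, ⟨32598926, 37807879⟩, ⟨-88832157, -75801298⟩, ⟨-68580153, -57420485⟩, ⟨45853425, 52301500⟩, ⟨-57882057, -45155510⟩, ⟨-57882057, -45155510⟩⟩ (by decide +kernel)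
  obtain ⟨Z4, X4, f4, e4, h4⟩ := op_lin hv h3 hB 1 1 1 ⟨⟨0, 0⟩, ⟨-2526493, 1255216⟩, ⟨17042075, 24093901⟩, ⟨-135278824, -114249515⟩, ⟨-35571781, -19566143⟩, ⟨31565193, 41753105⟩, ⟨-47692552, -29578530⟩, ⟨-47692552, -29578530⟩⟩ (by decide +kernel)
  obtain ⟨Z5, X5, f5, e5, h5⟩ := op_lin hv h4 h2 1 (-1) 1 zF (by decide +kernel)
  have g1 : Z5 = 0 := by rw [f5, f4, f3, f2, f1]; push_cast; ring
  have g2 : X5 = A + D + B - c * (N - N0) := by rw [e5, e4, e3, e2, e1]; push_cast; ring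
  rwa [g1, g2] at h5

lemma sum_BC (N x y : ℝ) (hN : 0 < N) (hx : 0 < x) (hy : 0 < y) (h : 0 < x * y - N ^ 2) :
    Real.arctan (N / x) + Real.arctan (N / y) = Real.arctan (N * (x + y) / 1000 / ((x * y - N ^ 2) / 1000)) := by
  rw [Real.arctan_add]
  · congr 1
    have : 1 - N / x * (N / y) = (x * y - N ^ 2) / (x * y) := by field_simp
    rw [this]
    field_simp
    ring
  · rw [div_mul_div_comm, div_lt_one (by positivity)]
    nlinarith

lemma pos_BC (x y : ℝ) (h1 : 0 < x + y) (h2 : 0 < x * y) : 0 < x ∧ 0 < y := by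
  rcases pos_and_pos_or_neg_and_neg_of_mul_pos h2 with h | h
  · exact h
  · linarith [h.1, h.2]

lemma c_bd (ℓ N0 : ℝ) (hl1 : 33013602 / 10000000 ≤ ℓ) (hl2 : ℓ ≤ 33013604 / 10000000) (hN : 0 < N0)
    (hl4 : ℓ ^ 4 - 12 * ℓ ^ 2 + 12 = 0) (e : N0 ^ 2 = gr ℓ ℓ 2 2 2 2) : mem (angs N0 ℓ ℓ 2 2 2 2 / N0) ⟨19450000, 19750000⟩ := by
  have eg : gr ℓ ℓ 2 2 2 2 = 4 * ℓ ^ 2 - 4 := by unfold gr; linear_combination -hl4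
  have eA : dd ℓ ℓ 2 2 2 2 = ℓ ^ 3 + 4 * ℓ ^ 2 - 4 := by unfold dd; ring
  have eB : dd ℓ 2 2 2 2 ℓ = ℓ ^ 2 + 6 * ℓ + 4 := by unfold dd; ring
  have eD : dd 2 2 2 2 ℓ ℓ = 28 - 2 * ℓ ^ 2 := by unfold dd; ring
  have s1 : 10898 / 1000 ≤ ℓ ^ 2 := by nlinarith
  have s2 : ℓ ^ 2 ≤ 10900 / 1000 := by nlinarith
  have t1 : 3597 / 100 ≤ ℓ ^ 3 := by nlinarith
  have t2 : ℓ ^ 3 ≤ 3599 / 100 := by nlinarith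
  rw [eg] at e
  have n1 : 6292 / 1000 ≤ N0 := by
    apply le_of_sq_le_sq _ hN.le
    nlinarith
  have n2 : N0 ≤ 6293 / 1000 := by
    apply le_of_sq_le_sq _ (by norm_num)
    nlinarith
  have pA : 0 < ℓ ^ 3 + 4 * ℓ ^ 2 - 4 := by linarith
  have pB : 0 < ℓ ^ 2 + 6 * ℓ + 4 := by linarith
  have pD : 0 < 28 - 2 * ℓ ^ 2 := by linarith
  have u1 : 832 / 10000 ≤ N0 / (ℓ ^ 3 + 4 * ℓ ^ 2 - 4) := by rw [le_div_iff₀ pA]; linarith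
  have u2 : N0 / (ℓ ^ 3 + 4 * ℓ ^ 2 - 4) ≤ 833 / 10000 := by rw [div_le_iff₀ pA]; linarith
  have w1 : 1812 / 10000 ≤ N0 / (ℓ ^ 2 + 6 * ℓ + 4) := by rw [le_div_iff₀ pB]; linarith
  have w2 : N0 / (ℓ ^ 2 + 6 * ℓ + 4) ≤ 1814 / 10000 := by rw [div_le_iff₀ pB]; linarith
  have z1 : 1 ≤ N0 / (28 - 2 * ℓ ^ 2) := by rw [le_div_iff₀ pD]; linarith
  have z2 : N0 / (28 - 2 * ℓ ^ 2) ≤ (1 + 3 / 400) / (1 - 1 * (3 / 400)) := by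
    rw [div_le_iff₀ pD]; norm_num; linarith
  have U1 := (le_arctan (x := 832 / 10000) (by norm_num)).trans (Real.arctan_strictMono.monotone u1)
  have U2 := (arctan_le (le_trans (by norm_num) u1)).trans u2
  have W1 := (le_arctan (x := 1812 / 10000) (by norm_num)).trans (Real.arctan_strictMono.monotone w1)
  have W2 := (arctan_le (le_trans (by norm_num) w1)).trans w2
  have Z1 := Real.arctan_strictMono.monotone z1
  have Z2 := Real.arctan_strictMono.monotone z2
  rw [← Real.arctan_add (by norm_num)] at Z2
  rw [Real.arctan_one] at Z1 Z2
  have Z3 := arctan_le (x := 3 / 400) (by norm_num)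
  have q1 := Real.pi_gt_d4
  have q2 := Real.pi_lt_d4
  have ea : angs N0 ℓ ℓ 2 2 2 2 = Real.arctan (N0 / (ℓ ^ 3 + 4 * ℓ ^ 2 - 4)) + Real.arctan (N0 / (ℓ ^ 2 + 6 * ℓ + 4))
      + Real.arctan (N0 / (ℓ ^ 2 + 6 * ℓ + 4)) + Real.arctan (N0 / (28 - 2 * ℓ ^ 2)) := by
    unfold angs; rw [eA, eB, eD]
  rw [ea]
  unfold mem
  push_cast
  rw [← mul_div_assoc, le_div_iff₀ hN, div_le_iff₀ hN]
  norm_num at *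
  constructor <;> linarith

theorem num (ℓ a b p q s t N N0 : ℝ) (hl : mem ℓ ⟨330136024, 330136025⟩) (hl4 : ℓ ^ 4 - 12 * ℓ ^ 2 + 12 = 0)
    (ha : |a - ℓ| ≤ 13956 / 1000000) (hb : |b - ℓ| ≤ 13956 / 1000000)
    (hp : p ∈ Set.Icc 2 (2 + 13956 / 1000000)) (hq : q ∈ Set.Icc 2 (2 + 13956 / 1000000))
    (hs : s ∈ Set.Icc 2 (2 + 13956 / 1000000)) (ht : t ∈ Set.Icc 2 (2 + 13956 / 1000000))
    (hN : 0 < N) (hN2 : N ^ 2 = gr a b p t s q) (hN0 : 0 < N0) (hN02 : N0 ^ 2 = gr ℓ ℓ 2 2 2 2)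
    (hC : ((a * t + b * s) ^ 2 - (p * q) ^ 2) * ((p * q) ^ 2 - (a * t - b * s) ^ 2) ≤ 64 * gr a b p t s q) :
    (0 < dd a b p t s q ∧ 0 < dd a q s t p b ∧ 0 < dd b q t s p a ∧ 0 < dd p s t q b a) ∧
    (0 < dd ℓ ℓ 2 2 2 2 ∧ 0 < dd ℓ 2 2 2 2 ℓ ∧ 0 < dd 2 2 2 2 ℓ ℓ) ∧
    N0 * angs N a b p q s t ≤ N * angs N0 ℓ ℓ 2 2 2 2 := by
  obtain ⟨v, ev⟩ : ∃ v, v = vv ℓ a b p q s t := ⟨_, rfl⟩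
  have hv : VV v := by rw [ev]; exact vv_mem ℓ a b p q s t ha hb hp hq hs ht
  obtain ⟨hG, hA, hD, hS, hM, hCC⟩ := poly ℓ a b p q s t hl ha hb hp hq hs ht v ev
  have hc := c_bd ℓ N0 (by have := hl.1; push_cast at this; linarith) (by have := hl.2; push_cast at this; linarith) hN0 hl4 hN02
  have hNN := op_N hv _ _ N N0 hG hN hN0 hN2 hN02
  have pA := mem_pos hA.2.1 (by decide +kernel)
  have pA0 := mem_pos hA.1 (by decide +kernel)
  have pD := mem_pos hD.2.1 (by decide +kernel)
  have pD0 := mem_pos hD.1 (by decide +kernel)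
  have pS := mem_pos hS.2.1 (by decide +kernel)
  have pS0 := mem_pos hS.1 (by decide +kernel)
  have pM := mem_pos hM.2.1 (by decide +kernel)
  have pM0 := mem_pos hM.1 (by decide +kernel)
  have pB0 : 0 < dd ℓ 2 2 2 2 ℓ := by linarith
  obtain ⟨pB, pC⟩ := pos_BC (dd a q s t p b) (dd b q t s p a) pS (by nlinarith [sq_nonneg N])
  refine ⟨⟨pA, pB, pC, pD⟩, ⟨pA0, pB0, pD0⟩, ?_⟩
  have rA := angA hv hNN hA hN0 hN pA0 pA
  have rD := angD hv hNN hD hN0 hN pD0 pD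
  have hY := op_Y hv hNN hS
  have hX := op_X hv hM
  have rB := angB hv hY hX (by positivity) (by positivity) (by positivity) (by positivity)
  rw [← hN2, ← hN02] at rB
  rw [← hN2] at pM
  rw [← hN02] at pM0
  rw [← sum_BC N _ _ hN pB pC (by linarith), ← sum_BC N0 _ _ hN0 pB0 pB0 (by linarith)] at rB
  have hF := op_F hv rA rD rB hNN hc
  have z : 64 * gr ℓ ℓ 2 2 2 2 - ((ℓ * 2 + ℓ * 2) ^ 2 - (2 * 2) ^ 2) * ((2 * 2) ^ 2 - (ℓ * 2 - ℓ * 2) ^ 2) = 0 := by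
    unfold gr; linear_combination (-64) * hl4
  rw [z] at hCC
  have fin := op_final hv hF hCC (by decide +kernel) (by linarith)
  have e1 : angs N a b p q s t - angs N0 ℓ ℓ 2 2 2 2 - angs N0 ℓ ℓ 2 2 2 2 / N0 * (N - N0) ≤ 0 := by
    refine le_of_eq_of_le ?_ fin
    unfold angs
    ring
  have e2 : angs N0 ℓ ℓ 2 2 2 2 / N0 * (N - N0) = angs N0 ℓ ℓ 2 2 2 2 / N0 * N - angs N0 ℓ ℓ 2 2 2 2 := by
    field_simp
  have e3 : angs N a b p q s t ≤ angs N0 ℓ ℓ 2 2 2 2 / N0 * N := by linarith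
  rw [div_mul_eq_mul_div, le_div_iff₀ hN0] at e3
  linarith

end RR


open MeasureTheory Metric
namespace RR

lemma gr_sc (r x1 x2 x3 y1 y2 y3 : ℝ) :
    gr (r * x1) (r * x2) (r * x3) (r * y1) (r * y2) (r * y3) = r ^ 6 * gr x1 x2 x3 y1 y2 y3 := by
  unfold gr; ring

lemma dd_sc (r x1 x2 x3 y1 y2 y3 : ℝ) :
    dd (r * x1) (r * x2) (r * x3) (r * y1) (r * y2) (r * y3) = r ^ 3 * dd x1 x2 x3 y1 y2 y3 := by
  unfold dd; ring

lemma angs_sc (r N a b p q s t : ℝ) (hr : 0 < r) :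
    angs (r ^ 3 * N) (r * a) (r * b) (r * p) (r * q) (r * s) (r * t) = angs N a b p q s t := by
  have : r ^ 3 ≠ 0 := by positivity
  unfold angs
  simp only [dd_sc, mul_div_mul_left _ _ this]

lemma QF_sc (r x1 x2 x3 y1 y2 y3 : ℝ) (h : QF 1 x1 x2 x3 y1 y2 y3) :
    QF r (r * x1) (r * x2) (r * x3) (r * y1) (r * y2) (r * y3) := by
  intro u v w hu hv hw
  have := mul_le_mul_of_nonneg_left (h u v w hu hv hw) (sq_nonneg r)
  linarith

lemma QF_A (ℓ : ℝ) (h : 10 ≤ ℓ ^ 2) : QF 1 ℓ ℓ 2 2 2 2 := by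
  intro u v w hu hv hw
  have a1 := mul_nonneg hu hv
  have a2 := mul_nonneg hu hw
  have a3 := mul_nonneg hv hw
  nlinarith [mul_nonneg a1 (sub_nonneg.2 h), mul_nonneg a2 (sub_nonneg.2 h), mul_nonneg a3 (sub_nonneg.2 h),
    mul_nonneg (sq_nonneg u) (sub_nonneg.2 h), mul_nonneg (sq_nonneg v) (sub_nonneg.2 h), sq_nonneg w,
    sq_nonneg u, sq_nonneg v]

lemma QF_B (ℓ : ℝ) (h : 10 ≤ ℓ ^ 2) : QF 1 ℓ 2 2 2 2 ℓ := by
  intro u v w hu hv hw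
  have a1 := mul_nonneg hu hv
  have a2 := mul_nonneg hu hw
  have a3 := mul_nonneg hv hw
  nlinarith [mul_nonneg a2 (sub_nonneg.2 h),
    mul_nonneg (sq_nonneg u) (sub_nonneg.2 h), sq_nonneg w, sq_nonneg u, sq_nonneg v]

lemma QF_D (ℓ k : ℝ) (hk : k ^ 2 = 6) (h : ℓ ^ 2 = 6 + 2 * k) : QF 1 2 2 2 2 ℓ ℓ := by
  intro u v w hu hv hw
  rw [h]
  have e : (v + w) ^ 2 * (k ^ 2) = (v + w) ^ 2 * 6 := by rw [hk]
  nlinarith [sq_nonneg (u - k * (v + w) / 3), sq_nonneg (v - w)]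

lemma exN (r : ℝ) (hr : 0 < r) (A B C D : E3) (haff : AffineIndependent ℝ ![A, B, C, D])
    (a b p q s t : ℝ) (hAB : dist A B = r * a)
    (hAC : dist A C = r * b) (hAD : dist A D = r * p) (hBC : dist B C = r * q) (hBD : dist B D = r * s)
    (hCD : dist C D = r * t) : ∃ N : ℝ, 0 < N ∧ N ^ 2 = gr a b p t s q := by
  have h1 := det3_ne A B C D haff
  have h2 := det_gr A B C D _ _ _ _ _ _ hAB hAC hAD hCD hBD hBC
  rw [gr_sc] at h2
  refine ⟨|det3 (B - A) (C - A) (D - A)| / r ^ 3, by positivity, ?_⟩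
  rw [div_pow, sq_abs, h2]
  field_simp

set_option maxHeartbeats 1000000 in
lemma main (r ℓ k : ℝ) (hr : 0 < r) (hk : k ^ 2 = 6) (h : ℓ ^ 2 = 6 + 2 * k)
    (hl : mem ℓ ⟨330136024, 330136025⟩)
    (A B C D A₀ B₀ C₀ D₀ : E3) (haff : AffineIndependent ℝ ![A, B, C, D])
    (a b p q s t : ℝ) (hAB : dist A B = r * a)
    (hAC : dist A C = r * b) (hAD : dist A D = r * p) (hBC : dist B C = r * q) (hBD : dist B D = r * s)
    (hCD : dist C D = r * t)
    (ha : |a - ℓ| ≤ 13956 / 1000000) (hb : |b - ℓ| ≤ 13956 / 1000000)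
    (hp : p ∈ Set.Icc 2 (2 + 13956 / 1000000)) (hq : q ∈ Set.Icc 2 (2 + 13956 / 1000000))
    (hs : s ∈ Set.Icc 2 (2 + 13956 / 1000000)) (ht : t ∈ Set.Icc 2 (2 + 13956 / 1000000))
    (O : E3) (ρ : ℝ) (hρ0 : 0 < ρ) (hρ : ρ ≤ 2 * r)
    (oA : dist O A = ρ) (oB : dist O B = ρ) (oC : dist O C = ρ) (oD : dist O D = ρ)
    (haff₀ : AffineIndependent ℝ ![A₀, B₀, C₀, D₀])
    (hAB₀ : dist A₀ B₀ = r * ℓ) (hAC₀ : dist A₀ C₀ = r * ℓ)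
    (hAD₀ : dist A₀ D₀ = r * 2) (hBC₀ : dist B₀ C₀ = r * 2)
    (hBD₀ : dist B₀ D₀ = r * 2) (hCD₀ : dist C₀ D₀ = r * 2) :
    density A B C D r r r r ≤ density A₀ B₀ C₀ D₀ r r r r := by
  have l1 : 33 / 10 ≤ ℓ := by have := hl.1; push_cast at this; linarith
  have l2 : 10 ≤ ℓ ^ 2 := by nlinarith only [l1]
  have hl4 : ℓ ^ 4 - 12 * ℓ ^ 2 + 12 = 0 := by
    have : ℓ ^ 4 = (ℓ ^ 2) ^ 2 := by ring
    rw [this, h]; linear_combination 4 * hk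
  obtain ⟨N, hN, hN2⟩ := exN r hr A B C D haff a b p q s t hAB hAC hAD hBC hBD hCD
  obtain ⟨N0, hN0, hN02⟩ := exN r hr A₀ B₀ C₀ D₀ haff₀ _ _ _ _ _ _ hAB₀ hAC₀ hAD₀ hBC₀ hBD₀ hCD₀
  have hcirc := circum A B C D O _ _ _ _ _ _ ρ hAB hAC hAD hBC hBD hCD haff oA oB oC oD
  rw [gr_sc] at hcirc
  have hC : ((a * t + b * s) ^ 2 - (p * q) ^ 2) * ((p * q) ^ 2 - (a * t - b * s) ^ 2) ≤ 64 * gr a b p t s q := by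
    have e1 : r ^ 8 * (((a * t + b * s) ^ 2 - (p * q) ^ 2) * ((p * q) ^ 2 - (a * t - b * s) ^ 2)) =
        r ^ 6 * (16 * ρ ^ 2 * gr a b p t s q) := by
      rw [← mul_assoc] at hcirc ⊢
      linear_combination hcirc
    have g0 : 0 < gr a b p t s q := by rw [← hN2]; positivity
    have e2 : ρ ^ 2 ≤ (2 * r) ^ 2 := by gcongr
    have e3 : r ^ 6 * (16 * ρ ^ 2 * gr a b p t s q) ≤ r ^ 6 * (16 * (2 * r) ^ 2 * gr a b p t s q) := by gcongr
    refine le_of_mul_le_mul_left ?_ (show 0 < r ^ 8 by positivity)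
    rw [e1]
    refine e3.trans (le_of_eq ?_)
    ring
  obtain ⟨⟨dA, dB, dC, dD⟩, ⟨dA0, dB0, dD0⟩, key⟩ :=
    num ℓ a b p q s t N N0 hl hl4 ha hb hp hq hs ht hN hN2 hN0 hN02 hC
  have hr3 : 0 < r ^ 3 := by positivity
  have pa : 0 < a := by rw [abs_le] at ha; linarith
  have pb : 0 < b := by rw [abs_le] at hb; linarith
  have pp : 0 < p := by linarith [hp.1]
  have pq : 0 < q := by linarith [hq.1]
  have ps : 0 < s := by linarith [hs.1]
  have pt : 0 < t := by linarith [ht.1]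
  have up := dens_up r hr A B C D _ _ _ _ _ _ (r ^ 3 * N) hAB hAC hAD hBC hBD hCD (by positivity)
    (by positivity) (by positivity) (by positivity) (by positivity) (by positivity) (by positivity)
    (by rw [gr_sc, ← hN2]; ring) (by rw [dd_sc]; positivity) (by rw [dd_sc]; positivity)
    (by rw [dd_sc]; positivity) (by rw [dd_sc]; positivity)
  have hr2 : 2 * r ≤ r * ℓ := by
    rw [mul_comm]; exact mul_le_mul_of_nonneg_left (by linarith) hr.le
  have lo := dens_lo r hr A₀ B₀ C₀ D₀ _ _ _ _ _ _ (r ^ 3 * N0) hAB₀ hAC₀ hAD₀ hBC₀ hBD₀ hCD₀ hr2 hr2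
    (by linarith) (by linarith) (by linarith) (by linarith) (by positivity)
    (by rw [gr_sc, ← hN02]; ring) (by rw [dd_sc]; positivity) (by rw [dd_sc]; positivity)
    (by rw [dd_sc]; positivity) (by rw [dd_sc]; positivity)
    (QF_sc _ _ _ _ _ _ _ (QF_A ℓ l2)) (QF_sc _ _ _ _ _ _ _ (QF_B ℓ l2)) (QF_sc _ _ _ _ _ _ _ (QF_B ℓ l2))
    (QF_sc _ _ _ _ _ _ _ (QF_D ℓ k hk h))
  rw [angs_sc _ _ _ _ _ _ _ _ hr] at up lo
  refine up.trans (le_trans ?_ lo)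
  have hk0 : 0 ≤ (kap r).toReal := ENNReal.toReal_nonneg
  have hk3 : 0 ≤ kap3 := ENNReal.toReal_nonneg
  have e : ∀ n x : ℝ, 0 < n → (kap r).toReal * x / (r ^ 3 * n * kap3) = (kap r).toReal / (r ^ 3 * kap3) * (x / n) := by
    intro n x hn
    rw [div_mul_div_comm]
    ring
  rw [e N _ hN, e N0 _ hN0]
  apply mul_le_mul_of_nonneg_left _ (by positivity)
  rw [div_le_div_iff₀ hN hN0]
  linarith

lemma sqrt6 : 2449489742 / 1000000000 ≤ Real.sqrt 6 ∧ Real.sqrt 6 ≤ 2449489743 / 1000000000 :=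
  ⟨Real.le_sqrt_of_sq_le (by norm_num), Real.sqrt_le_iff.2 ⟨by norm_num, by norm_num⟩⟩

lemma ell_mem : mem (Real.sqrt (2 * Real.sqrt 6 + 6)) ⟨330136024, 330136025⟩ := by
  obtain ⟨h1, h2⟩ := sqrt6
  have a : 330136024 / 100000000 ≤ Real.sqrt (2 * Real.sqrt 6 + 6) :=
    Real.le_sqrt_of_sq_le (by norm_num at *; linarith)
  have b : Real.sqrt (2 * Real.sqrt 6 + 6) ≤ 330136025 / 100000000 :=
    Real.sqrt_le_iff.2 ⟨by norm_num, by norm_num at *; linarith⟩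
  unfold mem
  push_cast
  constructor <;> linarith

lemma edge_l (r x ℓ : ℝ) (hr : 41421 / 100000 ≤ r) (h : x ∈ Set.Icc (r * ℓ - 1 / 173) (r * ℓ + 1 / 173)) :
    |x / r - ℓ| ≤ 13956 / 1000000 := by
  have h0 : 0 < r := by linarith
  obtain ⟨h1, h2⟩ := h
  have e : x / r - ℓ = (x - r * ℓ) / r := by field_simp
  rw [e, abs_le, le_div_iff₀ h0, div_le_iff₀ h0]
  constructor <;> linarith

lemma edge_2 (r x : ℝ) (hr : 41421 / 100000 ≤ r) (h : x ∈ Set.Icc (2 * r) (2 * r + 1 / 173)) :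
    x / r ∈ Set.Icc 2 (2 + 13956 / 1000000) := by
  have h0 : 0 < r := by linarith
  obtain ⟨h1, h2⟩ := h
  rw [Set.mem_Icc, le_div_iff₀ h0, div_le_iff₀ h0]
  constructor <;> linarith

end RR

theorem local_rrrr
    (A B C D A₀ B₀ C₀ D₀ : EuclideanSpace ℝ (Fin 3))
    (haff : AffineIndependent ℝ ![A, B, C, D])
    (hAB : dist A B ∈ Set.Icc
      ((Real.sqrt 2 - 1) * Real.sqrt (2 * Real.sqrt 6 + 6) - 1 / 173)
      ((Real.sqrt 2 - 1) * Real.sqrt (2 * Real.sqrt 6 + 6) + 1 / 173))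
    (hAC : dist A C ∈ Set.Icc
      ((Real.sqrt 2 - 1) * Real.sqrt (2 * Real.sqrt 6 + 6) - 1 / 173)
      ((Real.sqrt 2 - 1) * Real.sqrt (2 * Real.sqrt 6 + 6) + 1 / 173))
    (hAD : dist A D ∈ Set.Icc (2 * (Real.sqrt 2 - 1)) (2 * (Real.sqrt 2 - 1) + 1 / 173))
    (hBC : dist B C ∈ Set.Icc (2 * (Real.sqrt 2 - 1)) (2 * (Real.sqrt 2 - 1) + 1 / 173))
    (hBD : dist B D ∈ Set.Icc (2 * (Real.sqrt 2 - 1)) (2 * (Real.sqrt 2 - 1) + 1 / 173))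
    (hCD : dist C D ∈ Set.Icc (2 * (Real.sqrt 2 - 1)) (2 * (Real.sqrt 2 - 1) + 1 / 173))
    (hdisjAB : 2 * (Real.sqrt 2 - 1) ≤ dist A B)
    (hdisjAC : 2 * (Real.sqrt 2 - 1) ≤ dist A C)
    (hsupp : ∃ O : EuclideanSpace ℝ (Fin 3), ∃ R : ℝ, 0 < R ∧ R ≤ Real.sqrt 2 - 1 ∧
      dist O A = (Real.sqrt 2 - 1) + R ∧ dist O B = (Real.sqrt 2 - 1) + R ∧
      dist O C = (Real.sqrt 2 - 1) + R ∧ dist O D = (Real.sqrt 2 - 1) + R)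
    (haff₀ : AffineIndependent ℝ ![A₀, B₀, C₀, D₀])
    (hAB₀ : dist A₀ B₀ = (Real.sqrt 2 - 1) * Real.sqrt (2 * Real.sqrt 6 + 6))
    (hAC₀ : dist A₀ C₀ = (Real.sqrt 2 - 1) * Real.sqrt (2 * Real.sqrt 6 + 6))
    (hAD₀ : dist A₀ D₀ = 2 * (Real.sqrt 2 - 1)) (hBC₀ : dist B₀ C₀ = 2 * (Real.sqrt 2 - 1))
    (hBD₀ : dist B₀ D₀ = 2 * (Real.sqrt 2 - 1)) (hCD₀ : dist C₀ D₀ = 2 * (Real.sqrt 2 - 1)) :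
    density A B C D (Real.sqrt 2 - 1) (Real.sqrt 2 - 1) (Real.sqrt 2 - 1) (Real.sqrt 2 - 1) ≤
      density A₀ B₀ C₀ D₀ (Real.sqrt 2 - 1) (Real.sqrt 2 - 1) (Real.sqrt 2 - 1)
        (Real.sqrt 2 - 1) := by
  have hr : 41421 / 100000 ≤ Real.sqrt 2 - 1 := by
    have : 141421 / 100000 ≤ Real.sqrt 2 := Real.le_sqrt_of_sq_le (by norm_num)
    linarith
  obtain ⟨r, er⟩ : ∃ r, r = Real.sqrt 2 - 1 := ⟨_, rfl⟩
  obtain ⟨ℓ, el⟩ : ∃ ℓ, ℓ = Real.sqrt (2 * Real.sqrt 6 + 6) := ⟨_, rfl⟩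
  have hl := RR.ell_mem
  have hk : Real.sqrt 6 ^ 2 = 6 := Real.sq_sqrt (by norm_num)
  have h : Real.sqrt (2 * Real.sqrt 6 + 6) ^ 2 = 6 + 2 * Real.sqrt 6 := by
    rw [Real.sq_sqrt (by positivity)]; ring
  obtain ⟨O, R, hR0, hR, oA, oB, oC, oD⟩ := hsupp
  rw [← el] at hl h hAB hAC hAB₀ hAC₀
  rw [← er] at hr hAB hAC hAD hBC hBD hCD hR oA oB oC oD hAB₀ hAC₀ hAD₀ hBC₀ hBD₀ hCD₀ ⊢
  have h0 : 0 < r := by linarith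
  have hd : ∀ x : ℝ, x = r * (x / r) := fun x => by field_simp
  exact RR.main r ℓ _ h0 hk h hl A B C D A₀ B₀ C₀ D₀ haff _ _ _ _ _ _ (hd _) (hd _) (hd _) (hd _)
    (hd _) (hd _) (RR.edge_l _ _ _ hr hAB) (RR.edge_l _ _ _ hr hAC) (RR.edge_2 _ _ hr hAD)
    (RR.edge_2 _ _ hr hBC) (RR.edge_2 _ _ hr hBD) (RR.edge_2 _ _ hr hCD) O (r + R) (by linarith)
    (by linarith) oA oB oC oD haff₀ hAB₀ hAC₀ (by rw [hAD₀]; ring) (by rw [hBC₀]; ring)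
    (by rw [hBD₀]; ring) (by rw [hCD₀]; ring)
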